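/- arXiv:1908.05631 — 3 statements merged into one kernel-verified Lean document; each statement's English description precedes it below -/
import Mathlib

section
/- There exist constants C > 0 and q₀ > 0, depending only on C₀, σ, and β, such that for every q ≥ q₀ the following resolvent estimate holds: if u : ℝ² → ℂ is twice continuously differentiable, 2π-periodic in each variable, and f : ℝ² → ℂ is defined by f = −(∂ₓ²u + ∂ᵧ²u) + i·q·W(x)·u − q²·u, then ∫_{[−π,π]²} |u|² ≤ C² · q^{2/(β+2)} · ∫_{[−π,π]²} |f|². -/
open Real MeasureTheory intervalIntegral

/-- The model damping profile `V(x) = 0` for `|x| ≤ σ`, `V(x) = (|x| - σ)^β` otherwise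
(used only on the period `[-π, π]`). -/
noncomputable def dampV (σ β : ℝ) (x : ℝ) : ℝ :=
  if |x| ≤ σ then 0 else (|x| - σ) ^ β

lemma le_of_sq_le' {a b : ℝ} (h : a ^ 2 ≤ b ^ 2) (hb : 0 ≤ b) : a ≤ b := by
  nlinarith [abs_le_of_sq_le_sq h hb, le_abs_self a]

lemma alg_aux (C1 : ℝ) (h1 : 1 ≤ C1) (X t E : ℝ) (hX : 0 ≤ X) (ht : 0 ≤ t)
    (hS : t ^ 2 ≤ C1 * (X * t + X ^ 2) + 2 * E)
    (hE : E ^ 2 ≤ C1 * (X ^ 2 * t ^ 2 + X ^ 3 * t + X * t ^ 3)) : t ≤ 48 * C1 * X := by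
  by_contra hcon
  push Not at hcon
  have htpos : 0 < t := lt_of_le_of_lt (by positivity) hcon
  have hCX : 0 ≤ C1 * X := by positivity
  have hXC : X ≤ C1 * X := by nlinarith
  have hXt : X ≤ t := by nlinarith
  have a1 : X ^ 2 ≤ X * t := by nlinarith
  have a2 : X ^ 2 * t ^ 2 ≤ X * t ^ 3 := by
    have := mul_le_mul_of_nonneg_right a1 (sq_nonneg t); nlinarith
  have a3 : X ^ 3 * t ≤ X * t ^ 3 := by
    have : X ^ 3 * t = X ^ 2 * (X * t) := by ring
    have : X ^ 2 * (X * t) ≤ (X * t) * (X * t) := by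
      apply mul_le_mul_of_nonneg_right a1; positivity
    nlinarith
  have b1 : C1 * (X * t + X ^ 2) ≤ t ^ 2 / 24 := by nlinarith
  have b2 : E ^ 2 ≤ (t ^ 2 / 4) ^ 2 := by
    have e : C1 * (X ^ 2 * t ^ 2 + X ^ 3 * t + X * t ^ 3) ≤ 3 * (C1 * X) * t ^ 3 := by nlinarith
    have : 3 * (C1 * X) * t ^ 3 ≤ 3 * (t / 48) * t ^ 3 := by
      have : 0 < t ^ 3 := by positivity
      nlinarith
    nlinarith
  have b3 : E ≤ t ^ 2 / 4 := le_of_sq_le' b2 (by positivity)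
  nlinarith

set_option maxHeartbeats 1000000 in
lemma alg_main (Γ : ℝ) (hΓ : 1 ≤ Γ) (n φ D B E P S μ Λ q : ℝ)
    (hn : 0 ≤ n) (hφ : 0 ≤ φ) (hD : 0 ≤ D) (hS : 0 ≤ S) (hΛ : 1 ≤ Λ)
    (hq : 1 ≤ q) (hμ : 1 ≤ Γ * μ) (hμq : μ ≤ q ^ 2) (hΛq : Λ ^ 2 ≤ q)
    (hDn : D ≤ φ * n) (hB : B ≤ Γ * ((μ + Λ ^ 2) * D + φ ^ 2))
    (hE : E ^ 2 ≤ D * (Γ * B + Γ * Λ * S)) (hP : P ^ 2 ≤ φ ^ 2 * (Γ * S))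
    (hSS : q * S ≤ Γ * (B + μ * D) + q * (2 * E + 2 * P)) (hnS : μ * n ^ 2 ≤ Γ * S) :
    n ^ 2 ≤ (480 * Γ ^ 5) ^ 2 * Λ ^ 2 * φ ^ 2 := by
  have hμ0 : 0 < μ := by
    by_contra h; push Not at h; nlinarith
  obtain ⟨t, ht, rfl⟩ : ∃ t : ℝ, 0 ≤ t ∧ S = t ^ 2 := ⟨√S, sqrt_nonneg _, (sq_sqrt hS).symm⟩
  set X := Λ * φ with hX
  have hX0 : 0 ≤ X := by positivity
  have hφX : φ ≤ X := by nlinarith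
  have hnt : n ≤ Γ * t := by
    apply le_of_sq_le' _ (by positivity)
    have : n ^ 2 ≤ Γ * (μ * n ^ 2) := by nlinarith [sq_nonneg n]
    nlinarith
  have hμn : μ * n ≤ q * (Γ * t) := by
    apply le_of_sq_le' _ (by positivity)
    have e1 : (μ * n) ^ 2 = μ * (μ * n ^ 2) := by ring
    have e2 : μ * (μ * n ^ 2) ≤ μ * (Γ * t ^ 2) := by gcongr
    have e3 : μ * (Γ * t ^ 2) ≤ q ^ 2 * (Γ * t ^ 2) := by gcongr
    have e4 : Γ * t ^ 2 ≤ Γ ^ 2 * t ^ 2 := by gcongr; nlinarith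
    have e5 : q ^ 2 * (Γ * t ^ 2) ≤ q ^ 2 * (Γ ^ 2 * t ^ 2) := by gcongr
    nlinarith
  have g1 : Γ ≤ Γ ^ 2 := by nlinarith
  have g3 : Γ ^ 2 ≤ Γ ^ 3 := by nlinarith
  have g4 : Γ ^ 3 ≤ Γ ^ 4 := by
    have : 0 ≤ Γ ^ 3 := by positivity
    nlinarith
  have hμD : μ * D ≤ q * (Γ * (X * t)) := by
    calc μ * D ≤ μ * (φ * n) := by gcongr
      _ = φ * (μ * n) := by ring
      _ ≤ X * (q * (Γ * t)) := by gcongr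
      _ = _ := by ring
  have hDX : D ≤ Γ * (X * t) := by
    calc D ≤ φ * n := hDn
      _ ≤ X * (Γ * t) := by gcongr
      _ = _ := by ring
  have hΛD : Λ ^ 2 * D ≤ q * (Γ * (X * t)) := by gcongr
  have hBq : B ≤ q * (2 * Γ ^ 2 * (X * t) + Γ * X ^ 2) := by
    have : φ ^ 2 ≤ q * X ^ 2 := by
      calc φ ^ 2 ≤ X ^ 2 := by gcongr
        _ ≤ q * X ^ 2 := by nlinarith [sq_nonneg X]
    calc B ≤ Γ * ((μ + Λ ^ 2) * D + φ ^ 2) := hB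
      _ ≤ Γ * (q * (Γ * (X * t)) + q * (Γ * (X * t)) + q * X ^ 2) := by
        gcongr; linarith
      _ = _ := by ring
  have hPX : P ≤ Γ * (X * t) := by
    apply le_of_sq_le' _ (by positivity)
    calc P ^ 2 ≤ φ ^ 2 * (Γ * t ^ 2) := hP
      _ ≤ X ^ 2 * (Γ ^ 2 * t ^ 2) := by gcongr
      _ = _ := by ring
  have hS1 : t ^ 2 ≤ 10 * Γ ^ 4 * (X * t + X ^ 2) + 2 * E := by
    have : q * t ^ 2 ≤ q * (Γ * ((2 * Γ ^ 2 * (X * t) + Γ * X ^ 2) + Γ * (X * t)) + 2 * E + 2 * (Γ * (X * t))) := by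
      have := mul_le_mul_of_nonneg_left hBq (by linarith : 0 ≤ Γ)
      have := mul_le_mul_of_nonneg_left hμD (by linarith : 0 ≤ Γ)
      have := mul_le_mul_of_nonneg_left hPX (by linarith : 0 ≤ q)
      linarith
    have h2 := le_of_mul_le_mul_left this (by linarith)
    have hXt : 0 ≤ X * t := by positivity
    have hX2 : 0 ≤ X ^ 2 := by positivity
    linarith [mul_nonneg (pow_nonneg (by linarith : 0 ≤ Γ) 4) hXt, mul_nonneg (pow_nonneg (by linarith : 0 ≤ Γ) 4) hX2, mul_le_mul_of_nonneg_right (g1.trans (g3.trans g4)) hXt, mul_le_mul_of_nonneg_right g4 hXt, mul_le_mul_of_nonneg_right (g3.trans g4) hXt, mul_le_mul_of_nonneg_right (g3.trans g4) hX2]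
  have hE1 : E ^ 2 ≤ 10 * Γ ^ 4 * (X ^ 2 * t ^ 2 + X ^ 3 * t + X * t ^ 3) := by
    have c1 : μ * D ^ 2 ≤ Γ * (X ^ 2 * t ^ 2) := by
      calc μ * D ^ 2 ≤ μ * (φ * n) ^ 2 := by gcongr
        _ = φ ^ 2 * (μ * n ^ 2) := by ring
        _ ≤ X ^ 2 * (Γ * t ^ 2) := by gcongr
        _ = _ := by ring
    have c2 : Λ ^ 2 * D ^ 2 ≤ Γ ^ 2 * (X ^ 2 * t ^ 2) := by
      calc Λ ^ 2 * D ^ 2 ≤ Λ ^ 2 * (φ * n) ^ 2 := by gcongr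
        _ = X ^ 2 * n ^ 2 := by rw [hX]; ring
        _ ≤ X ^ 2 * (Γ * t) ^ 2 := by gcongr
        _ = _ := by ring
    have c3 : D * φ ^ 2 ≤ Γ * (X ^ 3 * t) := by
      calc D * φ ^ 2 ≤ (Γ * (X * t)) * X ^ 2 := by gcongr
        _ = _ := by ring
    have c4 : Λ * D * t ^ 2 ≤ Γ * (X * t ^ 3) := by
      calc Λ * D * t ^ 2 ≤ Λ * (φ * n) * t ^ 2 := by gcongr
        _ = X * n * t ^ 2 := by rw [hX]; ring
        _ ≤ X * (Γ * t) * t ^ 2 := by gcongr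
        _ = _ := by ring
    have c5 : D * B ≤ Γ * (μ * D ^ 2 + Λ ^ 2 * D ^ 2 + D * φ ^ 2) := by
      have := mul_le_mul_of_nonneg_left hB hD
      nlinarith
    have y1 : 0 ≤ X ^ 2 * t ^ 2 := by positivity
    have y2 : 0 ≤ X ^ 3 * t := by positivity
    have y3 : 0 ≤ X * t ^ 3 := by positivity
    have c6 : D * (Γ * B + Γ * Λ * t ^ 2) ≤ Γ * (Γ * (Γ * (X ^ 2 * t ^ 2) + Γ ^ 2 * (X ^ 2 * t ^ 2) + Γ * (X ^ 3 * t))) + Γ * (Γ * (X * t ^ 3)) := by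
      calc D * (Γ * B + Γ * Λ * t ^ 2) = Γ * (D * B) + Γ * (Λ * D * t ^ 2) := by ring
        _ ≤ Γ * (Γ * (μ * D ^ 2 + Λ ^ 2 * D ^ 2 + D * φ ^ 2)) + Γ * (Γ * (X * t ^ 3)) := by gcongr
        _ ≤ _ := by gcongr
    refine hE.trans (c6.trans ?_)
    linarith [mul_nonneg (pow_nonneg (by linarith : 0 ≤ Γ) 4) y1, mul_nonneg (pow_nonneg (by linarith : 0 ≤ Γ) 4) y2, mul_nonneg (pow_nonneg (by linarith : 0 ≤ Γ) 4) y3,mul_le_mul_of_nonneg_right g4 y1, mul_le_mul_of_nonneg_right g4 y2, mul_le_mul_of_nonneg_right (g3.trans g4) y3]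
  have g14 : 1 ≤ Γ ^ 4 := one_le_pow₀ hΓ
  have := alg_aux (10 * Γ ^ 4) (by linarith) X t E hX0 ht hS1 hE1
  calc n ^ 2 ≤ (Γ * (48 * (10 * Γ ^ 4) * X)) ^ 2 := by
        gcongr; exact hnt.trans (by gcongr)
    _ = _ := by rw [hX]; ring

/-- Measurable and bounded on the period. -/
def BM (f : ℝ → ℝ) : Prop := Measurable f ∧ ∃ M, ∀ x ∈ Set.Icc (-π) π, |f x| ≤ M

lemma BM.of_cont {f : ℝ → ℝ} (h : Continuous f) : BM f := by
  refine ⟨h.measurable, ?_⟩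
  obtain ⟨M, hM⟩ := isCompact_Icc.exists_bound_of_continuousOn (s := Set.Icc (-π) π) h.continuousOn
  exact ⟨M, hM⟩

lemma BM.mul {f g : ℝ → ℝ} (hf : BM f) (hg : BM g) : BM (fun x => f x * g x) := by
  obtain ⟨hf, M, hM⟩ := hf
  obtain ⟨hg, N, hN⟩ := hg
  refine ⟨hf.mul hg, M * N, fun x hx => ?_⟩
  rw [abs_mul]
  exact mul_le_mul (hM x hx) (hN x hx) (abs_nonneg _) ((abs_nonneg _).trans (hM x hx))

lemma BM.add {f g : ℝ → ℝ} (hf : BM f) (hg : BM g) : BM (fun x => f x + g x) := by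
  obtain ⟨hf, M, hM⟩ := hf
  obtain ⟨hg, N, hN⟩ := hg
  exact ⟨hf.add hg, M + N, fun x hx => (abs_add_le _ _).trans (add_le_add (hM x hx) (hN x hx))⟩

lemma BM.const_mul {f : ℝ → ℝ} (hf : BM f) (c : ℝ) : BM (fun x => c * f x) :=
  (BM.of_cont continuous_const).mul hf

lemma BM.sq {f : ℝ → ℝ} (hf : BM f) : BM (fun x => f x ^ 2) := by
  simp only [pow_two]; exact hf.mul hf

lemma BM.ii {f : ℝ → ℝ} (hf : BM f) {a b : ℝ} (ha : a ∈ Set.Icc (-π) π) (hb : b ∈ Set.Icc (-π) π) :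
    IntervalIntegrable f volume a b := by
  obtain ⟨hf, M, hM⟩ := hf
  rw [intervalIntegrable_iff]
  refine Measure.integrableOn_of_bounded (M := M) ?_ hf.aestronglyMeasurable ?_
  · simp [Set.uIoc]
  · refine (ae_restrict_iff' measurableSet_uIoc).2 (Filter.Eventually.of_forall fun x hx => hM x ?_)
    exact Set.uIcc_subset_Icc ha hb (Set.uIoc_subset_uIcc hx)

lemma pim : -π ∈ Set.Icc (-π) π := ⟨le_rfl, by linarith [pi_pos]⟩
lemma pip : π ∈ Set.Icc (-π) π := ⟨by linarith [pi_pos], le_rfl⟩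

lemma BM.mono {f g : ℝ → ℝ} (hf : BM f) (hg : BM g) (h : ∀ x ∈ Set.Icc (-π) π, f x ≤ g x) :
    ∫ x in (-π)..π, f x ≤ ∫ x in (-π)..π, g x :=
  intervalIntegral.integral_mono_on (by linarith [pi_pos]) (hf.ii pim pip) (hg.ii pim pip) h

lemma BM.nonneg {f : ℝ → ℝ} (h : ∀ x, 0 ≤ f x) :
    0 ≤ ∫ x in (-π)..π, f x :=
  intervalIntegral.integral_nonneg (by linarith [pi_pos]) (fun x _ => h x)

lemma BM.lin4 {f f1 f2 f3 f4 : ℝ → ℝ} (hf : BM f) (h1 : BM f1) (h2 : BM f2) (h3 : BM f3)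
    (h4 : BM f4) (a b c d : ℝ)
    (h : ∀ x ∈ Set.Icc (-π) π, f x ≤ a * f1 x + b * f2 x + c * f3 x + d * f4 x) :
    ∫ x in (-π)..π, f x ≤ a * (∫ x in (-π)..π, f1 x) + b * (∫ x in (-π)..π, f2 x)
      + c * (∫ x in (-π)..π, f3 x) + d * (∫ x in (-π)..π, f4 x) := by
  have k1 := h1.const_mul a
  have k2 := h2.const_mul b
  have k3 := h3.const_mul c
  have k4 := h4.const_mul d
  refine (hf.mono (((k1.add k2).add k3).add k4) h).trans (le_of_eq ?_)
  rw [intervalIntegral.integral_add (((k1.add k2).add k3).ii pim pip) (k4.ii pim pip),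
    intervalIntegral.integral_add ((k1.add k2).ii pim pip) (k3.ii pim pip),
    intervalIntegral.integral_add (k1.ii pim pip) (k2.ii pim pip)]
  simp only [intervalIntegral.integral_const_mul]

lemma BM.cs {h a b : ℝ → ℝ} (hh : BM h) (ha : BM a) (hb : BM b) (ha0 : ∀ x, 0 ≤ a x)
    (hb0 : ∀ x, 0 ≤ b x) (hab : ∀ x, h x ^ 2 ≤ a x * b x) :
    (∫ x in (-π)..π, h x) ^ 2 ≤ (∫ x in (-π)..π, a x) * (∫ x in (-π)..π, b x) := by
  have key : ∀ l : ℝ, 0 ≤ (∫ x in (-π)..π, a x) * (l * l) + (-2 * ∫ x in (-π)..π, h x) * l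
      + (∫ x in (-π)..π, b x) := by
    intro l
    have := BM.lin4 (hh.const_mul (2 * l)) ha hb hb hb (l * l) 1 0 0 (fun x _ => by
      have e : (2 * l * h x) ^ 2 ≤ (l * l * a x + b x) ^ 2 := by
        have := mul_le_mul_of_nonneg_left (hab x) (by positivity : 0 ≤ 4 * l ^ 2)
        nlinarith [sq_nonneg (l * l * a x - b x)]
      have e2 : 0 ≤ l * l * a x + b x :=
        add_nonneg (mul_nonneg (mul_self_nonneg l) (ha0 x)) (hb0 x)
      have := le_of_sq_le' e e2
      linarith)
    rw [intervalIntegral.integral_const_mul] at this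
    linarith
  have := discrim_le_zero key
  rw [discrim] at this
  nlinarith

lemma int_deriv_zero {h h' : ℝ → ℝ} (hd : ∀ x, HasDerivAt h (h' x) x) (hc : Continuous h')
    (hp : h (-π) = h π) : ∫ x in (-π)..π, h' x = 0 := by
  rw [integral_eq_sub_of_hasDerivAt (fun x _ => hd x) (hc.intervalIntegrable _ _), hp, sub_self]

lemma point_le {F F' H : ℝ → ℝ} (hd : ∀ x, HasDerivAt F (F' x) x) (hc : Continuous F')
    (hH : BM H) (hFH : ∀ x ∈ Set.Icc (-π) π, |F' x| ≤ H x) {s : ℝ} (hs0 : -π ≤ s) (hs : s ≤ π) (x : ℝ)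
    (hx : x ∈ Set.Icc (-π) π) :
    (π - s) * F x ≤ (∫ y in s..π, F y) + (π - s) * ∫ y in (-π)..π, H y := by
  have hFc : Continuous F := continuous_iff_continuousAt.2 fun x => (hd x).continuousAt
  have step : ∀ y ∈ Set.Icc s π, F x ≤ F y + ∫ y in (-π)..π, H y := by
    intro y hy
    have hy' : y ∈ Set.Icc (-π) π := ⟨hs0.trans hy.1, hy.2⟩
    have e := integral_eq_sub_of_hasDerivAt (a := y) (b := x) (fun x _ => hd x)
      (hc.intervalIntegrable _ _)
    have e1 : |∫ t in y..x, F' t| ≤ |(∫ t in y..x, |F' t|)| :=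
      norm_integral_le_abs_integral_norm (f := F')
    have e2 : |(∫ t in y..x, |F' t|)| ≤ |(∫ t in (-π)..π, |F' t|)| := by
      apply abs_integral_mono_interval
      · rw [Set.uIoc_of_le (by linarith [pi_pos] : -π ≤ π)]
        intro z hz
        exact ⟨lt_of_le_of_lt (le_min hy'.1 hx.1) hz.1, hz.2.trans (max_le hy'.2 hx.2)⟩
      · exact Filter.Eventually.of_forall fun t => abs_nonneg _
      · exact hc.abs.intervalIntegrable _ _
    have e3 : |(∫ t in (-π)..π, |F' t|)| = ∫ t in (-π)..π, |F' t| :=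
      abs_of_nonneg (BM.nonneg fun t => abs_nonneg _)
    have e4 := BM.mono (BM.of_cont hc.abs) hH hFH
    have := le_abs_self (∫ t in y..x, F' t)
    linarith
  have m := intervalIntegral.integral_mono_on hs (μ := volume) (f := fun _ => F x)
    (g := fun y => F y + ∫ y in (-π)..π, H y) (by simp)
    ((hFc.add continuous_const).intervalIntegrable _ _) step
  rw [intervalIntegral.integral_add (hFc.intervalIntegrable _ _) (by simp)] at m
  simpa using m

open ComplexConjugate in
lemma re_mul_conj_le (a b : ℂ) : |(a * conj b).re| ≤ ‖a‖ * ‖b‖ := by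
  refine (Complex.abs_re_le_norm _).trans (by simp)

open ComplexConjugate in
lemma im_mul_conj_le (a b : ℂ) : |(a * conj b).im| ≤ ‖a‖ * ‖b‖ := by
  refine (Complex.abs_im_le_norm _).trans (by simp)

open ComplexConjugate in
lemma hasDeriv_mul_conj {a b a' b' : ℝ → ℂ} (ha : ∀ x, HasDerivAt a (a' x) x)
    (hb : ∀ x, HasDerivAt b (b' x) x) (x : ℝ) :
    HasDerivAt (fun x => a x * conj (b x)) (a' x * conj (b x) + a x * conj (b' x)) x :=
  (ha x).mul ((hb x).star_conj)

lemma hasDeriv_re {a : ℝ → ℂ} {a' : ℂ} {x : ℝ} (h : HasDerivAt a a' x) :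
    HasDerivAt (fun x => (a x).re) a'.re x :=
  Complex.reCLM.hasFDerivAt.comp_hasDerivAt x h

lemma hasDeriv_im {a : ℝ → ℂ} {a' : ℂ} {x : ℝ} (h : HasDerivAt a a' x) :
    HasDerivAt (fun x => (a x).im) a'.im x :=
  Complex.imCLM.hasFDerivAt.comp_hasDerivAt x h

open ComplexConjugate in
/-- The two weighted energy inequalities. -/
lemma weighted_energy {Q ψ ψ' : ℝ → ℝ} {v v1 v2 g : ℝ → ℂ} {μ : ℝ}
    (hv : ∀ x, HasDerivAt v (v1 x) x) (hv1 : ∀ x, HasDerivAt v1 (v2 x) x) (hv2 : Continuous v2)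
    (hvp : v (-π) = v π) (hv1p : v1 (-π) = v1 π)
    (hg : ∀ x, g x = -v2 x + Complex.I * Q x * v x - μ * v x)
    (hψ : ∀ x, HasDerivAt ψ (ψ' x) x) (hψ' : Continuous ψ') (hψp : ψ (-π) = ψ π)
    (hψ0 : ∀ x, 0 ≤ ψ x) :
    (∃ h : ℝ → ℝ, Continuous h ∧ ∫ x in (-π)..π, h x = 0 ∧
      ∀ x, ψ x * ‖v1 x‖ ^ 2 ≤ h x + μ * (ψ x * ‖v x‖ ^ 2) + ψ x * (‖g x‖ * ‖v x‖)
        + |ψ' x| * (‖v1 x‖ * ‖v x‖)) ∧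
    (∃ h : ℝ → ℝ, Continuous h ∧ ∫ x in (-π)..π, h x = 0 ∧
      ∀ x, ψ x * (Q x * ‖v x‖ ^ 2) ≤ h x + ψ x * (‖g x‖ * ‖v x‖)
        + |ψ' x| * (‖v1 x‖ * ‖v x‖)) := by
  have cv : Continuous v := continuous_iff_continuousAt.2 fun x => (hv x).continuousAt
  have cv1 : Continuous v1 := continuous_iff_continuousAt.2 fun x => (hv1 x).continuousAt
  have cψ : Continuous ψ := continuous_iff_continuousAt.2 fun x => (hψ x).continuousAt
  have e2 : ∀ x, v2 x = -g x + Complex.I * Q x * v x - μ * v x := fun x => by rw [hg]; ring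
  have s0 : ∀ z : ℂ, ‖z‖ ^ 2 = z.re * z.re + z.im * z.im := fun z => by
    rw [← Complex.normSq_eq_norm_sq, Complex.normSq_apply]
  have bd : ∀ x (r : ℝ), |r| ≤ ‖v1 x‖ * ‖v x‖ → -(ψ' x * r) ≤ |ψ' x| * (‖v1 x‖ * ‖v x‖) := by
    intro x r h
    calc -(ψ' x * r) ≤ |ψ' x * r| := neg_le_abs _
      _ = |ψ' x| * |r| := abs_mul _ _
      _ ≤ _ := by gcongr
  constructor
  · refine ⟨fun x => ψ' x * (v1 x * conj (v x)).re +
      ψ x * (v2 x * conj (v x) + v1 x * conj (v1 x)).re, by fun_prop, ?_, ?_⟩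
    · exact int_deriv_zero (fun x => (hψ x).mul (hasDeriv_re (hasDeriv_mul_conj hv1 hv x)))
        (by fun_prop) (by simp only [Pi.mul_apply, hψp, hvp, hv1p])
    · intro x
      have h1 := bd x _ (re_mul_conj_le (v1 x) (v x))
      have h2 : -(‖g x‖ * ‖v x‖) ≤ -(g x * conj (v x)).re :=
        neg_le_neg ((le_abs_self _).trans (re_mul_conj_le (g x) (v x)))
      have h3 : (v2 x * conj (v x) + v1 x * conj (v1 x)).re
        = -(g x * conj (v x)).re - μ * ‖v x‖ ^ 2 + ‖v1 x‖ ^ 2 := by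
        rw [e2, s0, s0]
        simp
        ring
      have h4 := mul_le_mul_of_nonneg_left h2 (hψ0 x)
      simp only [h3]
      nlinarith
  · refine ⟨fun x => ψ' x * (v1 x * conj (v x)).im +
      ψ x * (v2 x * conj (v x) + v1 x * conj (v1 x)).im, by fun_prop, ?_, ?_⟩
    · exact int_deriv_zero (fun x => (hψ x).mul (hasDeriv_im (hasDeriv_mul_conj hv1 hv x)))
        (by fun_prop) (by simp only [Pi.mul_apply, hψp, hvp, hv1p])
    · intro x
      have h1 := bd x _ (im_mul_conj_le (v1 x) (v x))
      have h2 : -(‖g x‖ * ‖v x‖) ≤ -(g x * conj (v x)).im :=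
        neg_le_neg ((le_abs_self _).trans (im_mul_conj_le (g x) (v x)))
      have h3 : (v2 x * conj (v x) + v1 x * conj (v1 x)).im
        = -(g x * conj (v x)).im + Q x * ‖v x‖ ^ 2 := by
        rw [e2, s0]
        simp
        ring
      have h4 := mul_le_mul_of_nonneg_left h2 (hψ0 x)
      simp only [h3]
      nlinarith

set_option maxHeartbeats 4000000 in
open ComplexConjugate in
lemma core (K s : ℝ) (hK : 1 ≤ K) (hs0 : -π ≤ s) (hs : s < π) (hKs : 1 ≤ K * (π - s)) :
    ∃ C > 0, ∀ (Λ q μ : ℝ) (Q ψ ψ' m : ℝ → ℝ) (v v1 v2 g : ℝ → ℂ), 1 ≤ Λ → Λ ^ 2 ≤ q → μ ≤ q ^ 2 →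
      BM Q → (∀ x, 0 ≤ Q x) →
      (∀ x, HasDerivAt ψ (ψ' x) x) → Continuous ψ' → ψ (-π) = ψ π → (∀ x, 0 ≤ ψ x) →
      BM m → ∫ x in (-π)..π, m x ≤ K * Λ → (∀ x, 0 ≤ m x) →
      (∀ x ∈ Set.Icc (-π) π, ψ x ≤ K * Q x) →
      (∀ x ∈ Set.Icc (-π) π, Q x ≤ K * ψ x + m x) →
      (∀ x ∈ Set.Icc (-π) π, ψ' x ^ 2 ≤ K * Λ ^ 2 * (ψ x * Q x)) →
      (∀ x ∈ Set.Icc s π, q ≤ K * ψ x) →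
      (∀ x, HasDerivAt v (v1 x) x) → (∀ x, HasDerivAt v1 (v2 x) x) → Continuous v2 →
      v (-π) = v π → v1 (-π) = v1 π →
      (∀ x, g x = -v2 x + Complex.I * Q x * v x - μ * v x) →
      ∫ x in (-π)..π, ‖v x‖ ^ 2 ≤ C * Λ ^ 2 * ∫ x in (-π)..π, ‖g x‖ ^ 2 := by
  set Γ : ℝ := 400 * K ^ 3 with hΓ
  set c1 : ℝ := 8 * π * K ^ 3 + 32 * π ^ 2 with hc1
  have hK3 : 1 ≤ K ^ 3 := one_le_pow₀ hK
  have hK23 : K ^ 2 ≤ K ^ 3 := pow_le_pow_right₀ hK (by norm_num)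
  have hK13 : K ≤ K ^ 3 := by simpa using pow_le_pow_right₀ hK (show 1 ≤ 3 by norm_num)
  have hΓ1 : 1 ≤ Γ := by linarith
  have hpi := pi_pos
  have hpi4 := pi_lt_d2
  have hle : (-π) ≤ π := by linarith
  refine ⟨max ((480 * Γ ^ 5) ^ 2) (c1 ^ 2), lt_max_of_lt_left (by positivity), ?_⟩
  intro Λ q μ Q ψ ψ' m v v1 v2 g hΛ hΛq hμq hQ hQ0 hψ cψ' hψp hψ0 hm hmK hm0 hψQ hQψ hψ'2 hqψ
    hv hv1 cv2 hvp hv1p hg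
  have cv : Continuous v := continuous_iff_continuousAt.2 fun x => (hv x).continuousAt
  have cv1 : Continuous v1 := continuous_iff_continuousAt.2 fun x => (hv1 x).continuousAt
  have cψ : Continuous ψ := continuous_iff_continuousAt.2 fun x => (hψ x).continuousAt
  have hq1 : 1 ≤ q := by nlinarith
  -- BM facts
  have bψ : BM ψ := BM.of_cont cψ
  have bv : BM (fun x => ‖v x‖) := BM.of_cont cv.norm
  have bv1 : BM (fun x => ‖v1 x‖) := BM.of_cont cv1.norm
  have bg : BM (fun x => ‖g x‖) := by
    have hgm : Measurable g := by
      have : g = fun x => -v2 x + Complex.I * Q x * v x - μ * v x := funext hg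
      rw [this]
      have := hQ.1
      have := cv.measurable
      have := cv2.measurable
      fun_prop
    obtain ⟨M, hM⟩ := ((BM.of_cont cv2.norm).add ((hQ.mul bv).add (bv.const_mul |μ|))).2
    refine ⟨hgm.norm, M, fun x hx => ?_⟩
    refine le_trans ?_ ((le_abs_self _).trans (hM x hx))
    rw [abs_norm, hg]
    calc ‖-v2 x + Complex.I * Q x * v x - μ * v x‖
        ≤ ‖-v2 x + Complex.I * Q x * v x‖ + ‖μ * v x‖ := norm_sub_le _ _
      _ ≤ ‖-v2 x‖ + ‖Complex.I * Q x * v x‖ + ‖μ * v x‖ := by gcongr; exact norm_add_le _ _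
      _ = _ := by simp [abs_of_nonneg (hQ0 x)]; ring
  have bQv := hQ.mul bv.sq
  have bQv1 := hQ.mul bv1.sq
  have bψv := bψ.mul bv.sq
  have bψv1 := bψ.mul bv1.sq
  have bψQv := bψ.mul bQv
  have bgv := bg.mul bv
  have bgv1 := bg.mul bv1
  have bvv1 := bv.mul bv1
  have bQvv1 := hQ.mul bvv1
  set N0 := ∫ x in (-π)..π, ‖v x‖ ^ 2 with hN0
  set N1 := ∫ x in (-π)..π, ‖v1 x‖ ^ 2 with hN1
  set Φ := ∫ x in (-π)..π, ‖g x‖ ^ 2 with hΦ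
  set D := ∫ x in (-π)..π, Q x * ‖v x‖ ^ 2 with hD
  set A := ∫ x in (-π)..π, ψ x * (Q x * ‖v x‖ ^ 2) with hA
  set B := ∫ x in (-π)..π, ψ x * ‖v1 x‖ ^ 2 with hB
  set R := ∫ x in (-π)..π, ‖g x‖ * ‖v x‖ with hR
  set P := ∫ x in (-π)..π, ‖g x‖ * ‖v1 x‖ with hP
  set E := ∫ x in (-π)..π, Q x * (‖v x‖ * ‖v1 x‖) with hE
  set G := ∫ x in (-π)..π, Q x * ‖v1 x‖ ^ 2 with hG
  have N00 : 0 ≤ N0 := BM.nonneg fun x => by positivity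
  have N10 : 0 ≤ N1 := BM.nonneg fun x => by positivity
  have Φ0 : 0 ≤ Φ := BM.nonneg fun x => by positivity
  have R0 : 0 ≤ R := BM.nonneg fun x => by positivity
  have P0 : 0 ≤ P := BM.nonneg fun x => by positivity
  have D0 : 0 ≤ D := BM.nonneg fun x => mul_nonneg (hQ0 x) (by positivity)
  have E0 : 0 ≤ E := BM.nonneg fun x => mul_nonneg (hQ0 x) (by positivity)
  have B0 : 0 ≤ B := BM.nonneg fun x => mul_nonneg (hψ0 x) (by positivity)
  have hR2 : R ^ 2 ≤ Φ * N0 := BM.cs bgv bg.sq bv.sq (fun x => by positivity)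
    (fun x => by positivity) (fun x => by rw [mul_pow])
  have hP2 : P ^ 2 ≤ Φ * N1 := BM.cs bgv1 bg.sq bv1.sq (fun x => by positivity)
    (fun x => by positivity) (fun x => by rw [mul_pow])
  have hE2 : E ^ 2 ≤ D * G := BM.cs bQvv1 bQv bQv1 (fun x => mul_nonneg (hQ0 x) (by positivity))
    (fun x => mul_nonneg (hQ0 x) (by positivity)) (fun x => le_of_eq (by ring))
  -- basic energy
  obtain ⟨⟨h, hc, hz, hl⟩, ⟨k, kc, kz, kl⟩⟩ := weighted_energy (ψ := fun _ => 1) (ψ' := fun _ => 0)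
    hv hv1 cv2 hvp hv1p hg (fun x => hasDerivAt_const x 1) continuous_const rfl (fun _ => zero_le_one)
  have hN1R : N1 ≤ μ * N0 + R := by
    have := BM.lin4 bv1.sq (BM.of_cont hc) bv.sq bgv bgv 1 μ 1 0 (fun x _ => by
      have := hl x; simp at this; linarith)
    rw [hz] at this
    linarith
  have hDR : D ≤ R := by
    have := BM.lin4 bQv (BM.of_cont kc) bgv bgv bgv 1 1 0 0 (fun x _ => by
      have := kl x; simp at this; linarith)
    rw [kz] at this
    linarith
  clear h hc hz hl k kc kz kl
  -- control on [s, π]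
  have sub_le : ∀ (f H : ℝ → ℝ), Continuous f → BM H → (∀ x ∈ Set.Icc s π, f x ≤ H x) →
      (∀ x, 0 ≤ H x) → ∫ x in s..π, f x ≤ ∫ x in (-π)..π, H x := by
    intro f H hf hH hfH hH0
    refine (intervalIntegral.integral_mono_on hs.le (hf.intervalIntegrable _ _)
      (hH.ii ⟨hs0, hs.le⟩ pip) hfH).trans ?_
    exact integral_mono_interval hs0 hs.le le_rfl
      (Filter.Eventually.of_forall fun x => hH0 x) (hH.ii pim pip)
  have hqQ : ∀ x ∈ Set.Icc s π, q ≤ K ^ 2 * Q x := by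
    intro x hx
    have h1 := hqψ x hx
    have h2 := hψQ x ⟨hs0.trans hx.1, hx.2⟩
    nlinarith
  have gv : q * ∫ x in s..π, ‖v x‖ ^ 2 ≤ K ^ 2 * D := by
    rw [← intervalIntegral.integral_const_mul, ← intervalIntegral.integral_const_mul]
    refine sub_le _ _ (by fun_prop) (bQv.const_mul _) (fun x hx => ?_)
      (fun x => mul_nonneg (by positivity) (mul_nonneg (hQ0 x) (by positivity)))
    rw [← mul_assoc]
    exact mul_le_mul_of_nonneg_right (hqQ x hx) (by positivity)
  have gv1 : q * ∫ x in s..π, ‖v1 x‖ ^ 2 ≤ K * B := by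
    rw [← intervalIntegral.integral_const_mul, ← intervalIntegral.integral_const_mul]
    refine sub_le _ _ (by fun_prop) (bψv1.const_mul _) (fun x hx => ?_)
      (fun x => mul_nonneg (by positivity) (mul_nonneg (hψ0 x) (by positivity)))
    rw [← mul_assoc]
    exact mul_le_mul_of_nonneg_right (hqψ x hx) (by positivity)
  have Gv0 : 0 ≤ ∫ x in s..π, ‖v x‖ ^ 2 :=
    intervalIntegral.integral_nonneg hs.le fun x _ => by positivity
  have Gv10 : 0 ≤ ∫ x in s..π, ‖v1 x‖ ^ 2 :=
    intervalIntegral.integral_nonneg hs.le fun x _ => by positivity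
  have intconst : ∀ c : ℝ, ∫ x in (-π)..π, (fun _ => c : ℝ → ℝ) x = 2 * π * c := by
    intro c; rw [intervalIntegral.integral_const, smul_eq_mul]; ring
  have nsq : ∀ z : ℂ, ‖z‖ ^ 2 = (z * conj z).re := fun z => by
    rw [Complex.mul_conj, ← Complex.normSq_eq_norm_sq]; simp
  have dnv : ∀ x, HasDerivAt (fun x => ‖v x‖ ^ 2) (2 * (v1 x * conj (v x)).re) x := fun x => by
    simp only [nsq]
    convert hasDeriv_re (hasDeriv_mul_conj hv hv x) using 1
    simp; ring
  have dnv1 : ∀ x, HasDerivAt (fun x => ‖v1 x‖ ^ 2) (2 * (v2 x * conj (v1 x)).re) x := fun x => by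
    simp only [nsq]
    convert hasDeriv_re (hasDeriv_mul_conj hv1 hv1 x) using 1
    simp; ring
  by_cases hμs : Γ * μ < 1
  · -- small μ
    have hpt : ∀ x ∈ Set.Icc (-π) π, ‖v x‖ ^ 2 ≤ K * (∫ x in s..π, ‖v x‖ ^ 2) +
        (1 / (4 * π) * N0 + 4 * π * N1) := by
      intro x hx
      have p := point_le dnv (by fun_prop) (H := fun x => 1 / (4 * π) * ‖v x‖ ^ 2 + 4 * π * ‖v1 x‖ ^ 2)
        ((bv.sq.const_mul _).add (bv1.sq.const_mul _)) (fun x _ => by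
          rw [abs_mul, abs_two]
          have := re_mul_conj_le (v1 x) (v x)
          have e : 1 / (4 * π) * ‖v x‖ ^ 2 + 4 * π * ‖v1 x‖ ^ 2 - 2 * (‖v1 x‖ * ‖v x‖)
            = 1 / (4 * π) * (‖v x‖ - 4 * π * ‖v1 x‖) ^ 2 := by field_simp; ring
          have : 0 ≤ 1 / (4 * π) * (‖v x‖ - 4 * π * ‖v1 x‖) ^ 2 := by positivity
          linarith) hs0 hs.le x hx
      rw [intervalIntegral.integral_add ((bv.sq.const_mul _).ii pim pip)
        ((bv1.sq.const_mul _).ii pim pip), intervalIntegral.integral_const_mul,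
        intervalIntegral.integral_const_mul, ← hN0, ← hN1] at p
      have hps : 0 < π - s := by linarith
      refine le_of_mul_le_mul_left (p.trans ?_) hps
      have := mul_le_mul_of_nonneg_right hKs Gv0
      linarith
    have h1 : N0 ≤ 2 * π * (K * (∫ x in s..π, ‖v x‖ ^ 2) + (1 / (4 * π) * N0 + 4 * π * N1)) := by
      rw [← intconst]
      exact BM.mono bv.sq (BM.of_cont continuous_const) hpt
    have h2 : ∫ x in s..π, ‖v x‖ ^ 2 ≤ K ^ 2 * R := by nlinarith
    have h3 : 2 * π * (1 / (4 * π) * N0) = N0 / 2 := by field_simp; ring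
    have h4 : 32 * π ^ 2 * (μ * N0) ≤ N0 := by
      by_cases hμ0 : μ ≤ 0
      · have := mul_nonneg (neg_nonneg.2 hμ0) N00
        nlinarith [sq_nonneg π]
      · push Not at hμ0
        have : 32 * π ^ 2 ≤ Γ := by nlinarith
        have : 32 * π ^ 2 * μ ≤ 1 := by nlinarith
        nlinarith
    have h5 : N0 ≤ c1 * R := by
      have e1 : 2 * π * K * (∫ x in s..π, ‖v x‖ ^ 2) ≤ 2 * π * K * (K ^ 2 * R) := by gcongr
      have e2 : 8 * π ^ 2 * N1 ≤ 8 * π ^ 2 * (μ * N0 + R) := by gcongr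
      rw [hc1]
      linarith
    have h6 : N0 ≤ c1 ^ 2 * Φ := by
      rcases N00.eq_or_lt with h0 | h0
      · rw [← h0]; positivity
      · refine le_of_mul_le_mul_right ?_ h0
        calc N0 * N0 = N0 ^ 2 := by ring
          _ ≤ (c1 * R) ^ 2 := by gcongr
          _ = c1 ^ 2 * R ^ 2 := by ring
          _ ≤ c1 ^ 2 * (Φ * N0) := by gcongr
          _ = _ := by ring
    calc N0 ≤ c1 ^ 2 * 1 * Φ := by linarith
      _ ≤ _ := by
        gcongr
        · exact le_max_right _ _
        · exact one_le_pow₀ hΛ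
  · push Not at hμs
    have hμ0 : 0 < μ := by
      by_contra h; push Not at h; nlinarith
    obtain ⟨⟨h, hc, hz, hl⟩, ⟨k, kc, kz, kl⟩⟩ := weighted_energy
      hv hv1 cv2 hvp hv1p hg hψ cψ' hψp hψ0
    have pt1 : ∀ x ∈ Set.Icc (-π) π, ψ x * (‖g x‖ * ‖v x‖) ≤
        K / 2 * ‖g x‖ ^ 2 + 1 / 2 * (ψ x * (Q x * ‖v x‖ ^ 2)) := by
      intro x hx
      have e1 := mul_le_mul_of_nonneg_left (hψQ x hx) (mul_nonneg (hψ0 x) (sq_nonneg ‖v x‖))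
      have e2 : 2 * K * (ψ x * (‖g x‖ * ‖v x‖)) ≤ K ^ 2 * ‖g x‖ ^ 2 + ψ x * ‖v x‖ ^ 2 * ψ x := by
        nlinarith [sq_nonneg (K * ‖g x‖ - ψ x * ‖v x‖)]
      have e3 : 2 * K * (ψ x * (‖g x‖ * ‖v x‖)) ≤
          2 * K * (K / 2 * ‖g x‖ ^ 2 + 1 / 2 * (ψ x * (Q x * ‖v x‖ ^ 2))) := by linarith
      exact le_of_mul_le_mul_left e3 (by linarith)
    have pt2 : ∀ x ∈ Set.Icc (-π) π, |ψ' x| * (‖v1 x‖ * ‖v x‖) ≤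
        1 / 8 * (ψ x * ‖v1 x‖ ^ 2) + 2 * K * Λ ^ 2 * (Q x * ‖v x‖ ^ 2) := by
      intro x hx
      have p1 : 0 ≤ ψ x * ‖v1 x‖ ^ 2 := mul_nonneg (hψ0 x) (by positivity)
      have p2 : 0 ≤ 2 * K * Λ ^ 2 * (Q x * ‖v x‖ ^ 2) :=
        mul_nonneg (by positivity) (mul_nonneg (hQ0 x) (by positivity))
      apply le_of_sq_le' _ (by linarith)
      have e0 := mul_le_mul_of_nonneg_right (hψ'2 x hx) (sq_nonneg (‖v1 x‖ * ‖v x‖))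
      have e1 : (|ψ' x| * (‖v1 x‖ * ‖v x‖)) ^ 2 = ψ' x ^ 2 * (‖v1 x‖ * ‖v x‖) ^ 2 := by
        rw [mul_pow, sq_abs]
      have e2 := sq_nonneg (1 / 8 * (ψ x * ‖v1 x‖ ^ 2) - 2 * K * Λ ^ 2 * (Q x * ‖v x‖ ^ 2))
      rw [e1]
      linarith
    have hAle : A ≤ K / 2 * Φ + 1 / 2 * A + (1 / 8 * B + 2 * K * Λ ^ 2 * D) := by
      have := BM.lin4 (f := fun x => ψ x * (Q x * ‖v x‖ ^ 2) - k x)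
        (by simpa [sub_eq_add_neg] using bψQv.add ((BM.of_cont kc).const_mul (-1))) bg.sq bψQv bψv1 bQv (K / 2) (1 / 2) (1 / 8) (2 * K * Λ ^ 2)
        (fun x hx => by linarith [kl x, pt1 x hx, pt2 x hx])
      rw [intervalIntegral.integral_sub (bψQv.ii pim pip) (kc.intervalIntegrable _ _), kz] at this
      linarith
    have hBle : B ≤ μ * K * D + (K / 2 * Φ + 1 / 2 * A + (1 / 8 * B + 2 * K * Λ ^ 2 * D)) := by
      have := BM.lin4 (f := fun x => ψ x * ‖v1 x‖ ^ 2 - h x)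
        (by simpa [sub_eq_add_neg] using bψv1.add ((BM.of_cont hc).const_mul (-1))) bg.sq bψQv bψv1 bQv (K / 2) (1 / 2) (1 / 8) (μ * K + 2 * K * Λ ^ 2)
        (fun x hx => by
          have e1 := mul_le_mul_of_nonneg_left (hψQ x hx) (mul_nonneg hμ0.le (sq_nonneg ‖v x‖))
          linarith [hl x, pt1 x hx, pt2 x hx])
      rw [intervalIntegral.integral_sub (bψv1.ii pim pip) (hc.intervalIntegrable _ _), hz] at this
      linarith
    have hBfin : B ≤ 6 * K * ((μ + Λ ^ 2) * D + Φ) := by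
      have y1 : 0 ≤ μ * K * D := by positivity
      have y2 : 0 ≤ K * Λ ^ 2 * D := by positivity
      have y3 : 0 ≤ K * Φ := by positivity
      linarith
    -- pointwise energy
    set S : ℝ := K / q * (K * B + μ * (K ^ 2 * D)) + (2 * E + 2 * P) with hS
    have hFS : ∀ x ∈ Set.Icc (-π) π, ‖v1 x‖ ^ 2 + μ * ‖v x‖ ^ 2 ≤ S := by
      intro x hx
      have p := point_le (F := fun x => ‖v1 x‖ ^ 2 + μ * ‖v x‖ ^ 2)
        (fun x => (dnv1 x).add ((dnv x).const_mul μ)) (by fun_prop)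
        (H := fun x => 2 * (Q x * (‖v x‖ * ‖v1 x‖)) + 2 * (‖g x‖ * ‖v1 x‖))
        ((bQvv1.const_mul _).add (bgv1.const_mul _)) (fun x _ => by
          have e : 2 * (v2 x * conj (v1 x)).re + μ * (2 * (v1 x * conj (v x)).re)
              = 2 * ((Complex.I * Q x * v x - g x) * conj (v1 x)).re := by
            rw [hg]; simp; ring
          rw [e, abs_mul, abs_two]
          have e1 := re_mul_conj_le (Complex.I * Q x * v x - g x) (v1 x)
          have e2 : ‖Complex.I * Q x * v x - g x‖ ≤ Q x * ‖v x‖ + ‖g x‖ := by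
            refine (norm_sub_le _ _).trans ?_
            simp [abs_of_nonneg (hQ0 x)]
          have e3 := mul_le_mul_of_nonneg_right e2 (norm_nonneg (v1 x))
          linarith) hs0 hs.le x hx
      rw [intervalIntegral.integral_add ((bQvv1.const_mul _).ii pim pip)
        ((bgv1.const_mul _).ii pim pip), intervalIntegral.integral_const_mul,
        intervalIntegral.integral_const_mul, ← hE, ← hP,
        intervalIntegral.integral_add (Continuous.intervalIntegrable (by fun_prop) _ _)
          (Continuous.intervalIntegrable (by fun_prop) _ _),
        intervalIntegral.integral_const_mul] at p
      have hps : 0 < π - s := by linarith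
      refine le_of_mul_le_mul_left (p.trans ?_) hps
      set I1 := ∫ x in s..π, ‖v1 x‖ ^ 2
      set I0 := ∫ x in s..π, ‖v x‖ ^ 2
      have f1 : I1 + μ * I0 ≤ 1 / q * (K * B + μ * (K ^ 2 * D)) := by
        rw [one_div, ← div_eq_inv_mul, le_div_iff₀ (by linarith)]
        have := mul_le_mul_of_nonneg_left gv hμ0.le
        linarith
      have f2 : 0 ≤ 1 / q * (K * B + μ * (K ^ 2 * D)) := by positivity
      have f3 := mul_le_mul_of_nonneg_right hKs f2
      have f4 : (π - s) * S = K * (π - s) * (1 / q * (K * B + μ * (K ^ 2 * D)))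
        + (π - s) * (2 * E + 2 * P) := by rw [hS]; ring
      rw [f4]
      linarith
    have S0 : 0 ≤ S := by positivity
    have hN1S : N1 ≤ 2 * π * S := by
      rw [← intconst]
      refine BM.mono bv1.sq (BM.of_cont continuous_const) (fun x hx => ?_)
      have := hFS x hx
      have : 0 ≤ μ * ‖v x‖ ^ 2 := by positivity
      linarith
    have hN0S : μ * N0 ≤ 2 * π * S := by
      rw [← intconst, hN0, ← intervalIntegral.integral_const_mul]
      refine BM.mono (bv.sq.const_mul _) (BM.of_cont continuous_const) (fun x hx => ?_)
      have := hFS x hx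
      have : 0 ≤ ‖v1 x‖ ^ 2 := by positivity
      linarith
    have hGle : G ≤ K * B + K * Λ * S := by
      have := BM.lin4 bQv1 bψv1 hm hm hm K S 0 0 (fun x hx => by
        have e1 := mul_le_mul_of_nonneg_right (hQψ x hx) (sq_nonneg ‖v1 x‖)
        have e2 : ‖v1 x‖ ^ 2 ≤ S := by
          have := hFS x hx
          have : 0 ≤ μ * ‖v x‖ ^ 2 := by positivity
          linarith
        have e3 := mul_le_mul_of_nonneg_left e2 (hm0 x)
        linarith)
      have e4 := mul_le_mul_of_nonneg_left hmK S0
      linarith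
    have hKΓ : K ≤ Γ := by linarith
    have h2pi : 2 * π ≤ Γ := by linarith
    have fin := alg_main Γ hΓ1 (√N0) (√Φ) D B E P S μ Λ q (sqrt_nonneg _) (sqrt_nonneg _) D0 S0 hΛ
      hq1 hμs hμq hΛq
      (by
        rw [← sqrt_mul Φ0]
        exact hDR.trans (le_sqrt_of_sq_le hR2))
      (by
        rw [sq_sqrt Φ0]
        refine hBfin.trans ?_
        have : 6 * K ≤ Γ := by linarith
        gcongr)
      (by
        refine hE2.trans ?_
        have : K * B + K * Λ * S ≤ Γ * B + Γ * Λ * S := by gcongr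
        exact mul_le_mul_of_nonneg_left (hGle.trans this) D0)
      (by
        rw [sq_sqrt Φ0]
        refine hP2.trans ?_
        have : 2 * π * S ≤ Γ * S := by gcongr
        exact mul_le_mul_of_nonneg_left (hN1S.trans this) Φ0)
      (by
        have e : q * S = K ^ 2 * B + K ^ 3 * (μ * D) + q * (2 * E + 2 * P) := by
          rw [hS]; field_simp
        rw [e]
        have e1 : K ^ 2 * B ≤ Γ * B := by gcongr; linarith
        have e2 : K ^ 3 * (μ * D) ≤ Γ * (μ * D) := by gcongr; linarith
        linarith)
      (by
        rw [sq_sqrt N00]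
        exact hN0S.trans (by gcongr))
    rw [sq_sqrt N00, sq_sqrt Φ0] at fin
    refine fin.trans ?_
    gcongr
    exact le_max_left _ _

lemma hasDeriv_comp_max {h h' : ℝ → ℝ} (hd : ∀ z, 0 ≤ z → HasDerivAt h (h' z) z) (h0 : h' 0 = 0)
    (τ x : ℝ) : HasDerivAt (fun y => h (max (y - τ) 0)) (h' (max (x - τ) 0)) x := by
  have R : ∀ x, τ ≤ x → HasDerivWithinAt (fun y => h (max (y - τ) 0)) (h' (max (x - τ) 0)) (Set.Ici τ) x := by
    intro x hx
    have e : max (x - τ) 0 = x - τ := max_eq_left (by linarith)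
    have : HasDerivAt (fun y => h (y - τ)) (h' (x - τ)) x := by
      simpa using (hd (x - τ) (by linarith)).comp_sub_const x τ
    rw [e]
    refine this.hasDerivWithinAt.congr (fun y hy => ?_) (by simp only [e])
    rw [max_eq_left (by linarith [Set.mem_Ici.1 hy])]
  have L : ∀ x, x ≤ τ → HasDerivWithinAt (fun y => h (max (y - τ) 0)) (h' (max (x - τ) 0)) (Set.Iic τ) x := by
    intro x hx
    have e : max (x - τ) 0 = 0 := max_eq_right (by linarith)
    rw [e, h0]
    refine (hasDerivWithinAt_const x _ (h 0)).congr (fun y hy => ?_) (by simp only [e])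
    rw [max_eq_right (by linarith [Set.mem_Iic.1 hy])]
  rcases lt_trichotomy x τ with hx | rfl | hx
  · exact (L x hx.le).hasDerivAt (Iic_mem_nhds hx)
  · have := (L x le_rfl).union (R x le_rfl)
    rwa [Set.Iic_union_Ici, hasDerivWithinAt_univ] at this
  · exact (R x hx.le).hasDerivAt (Ici_mem_nhds hx)

lemma int_ind (σ δ : ℝ) (hδ : 0 ≤ δ) :
    ∫ x in (-π)..π, (Set.Ioc σ (σ + δ)).indicator (fun _ => (1 : ℝ)) x ≤ δ := by
  rw [intervalIntegral.integral_of_le (by linarith [pi_pos])]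
  rw [MeasureTheory.integral_indicator measurableSet_Ioc, Measure.restrict_restrict measurableSet_Ioc]
  simp only [MeasureTheory.integral_const, smul_eq_mul, mul_one, Measure.real, Measure.restrict_apply_univ]
  have : volume (Set.Ioc σ (σ + δ) ∩ Set.Ioc (-π) π) ≤ ENNReal.ofReal δ := by
    refine (measure_mono Set.inter_subset_left).trans ?_
    simp
  exact ENNReal.toReal_le_of_le_ofReal hδ this

/-- profile -/
noncomputable def wh (q d β z : ℝ) : ℝ := q * (z ^ 2 * (z + d) ^ (β - 2))
noncomputable def wh' (q d β z : ℝ) : ℝ :=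
  q * (2 * z * (z + d) ^ (β - 2) + z ^ 2 * ((β - 2) * (z + d) ^ (β - 3)))

lemma wh_deriv (q d β : ℝ) (hd : 0 < d) (z : ℝ) (hz : 0 ≤ z) :
    HasDerivAt (wh q d β) (wh' q d β z) z := by
  have h1 : HasDerivAt (fun z => (z + d) ^ (β - 2)) ((β - 2) * (z + d) ^ (β - 3)) z := by
    have := ((hasDerivAt_id z).add_const d).rpow_const (p := β - 2) (Or.inl (by simp; linarith))
    rw [show β - 2 - 1 = β - 3 by ring] at this
    simpa using this
  have h2 : HasDerivAt (fun z : ℝ => z ^ 2) (2 * z) z := by simpa using hasDerivAt_pow 2 z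
  exact (h2.mul h1).const_mul q

lemma wh'_cont (q d β τ : ℝ) (hd : 0 < d) : Continuous fun x => wh' q d β (max (x - τ) 0) := by
  have hp : ∀ x, max (x - τ) 0 + d ≠ 0 := fun x => by
    have := le_max_right (x - τ) 0; linarith
  have c0 : Continuous fun x => max (x - τ) 0 := by fun_prop
  have c1 : ∀ p : ℝ, Continuous fun x => (max (x - τ) 0 + d) ^ p := fun p =>
    (c0.add continuous_const).rpow_const (fun x => Or.inl (hp x))
  unfold wh'
  have a := c1 (β - 2)
  have b := c1 (β - 3)
  fun_prop

/-- facts on the profile: `z ≥ 0`, `r = z + d` -/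
lemma wh_facts (q d β Λ : ℝ) (hq : 0 < q) (hd : 0 < d) (hΛ : 2 * Λ * d = 1) (z : ℝ) (hz : 0 ≤ z) :
    0 ≤ wh q d β z ∧ wh q d β z ≤ q * (z + d) ^ β ∧
    (d ≤ z → q * (z + d) ^ β ≤ 4 * wh q d β z) ∧
    wh' q d β z ^ 2 ≤ 4 * (2 + |β - 2|) ^ 2 * Λ ^ 2 * (wh q d β z * (q * (z + d) ^ β)) := by
  have hr : 0 < z + d := by linarith
  obtain ⟨ρ, hρ⟩ : ∃ ρ, ρ = (z + d) ^ (β - 3) := ⟨_, rfl⟩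
  have hρ0 : 0 < ρ := hρ ▸ rpow_pos_of_pos hr _
  have e2 : (z + d) ^ (β - 2) = ρ * (z + d) := by
    rw [hρ, ← rpow_add_one hr.ne']; congr 1; ring
  have e0 : (z + d) ^ β = ρ * (z + d) ^ 3 := by
    rw [hρ, ← rpow_add_natCast hr.ne']; congr 1; push_cast; ring
  unfold wh wh'
  rw [e2, e0, ← hρ]
  generalize hrr : z + d = r at *
  have hzr : z ≤ r := by linarith
  have hqρ : 0 < q * ρ := by positivity
  refine ⟨by positivity, ?_, ?_, ?_⟩
  · have : z ^ 2 * r ≤ r ^ 2 * r := by gcongr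
    calc _ = q * ρ * (z ^ 2 * r) := by ring
      _ ≤ q * ρ * (r ^ 2 * r) := by gcongr
      _ = _ := by ring
  · intro hdz
    have : r ≤ 2 * z := by linarith
    have : r ^ 2 * r ≤ (2 * z) ^ 2 * r := by gcongr
    calc _ = q * ρ * (r ^ 2 * r) := by ring
      _ ≤ q * ρ * ((2 * z) ^ 2 * r) := by gcongr
      _ = _ := by ring
  · have hb : (2 * r + (β - 2) * z) ^ 2 ≤ ((2 + |β - 2|) * r) ^ 2 := by
      rw [sq_le_sq, abs_of_nonneg (a := (2 + |β - 2|) * r) (by positivity)]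
      calc |2 * r + (β - 2) * z| ≤ |2 * r| + |(β - 2) * z| := abs_add_le _ _
        _ = 2 * r + |β - 2| * z := by rw [abs_mul, abs_mul, abs_of_pos hr, abs_of_nonneg hz, abs_two]
        _ ≤ 2 * r + |β - 2| * r := by gcongr
        _ = _ := by ring
    have hΛ0 : 0 < Λ := by
      by_contra h; push Not at h; nlinarith
    have hrΛ : 1 ≤ (2 * Λ * r) ^ 2 := by
      have : d ≤ r := by linarith
      have : 2 * Λ * d ≤ 2 * Λ * r := by gcongr
      rw [hΛ] at this
      exact one_le_pow₀ this
    calc _ = (q * ρ * z) ^ 2 * (2 * r + (β - 2) * z) ^ 2 * 1 := by ring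
      _ ≤ (q * ρ * z) ^ 2 * ((2 + |β - 2|) * r) ^ 2 * (2 * Λ * r) ^ 2 := by gcongr
      _ = _ := by ring

lemma weights (C₀ σ β : ℝ) (hC₀ : 0 < C₀) (hσ : σ ∈ Set.Ioo 0 π) (hβ : 0 ≤ β) :
    ∃ K s q₀ : ℝ, 1 ≤ K ∧ -π ≤ s ∧ s < π ∧ 1 ≤ K * (π - s) ∧ 1 ≤ q₀ ∧
      ∀ W : ℝ → ℝ, (∀ x ∈ Set.Icc (-π) π, dampV σ β x / C₀ ≤ W x ∧ W x ≤ C₀ * dampV σ β x) →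
      ∀ q ≥ q₀, ∀ Λ : ℝ, Λ = q ^ (1 / (β + 2)) → 1 ≤ Λ ∧ Λ ^ 2 ≤ q ∧ ∃ ψ ψ' m : ℝ → ℝ,
      (∀ x, HasDerivAt ψ (ψ' x) x) ∧ Continuous ψ' ∧ ψ (-π) = ψ π ∧ (∀ x, 0 ≤ ψ x) ∧
      BM m ∧ ∫ x in (-π)..π, m x ≤ K * Λ ∧ (∀ x, 0 ≤ m x) ∧
      (∀ x ∈ Set.Icc (-π) π, ψ x ≤ K * (q * W x)) ∧
      (∀ x ∈ Set.Icc (-π) π, q * W x ≤ K * ψ x + m x) ∧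
      (∀ x ∈ Set.Icc (-π) π, ψ' x ^ 2 ≤ K * Λ ^ 2 * (ψ x * (q * W x))) ∧
      (∀ x ∈ Set.Icc s π, q ≤ K * ψ x) := by
  obtain ⟨hσ0, hσπ⟩ := hσ
  have hpi := pi_pos
  set κ := (π - σ) / 2 with hκ
  have hκ0 : 0 < κ := by linarith
  have hκβ : 0 < κ ^ β := rpow_pos_of_pos hκ0 _
  set c := 4 * (2 + |β - 2|) ^ 2 with hc
  have hc0 : 0 ≤ c := by positivity
  set K := 1 + 4 * C₀ + c * C₀ + 4 / κ ^ β + 1 / κ with hK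
  have k1 : 0 ≤ c * C₀ := by positivity
  have k2 : 0 ≤ 4 / κ ^ β := by positivity
  have k3 : 0 ≤ 1 / κ := by positivity
  refine ⟨K, (σ + π) / 2, max 1 ((1 / κ) ^ (β + 2)), by linarith, by linarith, by linarith, ?_,
    le_max_left _ _, ?_⟩
  · have : 1 / κ * κ = 1 := by field_simp
    have e : π - (σ + π) / 2 = κ := by rw [hκ]; ring
    rw [e]
    have : 1 / κ * κ ≤ K * κ := by gcongr; linarith
    linarith
  intro W hW q hq Λ hΛdef
  have hq1 : 1 ≤ q := (le_max_left _ _).trans hq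
  have hq0 : 0 < q := by linarith
  have hΛ1 : 1 ≤ Λ := hΛdef ▸ one_le_rpow hq1 (by positivity)
  have hΛ0 : 0 < Λ := by linarith
  have hΛq : Λ ^ 2 ≤ q := by
    rw [hΛdef, ← rpow_natCast, ← rpow_mul hq0.le]
    calc q ^ (1 / (β + 2) * ((2 : ℕ) : ℝ)) ≤ q ^ (1 : ℝ) := by
          apply rpow_le_rpow_of_exponent_le hq1
          push_cast
          rw [one_div_mul_eq_div, div_le_one (by linarith)]; linarith
      _ = q := rpow_one q
  have hΛβ : Λ ^ (β + 2) = q := by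
    rw [hΛdef, ← rpow_mul hq0.le, one_div_mul_cancel (by linarith), rpow_one]
  have hΛκ : 1 / κ ≤ Λ := by
    have : (1 / κ) ^ (β + 2) ≤ Λ ^ (β + 2) := hΛβ ▸ (le_max_right _ _).trans hq
    exact (rpow_le_rpow_iff k3 hΛ0.le (by linarith)).1 this
  set d := 1 / (2 * Λ) with hd
  have hd0 : 0 < d := by positivity
  have hΛd : 2 * Λ * d = 1 := by rw [hd]; field_simp
  have hdκ : 2 * d ≤ κ := by
    have : 1 ≤ Λ * κ := by rwa [div_le_iff₀ hκ0] at hΛκ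
    have : Λ * (2 * d) ≤ Λ * κ := by linarith
    exact le_of_mul_le_mul_left this hΛ0
  have hqd : q * (2 * d) ^ β = Λ ^ 2 := by
    have : 2 * d = Λ⁻¹ := by rw [hd]; field_simp
    rw [this, inv_rpow hΛ0.le, ← hΛβ, rpow_add hΛ0, rpow_two]
    have : Λ ^ β ≠ 0 := (rpow_pos_of_pos hΛ0 _).ne'
    field_simp
  set τ := σ + d with hτ
  set p : ℝ → ℝ := fun x => wh q d β (max (x - τ) 0) with hp
  set p' : ℝ → ℝ := fun x => wh' q d β (max (x - τ) 0) with hp'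
  have dp : ∀ x, HasDerivAt p (p' x) x := fun x =>
    hasDeriv_comp_max (wh_deriv q d β hd0) (by simp [wh']) τ x
  have cp' : Continuous p' := wh'_cont q d β τ hd0
  have pz : ∀ x, x ≤ 0 → p x = 0 := fun x hx => by
    simp only [hp]; rw [max_eq_right (by linarith)]; simp [wh]
  have pz' : ∀ x, x ≤ 0 → p' x = 0 := fun x hx => by
    simp only [hp']; rw [max_eq_right (by linarith)]; simp [wh']
  have pabs : ∀ x, p x + p (-x) = p |x| := by
    intro x
    rcases le_total 0 x with h | h
    · rw [pz (-x) (by linarith), abs_of_nonneg h, add_zero]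
    · rw [pz x h, abs_of_nonpos h, zero_add]
  have pabs' : ∀ x, (p' x - p' (-x)) ^ 2 = p' |x| ^ 2 := by
    intro x
    rcases le_total 0 x with h | h
    · rw [pz' (-x) (by linarith), abs_of_nonneg h, sub_zero]
    · rw [pz' x h, abs_of_nonpos h]; ring
  have facts := fun y => wh_facts q d β Λ hq0 hd0 hΛd (max (y - τ) 0) (le_max_right _ _)
  have p0 : ∀ y, 0 ≤ p y := fun y => (facts y).1
  -- comparison with V
  have V0 : ∀ x, 0 ≤ dampV σ β x := fun x => by
    unfold dampV; split_ifs with h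
    · exact le_rfl
    · exact rpow_nonneg (by linarith) _
  have key : ∀ x, p |x| ≤ q * dampV σ β x ∧
      (σ + 2 * d ≤ |x| → q * dampV σ β x ≤ 4 * p |x|) ∧
      (|x| ≤ σ + 2 * d → q * dampV σ β x ≤ Λ ^ 2) ∧
      p' |x| ^ 2 ≤ c * Λ ^ 2 * (p |x| * (q * dampV σ β x)) := by
    intro x
    obtain ⟨f0, f1, f2, f3⟩ := facts |x|
    have near : |x| ≤ σ + 2 * d → q * dampV σ β x ≤ Λ ^ 2 := by
      intro h
      rw [← hqd]
      unfold dampV; split_ifs with h1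
      · simp; positivity
      · have : |x| - σ ≤ 2 * d := by linarith
        have : 0 ≤ |x| - σ := by linarith
        gcongr
    rcases le_or_gt |x| τ with h | h
    · have e : max (|x| - τ) 0 = 0 := max_eq_right (by linarith)
      have ep : p |x| = 0 := by simp only [hp, e]; simp [wh]
      have ep' : p' |x| = 0 := by simp only [hp', e]; simp [wh']
      rw [ep, ep']
      refine ⟨mul_nonneg hq0.le (V0 x), fun h2 => by linarith, near, by simp⟩
    · have e : max (|x| - τ) 0 = |x| - τ := max_eq_left (by linarith)
      have eV : dampV σ β x = (|x| - τ + d) ^ β := by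
        unfold dampV; rw [if_neg (by linarith)]; congr 1; linarith
      have ep : p |x| = wh q d β (|x| - τ) := by simp only [hp, e]
      have ep' : p' |x| = wh' q d β (|x| - τ) := by simp only [hp', e]
      rw [e] at f1 f2 f3
      rw [ep, ep', eV]
      refine ⟨f1, fun h2 => f2 (by linarith), eV ▸ near, f3⟩
  set J := (Set.Ioc σ (σ + 2 * d)).indicator (fun _ => (1 : ℝ)) with hJ
  have J0 : ∀ x, 0 ≤ J x := fun x => Set.indicator_nonneg (fun _ _ => zero_le_one) x
  have J1 : ∀ x, J x ≤ 1 := fun x => Set.indicator_le_self' (fun _ _ => zero_le_one) x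
  have mJ : Measurable J := measurable_const.indicator measurableSet_Ioc
  have bJ : BM J := ⟨mJ, 1, fun x _ => by rw [abs_of_nonneg (J0 x)]; exact J1 x⟩
  have bJ' : BM (fun x => J (-x)) :=
    ⟨mJ.comp measurable_neg, 1, fun x _ => by rw [abs_of_nonneg (J0 _)]; exact J1 _⟩
  have hV1 : ∀ x ∈ Set.Icc (-π) π, q * dampV σ β x ≤ C₀ * (q * W x) := by
    intro x hx
    have := (hW x hx).1
    rw [div_le_iff₀ hC₀] at this
    nlinarith
  have hV2 : ∀ x ∈ Set.Icc (-π) π, q * W x ≤ C₀ * (q * dampV σ β x) := by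
    intro x hx
    have := (hW x hx).2
    nlinarith
  have hW0 : ∀ x ∈ Set.Icc (-π) π, 0 ≤ q * W x := by
    intro x hx
    have := hV1 x hx
    have := mul_nonneg hq0.le (V0 x)
    exact nonneg_of_mul_nonneg_right (by linarith) hC₀
  refine ⟨hΛ1, hΛq, fun x => p x + p (-x), fun x => p' x - p' (-x),
    fun x => C₀ * Λ ^ 2 * (J x + J (-x)), ?_, by fun_prop, by simp [add_comm],
    fun x => add_nonneg (p0 _) (p0 _), (bJ.add bJ').const_mul _, ?_,
    fun x => mul_nonneg (by positivity) (add_nonneg (J0 _) (J0 _)), ?_, ?_, ?_, ?_⟩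
  · intro x
    have := (dp x).add ((dp (-x)).comp x (hasDerivAt_neg x))
    have e : p' x + p' (-x) * -1 = p' x - p' (-x) := by ring
    rw [e] at this
    exact this
  · rw [intervalIntegral.integral_const_mul, intervalIntegral.integral_add (bJ.ii pim pip)
      (bJ'.ii pim pip), intervalIntegral.integral_comp_neg, neg_neg]
    have := int_ind σ (2 * d) (by linarith)
    calc C₀ * Λ ^ 2 * ((∫ x in (-π)..π, J x) + ∫ x in (-π)..π, J x)
        ≤ C₀ * Λ ^ 2 * (2 * d + 2 * d) := by gcongr
      _ = 2 * C₀ * Λ * (2 * Λ * d) := by ring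
      _ = 2 * C₀ * Λ := by rw [hΛd, mul_one]
      _ ≤ K * Λ := by gcongr; linarith
  · intro x hx
    simp only [pabs]
    have : C₀ * (q * W x) ≤ K * (q * W x) := mul_le_mul_of_nonneg_right (by linarith) (hW0 x hx)
    linarith [(key x).1, hV1 x hx]
  · intro x hx
    simp only [pabs]
    obtain ⟨-, h2, h3, -⟩ := key x
    have h4 := hV2 x hx
    have y1 := p0 |x|
    have y2 := J0 x
    have y3 := J0 (-x)
    have y4 : 0 ≤ C₀ * Λ ^ 2 := by positivity
    have y5 : 0 ≤ K * p |x| := mul_nonneg (by linarith) y1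
    rcases le_total (σ + 2 * d) |x| with h | h
    · have : 4 * C₀ * p |x| ≤ K * p |x| := mul_le_mul_of_nonneg_right (by linarith) y1
      have := mul_le_mul_of_nonneg_left (h2 h) hC₀.le
      have := mul_nonneg y4 (add_nonneg y2 y3)
      linarith
    · rcases le_or_gt |x| σ with h' | h'
      · have : dampV σ β x = 0 := if_pos h'
        rw [this] at h4
        have := mul_nonneg y4 (add_nonneg y2 y3)
        linarith
      · have hJJ : 1 ≤ J x + J (-x) := by
          rcases le_total 0 x with hx0 | hx0
          · rw [abs_of_nonneg hx0] at h h'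
            have : J x = 1 := Set.indicator_of_mem (show x ∈ Set.Ioc σ (σ + 2 * d) from ⟨h', h⟩) _
            linarith
          · rw [abs_of_nonpos hx0] at h h'
            have : J (-x) = 1 := Set.indicator_of_mem (show -x ∈ Set.Ioc σ (σ + 2 * d) from ⟨h', h⟩) _
            linarith
        have := mul_le_mul_of_nonneg_left (h3 h) hC₀.le
        have := mul_le_mul_of_nonneg_left hJJ y4
        linarith
  · intro x hx
    simp only [pabs, pabs']
    refine (key x).2.2.2.trans ?_
    have y1 := p0 |x|
    have h1 := hV1 x hx
    calc c * Λ ^ 2 * (p |x| * (q * dampV σ β x)) ≤ c * Λ ^ 2 * (p |x| * (C₀ * (q * W x))) := by gcongr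
      _ = c * C₀ * (Λ ^ 2 * (p |x| * (q * W x))) := by ring
      _ ≤ K * (Λ ^ 2 * (p |x| * (q * W x))) := by
        refine mul_le_mul_of_nonneg_right (by linarith) ?_
        exact mul_nonneg (by positivity) (mul_nonneg y1 (hW0 x hx))
      _ = _ := by ring
  · intro x hx
    simp only [pabs]
    have hx0 : 0 ≤ x := by linarith [hx.1]
    have h2 := (key x).2.1
    rw [abs_of_nonneg hx0] at h2 ⊢
    have h3 := h2 (by linarith [hx.1])
    have eV : dampV σ β x = (x - σ) ^ β := by
      unfold dampV; rw [abs_of_nonneg hx0, if_neg (by linarith [hx.1])]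
    have h4 : κ ^ β ≤ dampV σ β x := by
      rw [eV]; exact rpow_le_rpow hκ0.le (by linarith [hx.1]) hβ
    have h5 : q * κ ^ β ≤ 4 * p x := (by gcongr : q * κ ^ β ≤ q * dampV σ β x).trans h3
    have h6 : 4 / κ ^ β * p x ≤ K * p x := mul_le_mul_of_nonneg_right (by linarith) (p0 x)
    have h7 : q ≤ 4 / κ ^ β * p x := by
      rw [div_mul_eq_mul_div, le_div_iff₀ hκβ]; exact h5
    linarith

lemma negpi_lt : -π < π := by linarith [pi_pos]

/-- Fourier coefficient over the period. -/
noncomputable def FC (n : ℤ) (h : ℝ → ℂ) : ℂ := fourierCoeffOn negpi_lt h n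

/-- Exponential used in the coefficient. -/
noncomputable def EE (n : ℤ) (y : ℝ) : ℂ := fourier (-n) (y : AddCircle (π - -π))

lemma EE_cont (n : ℤ) : Continuous (EE n) := by
  unfold EE
  exact (fourier (-n)).continuous.comp (AddCircle.continuous_mk' _)

lemma FC_eq (n : ℤ) (h : ℝ → ℂ) :
    FC n h = (1 / (π - -π)) • ∫ y in (-π)..π, EE n y * h y := by
  unfold FC EE
  rw [fourierCoeffOn_eq_integral]
  simp only [smul_eq_mul]

lemma FC_add (n : ℤ) {f g : ℝ → ℂ} (hf : Continuous f) (hg : Continuous g) :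
    FC n (fun y => f y + g y) = FC n f + FC n g := by
  have cE := EE_cont n
  have i1 : IntervalIntegrable (fun y => EE n y * f y) volume (-π) π :=
    (by fun_prop : Continuous fun y => EE n y * f y).intervalIntegrable _ _
  have i2 : IntervalIntegrable (fun y => EE n y * g y) volume (-π) π :=
    (by fun_prop : Continuous fun y => EE n y * g y).intervalIntegrable _ _
  rw [FC_eq, FC_eq, FC_eq, ← smul_add, ← intervalIntegral.integral_add i1 i2]
  simp only [mul_add]

lemma FC_mul (n : ℤ) (f : ℝ → ℂ) (c : ℂ) :
    FC n (fun y => c * f y) = c * FC n f := by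
  unfold FC
  exact fourierCoeffOn.const_mul f c n negpi_lt

lemma FC_deriv (n : ℤ) {h h1 : ℝ → ℂ} (H : ∀ y, HasDerivAt h (h1 y) y)
    (c1 : Continuous h1) (p : h (-π) = h π) :
    FC n h1 = Complex.I * n * FC n h := by
  by_cases hn : n = 0
  · subst hn
    have : FC 0 h1 = 0 := by
      rw [FC_eq]
      have : ∀ y, EE 0 y = 1 := by intro y; simp [EE]
      simp only [this, one_mul]
      rw [intervalIntegral.integral_eq_sub_of_hasDerivAt (fun y _ => H y) (c1.intervalIntegrable _ _), p]
      simp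
    rw [this]; simp
  · have := fourierCoeffOn_of_hasDerivAt negpi_lt hn (fun y _ => H y) (c1.intervalIntegrable _ _)
    unfold FC
    rw [this, p]
    have hn' : (n : ℂ) ≠ 0 := by exact_mod_cast hn
    have hp : (π : ℂ) ≠ 0 := by exact_mod_cast pi_ne_zero
    push_cast
    field_simp
    ring

lemma FC_deriv2 (n : ℤ) {h h1 h2 : ℝ → ℂ} (H : ∀ y, HasDerivAt h (h1 y) y)
    (H1 : ∀ y, HasDerivAt h1 (h2 y) y) (c2 : Continuous h2) (p : h (-π) = h π)
    (p1 : h1 (-π) = h1 π) :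
    FC n h2 = -(n : ℂ) ^ 2 * FC n h := by
  have c1 : Continuous h1 := continuous_iff_continuousAt.2 fun y => (H1 y).continuousAt
  rw [FC_deriv n H1 c2 p1, FC_deriv n H c1 p]
  linear_combination (n : ℂ) ^ 2 * FC n h * Complex.I_sq

lemma FC_cont (n : ℤ) {G : ℝ → ℝ → ℂ} (hG : Continuous (fun p : ℝ × ℝ => G p.1 p.2)) :
    Continuous (fun x => FC n (G x)) := by
  simp only [FC_eq]
  have : Continuous (fun x => ∫ y in (-π)..π, EE n y * G x y) := by
    apply intervalIntegral.continuous_parametric_intervalIntegral_of_continuous'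
    exact ((EE_cont n).comp continuous_snd).mul hG
  exact this.const_smul (1 / (π - -π))

lemma FC_hasDeriv (n : ℤ) {G G' : ℝ → ℝ → ℂ} (hG : Continuous (fun p : ℝ × ℝ => G p.1 p.2))
    (hG' : Continuous (fun p : ℝ × ℝ => G' p.1 p.2))
    (H : ∀ x y, HasDerivAt (fun w => G w y) (G' x y) x) (x : ℝ) :
    HasDerivAt (fun x => FC n (G x)) (FC n (G' x)) x := by
  simp only [FC_eq]
  suffices HS : HasDerivAt (fun x => ∫ y in (-π)..π, EE n y * G x y)
      (∫ y in (-π)..π, EE n y * G' x y) x from HS.const_smul (1 / (π - -π))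
  have cG : ∀ x, Continuous (fun y => EE n y * G x y) := fun x =>
    (EE_cont n).mul (hG.comp (by fun_prop : Continuous fun y : ℝ => (x, y)))
  have cG' : ∀ x, Continuous (fun y => EE n y * G' x y) := fun x =>
    (EE_cont n).mul (hG'.comp (by fun_prop : Continuous fun y : ℝ => (x, y)))
  have cc : Continuous (fun p : ℝ × ℝ => EE n p.2 * G' p.1 p.2) :=
    ((EE_cont n).comp continuous_snd).mul hG'
  obtain ⟨M, hM⟩ := ((isCompact_Icc (a := x - 1) (b := x + 1)).prod
    (isCompact_Icc (a := -π) (b := π))).exists_bound_of_continuousOn cc.continuousOn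
  refine (intervalIntegral.hasDerivAt_integral_of_dominated_loc_of_deriv_le
    (F := fun x y => EE n y * G x y) (F' := fun x y => EE n y * G' x y)
    (s := Set.Icc (x - 1) (x + 1)) (bound := fun _ => M)
    (Icc_mem_nhds (by linarith) (by linarith)) (.of_forall fun x => (cG x).aestronglyMeasurable)
    ((cG x).intervalIntegrable _ _) (cG' x).aestronglyMeasurable ?_
    (by simp) ?_).2
  · refine .of_forall fun t ht z hz => ?_
    rw [Set.uIoc_of_le negpi_lt.le] at ht
    exact hM (z, t) ⟨hz, Set.Ioc_subset_Icc_self ht⟩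
  · exact .of_forall fun t _ z _ => (H z t).const_mul _

lemma FC_parseval {h : ℝ → ℂ} (hc : Continuous h) :
    HasSum (fun n => ‖FC n h‖ ^ 2) ((2 * π)⁻¹ * ∫ y in (-π)..π, ‖h y‖ ^ 2) := by
  have hL : MemLp h 2 (volume.restrict (Set.Ioc (-π) π)) := by
    obtain ⟨M, hM⟩ := isCompact_Icc.exists_bound_of_continuousOn (s := Set.Icc (-π) π) hc.continuousOn
    refine MemLp.of_bound hc.aestronglyMeasurable M ?_
    refine (ae_restrict_iff' measurableSet_Ioc).2 (.of_forall fun y hy => hM y (Set.Ioc_subset_Icc_self hy))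
  have := hasSum_sq_fourierCoeffOn negpi_lt hL
  rw [show π - -π = 2 * π by ring, smul_eq_mul] at this
  exact this

lemma partials {u : ℝ × ℝ → ℂ} (hu : ContDiff ℝ 2 u) :
    ∃ ux uxx uy uyy : ℝ → ℝ → ℂ,
      Continuous (fun p : ℝ × ℝ => ux p.1 p.2) ∧ Continuous (fun p : ℝ × ℝ => uxx p.1 p.2) ∧
      Continuous (fun p : ℝ × ℝ => uyy p.1 p.2) ∧
      (∀ x y, HasDerivAt (fun w => u (w, y)) (ux x y) x) ∧
      (∀ x y, HasDerivAt (fun w => ux w y) (uxx x y) x) ∧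
      (∀ x y, HasDerivAt (fun w => u (x, w)) (uy x y) y) ∧
      (∀ x y, HasDerivAt (fun w => uy x w) (uyy x y) y) := by
  have l1 : ∀ x y : ℝ, HasDerivAt (fun w : ℝ => (w, y)) ((1 : ℝ), (0 : ℝ)) x := fun x y =>
    (hasDerivAt_id x).prodMk (hasDerivAt_const x y)
  have l2 : ∀ x y : ℝ, HasDerivAt (fun w : ℝ => (x, w)) ((0 : ℝ), (1 : ℝ)) y := fun x y =>
    (hasDerivAt_const y x).prodMk (hasDerivAt_id y)
  have key : ∀ (e : ℝ × ℝ), ContDiff ℝ 1 (fun p => fderiv ℝ u p e) := fun e =>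
    (hu.fderiv_right (m := 1) (by norm_num)).clm_apply contDiff_const
  have d : ∀ p, HasFDerivAt u (fderiv ℝ u p) p := fun p =>
    (hu.differentiable (by norm_num) p).hasFDerivAt
  have d' : ∀ e p, HasFDerivAt (fun p => fderiv ℝ u p e) (fderiv ℝ (fun p => fderiv ℝ u p e) p) p := fun e p =>
    ((key e).differentiable (by norm_num) p).hasFDerivAt
  have c' : ∀ e, Continuous (fun p => fderiv ℝ (fun p => fderiv ℝ u p e) p e) := fun e =>
    ((key e).continuous_fderiv (by norm_num)).clm_apply continuous_const
  refine ⟨fun x y => fderiv ℝ u (x, y) (1, 0),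
    fun x y => fderiv ℝ (fun p => fderiv ℝ u p (1, 0)) (x, y) (1, 0),
    fun x y => fderiv ℝ u (x, y) (0, 1),
    fun x y => fderiv ℝ (fun p => fderiv ℝ u p (0, 1)) (x, y) (0, 1),
    (key (1, 0)).continuous, c' (1, 0), c' (0, 1), ?_, ?_, ?_, ?_⟩
  · exact fun x y => (d (x, y)).comp_hasDerivAt x (l1 x y)
  · exact fun x y => HasFDerivAt.comp_hasDerivAt (l := fun p => fderiv ℝ u p (1, 0)) x (d' (1, 0) (x, y)) (l1 x y)
  · exact fun x y => (d (x, y)).comp_hasDerivAt y (l2 x y)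
  · exact fun x y => HasFDerivAt.comp_hasDerivAt (l := fun p => fderiv ℝ u p (0, 1)) y (d' (0, 1) (x, y)) (l2 x y)

lemma per_deriv {h h1 : ℝ → ℂ} (p : ∀ x, h (x + 2 * π) = h x) (H : ∀ x, HasDerivAt h (h1 x) x) :
    h (-π) = h π ∧ h1 (-π) = h1 π := by
  have e : -π + 2 * π = π := by ring
  refine ⟨by rw [← p (-π), e], ?_⟩
  have a := (H (-π + 2 * π)).comp_add_const (-π) (2 * π)
  have : (fun x => h (x + 2 * π)) = h := funext p
  rw [this, e] at a
  exact (H (-π)).unique a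

/-- Reduction of the two dimensional estimate to the one dimensional estimates. -/
lemma reduce (A q : ℝ) (hA : 0 ≤ A) (W : ℝ → ℝ) (hWm : Measurable W) (M : ℝ) (hWM : ∀ x, W x ≤ M)
    (hW0 : ∀ x, 0 ≤ W x)
    (one : ∀ (n : ℤ) (v v1 v2 g : ℝ → ℂ), (∀ x, HasDerivAt v (v1 x) x) →
      (∀ x, HasDerivAt v1 (v2 x) x) → Continuous v2 → v (-π) = v π → v1 (-π) = v1 π →
      (∀ x, g x = -v2 x + Complex.I * (q * W x : ℝ) * v x - ((q ^ 2 - (n : ℝ) ^ 2 : ℝ) : ℂ) * v x) →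
      ∫ x in (-π)..π, ‖v x‖ ^ 2 ≤ A * ∫ x in (-π)..π, ‖g x‖ ^ 2)
    (u f : ℝ × ℝ → ℂ) (hu : ContDiff ℝ 2 u)
    (px : ∀ x y : ℝ, u (x + 2 * π, y) = u (x, y))
    (py : ∀ x y : ℝ, u (x, y + 2 * π) = u (x, y))
    (hf : ∀ x y : ℝ, f (x, y) = -(deriv (deriv fun w => u (w, y)) x +
                  deriv (deriv fun w => u (x, w)) y) +
                Complex.I * q * W x * u (x, y) - q ^ 2 * u (x, y)) :
    ∫ x in (-π)..π, ∫ y in (-π)..π, ‖u (x, y)‖ ^ 2 ≤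
      A * ∫ x in (-π)..π, ∫ y in (-π)..π, ‖f (x, y)‖ ^ 2 := by
  obtain ⟨ux, uxx, uy, uyy, cx, cxx, cyy, Hx, Hxx, Hy, Hyy⟩ := partials hu
  have hf' : ∀ x y, f (x, y) = (-1) * uxx x y + ((-1) * uyy x y + (Complex.I * (q * W x : ℝ) - q ^ 2) * u (x, y)) := by
    intro x y
    have e1 : (deriv fun w => u (w, y)) = fun w => ux w y := funext fun w => (Hx w y).deriv
    have e2 : (deriv fun w => u (x, w)) = fun w => uy x w := funext fun w => (Hy x w).deriv
    rw [hf, e1, e2, (Hxx x y).deriv, (Hyy x y).deriv]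
    push_cast
    ring
  have sl : ∀ x : ℝ, Continuous fun y : ℝ => (x, y) := fun x => by fun_prop
  have cu : Continuous (fun p : ℝ × ℝ => u (p.1, p.2)) := hu.continuous
  have cux : ∀ x, Continuous fun y => u (x, y) := fun x => hu.continuous.comp (sl x)
  have cuxx : ∀ x, Continuous fun y => uxx x y := fun x => cxx.comp (sl x)
  have cuyy : ∀ x, Continuous fun y => uyy x y := fun x => cyy.comp (sl x)
  have cf : ∀ x, Continuous fun y => f (x, y) := by
    intro x
    simp only [hf']
    exact (continuous_const.mul (cuxx x)).add ((continuous_const.mul (cuyy x)).add (continuous_const.mul (cux x)))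
  -- coefficients
  have fn : ∀ (n : ℤ) x, FC n (fun y => f (x, y)) = -FC n (uxx x) +
      Complex.I * (q * W x : ℝ) * FC n (fun y => u (x, y)) -
      ((q ^ 2 - (n : ℝ) ^ 2 : ℝ) : ℂ) * FC n (fun y => u (x, y)) := by
    intro n x
    simp only [hf']
    rw [FC_add n (f := fun y => (-1) * uxx x y)
        (g := fun y => (-1) * uyy x y + (Complex.I * (q * W x : ℝ) - q ^ 2) * u (x, y))
        (continuous_const.mul (cuxx x)) ((continuous_const.mul (cuyy x)).add (continuous_const.mul (cux x))),
      FC_add n (f := fun y => (-1) * uyy x y)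
        (g := fun y => (Complex.I * (q * W x : ℝ) - q ^ 2) * u (x, y))
        (continuous_const.mul (cuyy x)) (continuous_const.mul (cux x)), FC_mul, FC_mul, FC_mul]
    have pp := per_deriv (fun y => py x y) (fun y => Hy x y)
    rw [FC_deriv2 n (h := fun y => u (x, y)) (h1 := uy x) (h2 := uyy x) (fun y => Hy x y) (fun y => Hyy x y) (cuyy x) pp.1 pp.2]
    push_cast
    ring
  have est : ∀ n : ℤ, ∫ x in (-π)..π, ‖FC n (fun y => u (x, y))‖ ^ 2 ≤
      A * ∫ x in (-π)..π, ‖FC n (fun y => f (x, y))‖ ^ 2 := by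
    intro n
    refine one n _ (fun x => FC n (ux x)) (fun x => FC n (uxx x)) _
      (FC_hasDeriv n (G := fun x y => u (x, y)) cu cx Hx) (FC_hasDeriv n cx cxx Hxx)
      (FC_cont n cxx) ?_ ?_ (fn n)
    · congr 1; ext y
      exact (per_deriv (fun x => px x y) (fun x => Hx x y)).1
    · congr 1; ext y
      exact (per_deriv (fun x => px x y) (fun x => Hx x y)).2
  have bW : BM W := ⟨hWm, M, fun x _ => by rw [abs_of_nonneg (hW0 x)]; exact hWM x⟩
  -- measurability of f
  have mf : Measurable f := by
    have : f = fun p => (-1) * uxx p.1 p.2 + ((-1) * uyy p.1 p.2 + (Complex.I * (q * W p.1 : ℝ) - q ^ 2) * u (p.1, p.2)) := by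
      ext ⟨x, y⟩; exact hf' x y
    rw [this]
    have m1 := cxx.measurable
    have m2 := cyy.measurable
    have m3 := cu.measurable
    have m4 : Measurable (fun p : ℝ × ℝ => Complex.I * ((q * W p.1 : ℝ) : ℂ) - (q : ℂ) ^ 2) :=
      ((Complex.measurable_ofReal.comp ((hWm.comp measurable_fst).const_mul q)).const_mul Complex.I).sub_const _
    exact (m1.const_mul _).add ((m2.const_mul _).add (m4.mul m3))
  obtain ⟨B, hB⟩ : ∃ B, ∀ x ∈ Set.Icc (-π) π, ∀ y ∈ Set.Icc (-π) π, ‖f (x, y)‖ ≤ B := by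
    obtain ⟨B1, h1⟩ := ((isCompact_Icc (a := -π) (b := π)).prod
      (isCompact_Icc (a := -π) (b := π))).exists_bound_of_continuousOn cxx.continuousOn
    obtain ⟨B2, h2⟩ := ((isCompact_Icc (a := -π) (b := π)).prod
      (isCompact_Icc (a := -π) (b := π))).exists_bound_of_continuousOn cyy.continuousOn
    obtain ⟨B3, h3⟩ := ((isCompact_Icc (a := -π) (b := π)).prod
      (isCompact_Icc (a := -π) (b := π))).exists_bound_of_continuousOn cu.continuousOn
    refine ⟨B1 + (B2 + (|q| * M + q ^ 2) * B3), fun x hx y hy => ?_⟩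
    have h1 := h1 (x, y) ⟨hx, hy⟩
    have h2 := h2 (x, y) ⟨hx, hy⟩
    have h3 := h3 (x, y) ⟨hx, hy⟩
    rw [hf']
    refine (norm_add_le _ _).trans (add_le_add (by simpa using h1) ((norm_add_le _ _).trans (add_le_add (by simpa using h2) ?_)))
    rw [norm_mul]
    have : ‖Complex.I * ((q * W x : ℝ) : ℂ) - (q : ℂ) ^ 2‖ ≤ |q| * M + q ^ 2 := by
      refine (norm_sub_le _ _).trans (add_le_add ?_ ?_)
      · rw [norm_mul, Complex.norm_I, one_mul, Complex.norm_real, Real.norm_eq_abs, abs_mul, abs_of_nonneg (hW0 x)]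
        exact mul_le_mul_of_nonneg_left (hWM x) (abs_nonneg _)
      · simp
    exact mul_le_mul this h3 (norm_nonneg _) ((norm_nonneg _).trans this)
  -- the inner integral of |f|^2
  have bF : BM (fun x => ∫ y in (-π)..π, ‖f (x, y)‖ ^ 2) := by
    constructor
    · simp only [intervalIntegral.integral_of_le negpi_lt.le]
      have : StronglyMeasurable (fun p : ℝ × ℝ => ‖f p‖ ^ 2) := (mf.norm.pow_const 2).stronglyMeasurable
      exact (this.integral_prod_right (ν := volume.restrict (Set.Ioc (-π) π))).measurable
    · refine ⟨B ^ 2 * |π - -π|, fun x hx => ?_⟩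
      rw [← Real.norm_eq_abs]
      refine intervalIntegral.norm_integral_le_of_norm_le_const (fun y hy => ?_)
      rw [Set.uIoc_of_le negpi_lt.le] at hy
      have := hB x hx y (Set.Ioc_subset_Icc_self hy)
      rw [norm_pow, norm_norm]
      exact pow_le_pow_left₀ (norm_nonneg _) this 2
  have bfn : ∀ n : ℤ, BM (fun x => ‖FC n (fun y => f (x, y))‖ ^ 2) := by
    intro n
    constructor
    · refine Measurable.pow_const (Measurable.norm ?_) 2
      simp only [fn]
      have c1 := (FC_cont n cxx).measurable
      have c2 := (FC_cont n (G := fun x y => u (x, y)) cu).measurable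
      have m4 : Measurable (fun x : ℝ => Complex.I * ((q * W x : ℝ) : ℂ)) :=
        ((Complex.measurable_ofReal.comp (hWm.const_mul q)).const_mul Complex.I)
      exact (c1.neg.add (m4.mul c2)).sub (c2.const_mul _)
    · obtain ⟨K, hK⟩ := bF.2
      refine ⟨(2 * π)⁻¹ * K, fun x hx => ?_⟩
      rw [abs_of_nonneg (by positivity)]
      refine (le_hasSum (FC_parseval (cf x)) n (fun _ _ => by positivity)).trans ?_
      exact mul_le_mul_of_nonneg_left ((le_abs_self _).trans (hK x hx)) (by positivity)
  have bun : ∀ n : ℤ, Continuous (fun x => ‖FC n (fun y => u (x, y))‖ ^ 2) := fun n =>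
    (FC_cont n (G := fun x y => u (x, y)) cu).norm.pow 2
  have bd : ∀ s : Finset ℤ, ∑ n ∈ s, ∫ x in (-π)..π, ‖FC n (fun y => u (x, y))‖ ^ 2 ≤
      A * ((2 * π)⁻¹ * ∫ x in (-π)..π, ∫ y in (-π)..π, ‖f (x, y)‖ ^ 2) := by
    intro s
    refine (Finset.sum_le_sum fun n _ => est n).trans ?_
    rw [← Finset.mul_sum, ← intervalIntegral.integral_finsetSum (fun n _ => (bfn n).ii pim pip)]
    refine mul_le_mul_of_nonneg_left ?_ hA
    rw [← intervalIntegral.integral_const_mul]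
    refine intervalIntegral.integral_mono_on negpi_lt.le ?_ ((bF.ii pim pip).const_mul _) (fun x _ => ?_)
    · have := IntervalIntegrable.sum s (f := fun n x => ‖FC n (fun y => f (x, y))‖ ^ 2) (μ := volume) (a := -π) (b := π)
        (fun n _ => (bfn n).ii pim pip)
      simpa [Finset.sum_fn] using this
    · exact sum_le_hasSum s (fun _ _ => by positivity) (FC_parseval (cf x))
  have nn : ∀ n : ℤ, 0 ≤ ∫ x in (-π)..π, ‖FC n (fun y => u (x, y))‖ ^ 2 := fun n =>
    intervalIntegral.integral_nonneg negpi_lt.le (fun x _ => by positivity)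
  have smb := summable_of_sum_le nn bd
  have HS := hasSum_integral_of_summable_integral_norm (μ := volume.restrict (Set.Ioc (-π) π))
    (F := fun (n : ℤ) x => ‖FC n (fun y => u (x, y))‖ ^ 2)
    (fun n => (intervalIntegrable_iff_integrableOn_Ioc_of_le negpi_lt.le).1 ((bun n).intervalIntegrable _ _))
    (by
      refine smb.congr fun n => ?_
      rw [intervalIntegral.integral_of_le negpi_lt.le]
      simp only [norm_pow, norm_norm])
  have eq : ∫ x in Set.Ioc (-π) π, ∑' n : ℤ, ‖FC n (fun y => u (x, y))‖ ^ 2 =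
      (2 * π)⁻¹ * ∫ x in (-π)..π, ∫ y in (-π)..π, ‖u (x, y)‖ ^ 2 := by
    rw [intervalIntegral.integral_of_le negpi_lt.le, ← MeasureTheory.integral_const_mul]
    refine MeasureTheory.integral_congr_ae (.of_forall fun x => ?_)
    exact (FC_parseval (cux x)).tsum_eq
  rw [eq] at HS
  have fin := hasSum_le_of_sum_le HS (c := A * ((2 * π)⁻¹ * ∫ x in (-π)..π, ∫ y in (-π)..π, ‖f (x, y)‖ ^ 2)) (by
    intro s
    refine le_trans (le_of_eq (Finset.sum_congr rfl fun n _ => ?_)) (bd s)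
    rw [intervalIntegral.integral_of_le negpi_lt.le])
  have hp : 0 < (2 * π)⁻¹ := by positivity
  refine le_of_mul_le_mul_left (fin.trans (le_of_eq ?_)) hp
  ring

/-- The resolvent estimate on the torus: there are `C, q₀ > 0` depending only on
`C₀, σ, β` such that for all `q ≥ q₀` and all `2π`-biperiodic `C²` functions `u` with
`f = -Δu + iqW(x)u - q²u`, one has `∫∫ |u|² ≤ C² q^{2/(β+2)} ∫∫ |f|²`. -/
theorem damped_wave_torus_resolvent_estimate
    (C₀ σ β : ℝ) (hC₀ : 0 < C₀) (hσ : σ ∈ Set.Ioo 0 π) (hβ : 0 ≤ β) :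
    ∃ C > (0 : ℝ), ∃ q₀ > (0 : ℝ),
      ∀ (W : ℝ → ℝ), Function.Periodic W (2 * π) → Measurable W →
        (∃ M : ℝ, ∀ x : ℝ, W x ≤ M) → (∀ x : ℝ, 0 ≤ W x) →
        (∀ x ∈ Set.Icc (-π) π,
          dampV σ β x / C₀ ≤ W x ∧ W x ≤ C₀ * dampV σ β x) →
        ∀ q ≥ q₀,
          ∀ u f : ℝ × ℝ → ℂ, ContDiff ℝ 2 u →
            (∀ x y : ℝ, u (x + 2 * π, y) = u (x, y)) →
            (∀ x y : ℝ, u (x, y + 2 * π) = u (x, y)) →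
            (∀ x y : ℝ,
              f (x, y) = -(deriv (deriv fun w => u (w, y)) x +
                  deriv (deriv fun w => u (x, w)) y) +
                Complex.I * q * W x * u (x, y) - q ^ 2 * u (x, y)) →
            ∫ x in (-π)..π, ∫ y in (-π)..π, ‖u (x, y)‖ ^ 2 ≤
              C ^ 2 * q ^ ((2 : ℝ) / (β + 2)) *
                ∫ x in (-π)..π, ∫ y in (-π)..π, ‖f (x, y)‖ ^ 2 := by
  obtain ⟨K, s, q₀, hK, hs0, hs, hKs, hq0, hw⟩ := weights C₀ σ β hC₀ hσ hβ
  obtain ⟨C, hC, hcore⟩ := core K s hK hs0 hs hKs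
  refine ⟨√C, Real.sqrt_pos.2 hC, q₀, by linarith, ?_⟩
  rintro W - hWm ⟨M, hM⟩ hW0 hWV q hq u f hu px py hf
  obtain ⟨hΛ, hΛq, ψ, ψ', m, h1, h2, h3, h4, h5, h6, h7, h8, h9, h10, h11⟩ := hw W hWV q hq _ rfl
  have hqpos : 0 ≤ q := by linarith [hq.le]
  have e : (√C) ^ 2 * q ^ ((2 : ℝ) / (β + 2)) = C * (q ^ (1 / (β + 2))) ^ 2 := by
    rw [Real.sq_sqrt hC.le, ← Real.rpow_natCast, ← Real.rpow_mul hqpos]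
    congr 2
    push_cast
    ring
  rw [e]
  refine reduce _ q (by positivity) W hWm M hM hW0 ?_ u f hu px py hf
  intro n v v1 v2 g Hv Hv1 c2 p p1 hg
  refine hcore _ q (q ^ 2 - (n : ℝ) ^ 2) (fun x => q * W x) ψ ψ' m v v1 v2 g hΛ hΛq
    (by nlinarith [sq_nonneg (n : ℝ)]) ?_ (fun x => mul_nonneg hqpos (hW0 x))
    h1 h2 h3 h4 h5 h6 h7 h8 h9 h10 h11 Hv Hv1 c2 p p1 hg
  have bW : BM W := ⟨hWm, M, fun x _ => by rw [abs_of_nonneg (hW0 x)]; exact hM x⟩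
  exact bW.const_mul q
end

section
/- There exist constants C > 0 and q₀ > 0, depending only on C₀, σ, and β, such that for all q ≥ q₀, all real E with E ≤ q², and all u, f as in the context (i.e. u is 2π-periodic, twice continuously differentiable, and f = −u'' + i·q·W·u − E·u), one has ∫_{−π}^{π} |u|² ≤ C · q^{2/(β+2)} · ∫_{−π}^{π} |f|². -/
open Real MeasureTheory intervalIntegral

structure WSys (u v p s r z w : ℝ → ℝ) : Prop where
  hu : ∀ x, HasDerivAt u (p x) x
  hv : ∀ x, HasDerivAt v (s x) x
  hp : ∀ x, HasDerivAt p (r x) x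
  hs : ∀ x, HasDerivAt s (z x) x
  cr : Continuous r
  cz : Continuous z
  wm : Measurable w
  w0 : ∀ x, 0 ≤ w x
  wM : ∃ M, ∀ x, w x ≤ M
  bu : u (-π) = u π
  bv : v (-π) = v π
  bp : p (-π) = p π
  bs : s (-π) = s π

/-- squared modulus of the right-hand side -/
def gg (u v r z w : ℝ → ℝ) (E : ℝ) (x : ℝ) : ℝ :=
  (-r x - w x * v x - E * u x) ^ 2 + (-z x + w x * u x - E * v x) ^ 2

lemma ii_bdd {h c : ℝ → ℝ} (hm : Measurable h) (hc : Continuous c) (hb : ∀ x, |h x| ≤ c x)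
    (a b : ℝ) : IntervalIntegrable h volume a b := by
  refine (hc.intervalIntegrable a b).mono_fun hm.aestronglyMeasurable ?_
  refine Filter.Eventually.of_forall fun x => ?_
  simp only [Real.norm_eq_abs]
  exact (hb x).trans (le_abs_self _)

lemma var_bound {F F' h : ℝ → ℝ} {c d : ℝ} (hF : ∀ x, HasDerivAt F (F' x) x)
    (hc : Continuous F') (hi : IntervalIntegrable h volume c d)
    (hb : ∀ x ∈ Set.Icc c d, |F' x| ≤ h x) {x y : ℝ} (hx : x ∈ Set.Icc c d)
    (hy : y ∈ Set.Icc c d) : F x ≤ F y + ∫ t in c..d, h t := by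
  have hcd : c ≤ d := hx.1.trans hx.2
  have e1 : ∫ t in y..x, F' t = F x - F y :=
    integral_eq_sub_of_hasDerivAt (fun t _ => hF t) (hc.intervalIntegrable _ _)
  have key : ∀ α β : ℝ, c ≤ α → α ≤ β → β ≤ d → |∫ t in α..β, F' t| ≤ ∫ t in c..d, h t := by
    intro α β h1 h2 h3
    have s1 : |∫ t in α..β, F' t| ≤ ∫ t in α..β, |F' t| := abs_integral_le_integral_abs h2
    have s2 : ∫ t in α..β, |F' t| ≤ ∫ t in c..d, |F' t| := by
      refine integral_mono_interval h1 h2 h3 ?_ (hc.abs.intervalIntegrable _ _)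
      exact Filter.Eventually.of_forall fun t => abs_nonneg _
    have s3 : ∫ t in c..d, |F' t| ≤ ∫ t in c..d, h t :=
      integral_mono_on hcd (hc.abs.intervalIntegrable _ _) hi hb
    linarith
  have : |∫ t in y..x, F' t| ≤ ∫ t in c..d, h t := by
    rcases le_total y x with h | h
    · exact key y x hy.1 h hx.2
    · rw [integral_symm, abs_neg]; exact key x y hx.1 h hy.2
  rw [e1] at this
  have := le_abs_self (F x - F y)
  linarith

namespace WSys

lemma cu {u v p s r z w : ℝ → ℝ} (H : WSys u v p s r z w) : Continuous u := continuous_iff_continuousAt.2 fun x => (H.hu x).continuousAt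
lemma cv {u v p s r z w : ℝ → ℝ} (H : WSys u v p s r z w) : Continuous v := continuous_iff_continuousAt.2 fun x => (H.hv x).continuousAt
lemma cp {u v p s r z w : ℝ → ℝ} (H : WSys u v p s r z w) : Continuous p := continuous_iff_continuousAt.2 fun x => (H.hp x).continuousAt
lemma cs {u v p s r z w : ℝ → ℝ} (H : WSys u v p s r z w) : Continuous s := continuous_iff_continuousAt.2 fun x => (H.hs x).continuousAt

lemma iw {u v p s r z w : ℝ → ℝ} (H : WSys u v p s r z w) (a b : ℝ) : IntervalIntegrable w volume a b := by
  obtain ⟨M, hM⟩ := H.wM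
  exact ii_bdd H.wm (continuous_const (y := M)) (fun x => by rw [abs_of_nonneg (H.w0 x)]; exact hM x) a b

lemma iwn {u v p s r z w : ℝ → ℝ} (H : WSys u v p s r z w) (a b : ℝ) : IntervalIntegrable (fun x => w x * (u x ^ 2 + v x ^ 2)) volume a b := by
  have := H.cu
  have := H.cv
  exact (H.iw a b).mul_continuousOn (by fun_prop)

lemma ig {u v p s r z w : ℝ → ℝ} (H : WSys u v p s r z w) (E a b : ℝ) : IntervalIntegrable (gg u v r z w E) volume a b := by
  have h1 := H.cu
  have h2 := H.cv
  have h3 := H.cr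
  have h4 := H.cz
  have hw2 : IntervalIntegrable (fun x => w x ^ 2) volume a b := by
    obtain ⟨M, hM⟩ := H.wM
    refine ii_bdd (H.wm.pow_const 2) (continuous_const (y := M ^ 2)) (fun x => ?_) a b
    rw [abs_of_nonneg (by positivity)]
    exact pow_le_pow_left₀ (H.w0 x) (hM x) 2
  have e : gg u v r z w E = fun x => (w x ^ 2 * (u x ^ 2 + v x ^ 2) +
      w x * (2 * (v x * (r x + E * u x) - u x * (z x + E * v x)))) +
      ((r x + E * u x) ^ 2 + (z x + E * v x) ^ 2) := by
    funext x; simp only [gg]; ring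
  rw [e]
  refine ((hw2.mul_continuousOn (by fun_prop)).add
    ((H.iw a b).mul_continuousOn (by fun_prop))).add ?_
  exact Continuous.intervalIntegrable (by fun_prop) _ _

lemma i_n {u v p s r z w : ℝ → ℝ} (H : WSys u v p s r z w) (a b : ℝ) : IntervalIntegrable (fun x => u x ^ 2 + v x ^ 2) volume a b := by
  have := H.cu
  have := H.cv
  exact Continuous.intervalIntegrable (by fun_prop) _ _

lemma i_e {u v p s r z w : ℝ → ℝ} (H : WSys u v p s r z w) (a b : ℝ) : IntervalIntegrable (fun x => p x ^ 2 + s x ^ 2) volume a b := by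
  have := H.cp
  have := H.cs
  exact Continuous.intervalIntegrable (by fun_prop) _ _

lemma iA {u v p s r z w : ℝ → ℝ} (H : WSys u v p s r z w) (E t a b : ℝ) : IntervalIntegrable
    (fun x => (t * (u x ^ 2 + v x ^ 2) + t⁻¹ * gg u v r z w E x) / 2) volume a b :=
  (((H.i_n a b).const_mul t).add ((H.ig E a b).const_mul t⁻¹)).div_const 2

lemma A_eq {u v p s r z w : ℝ → ℝ} (H : WSys u v p s r z w) (E t a b : ℝ) :
    ∫ x in a..b, (t * (u x ^ 2 + v x ^ 2) + t⁻¹ * gg u v r z w E x) / 2 =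
    (t * (∫ x in a..b, (u x ^ 2 + v x ^ 2)) + t⁻¹ * ∫ x in a..b, gg u v r z w E x) / 2 := by
  rw [intervalIntegral.integral_div, integral_add ((H.i_n a b).const_mul t) ((H.ig E a b).const_mul t⁻¹),
    intervalIntegral.integral_const_mul, intervalIntegral.integral_const_mul]

lemma amgm {t : ℝ} (ht : 0 < t) (a b c d : ℝ) :
    a * c + b * d ≤ (t * (a ^ 2 + b ^ 2) + t⁻¹ * (c ^ 2 + d ^ 2)) / 2 := by
  have h : (t * (a ^ 2 + b ^ 2) + t⁻¹ * (c ^ 2 + d ^ 2)) / 2 - (a * c + b * d)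
      = t⁻¹ * ((t * a - c) ^ 2 + (t * b - d) ^ 2) / 2 := by
    field_simp; ring
  have : 0 ≤ t⁻¹ * ((t * a - c) ^ 2 + (t * b - d) ^ 2) / 2 := by positivity
  linarith

lemma est1 {u v p s r z w : ℝ → ℝ} (H : WSys u v p s r z w) (E : ℝ) {t : ℝ} (ht : 0 < t) :
    ∫ x in (-π)..π, w x * (u x ^ 2 + v x ^ 2) ≤
      ∫ x in (-π)..π, (t * (u x ^ 2 + v x ^ 2) + t⁻¹ * gg u v r z w E x) / 2 := by
  have h1 := H.cu
  have h2 := H.cv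
  have h3 := H.cr
  have h4 := H.cz
  have hd : ∀ x, HasDerivAt (fun x => s x * u x - p x * v x) (z x * u x - r x * v x) x := by
    intro x
    exact (((H.hs x).mul (H.hu x)).sub ((H.hp x).mul (H.hv x))).congr_deriv (by ring)
  have hc : IntervalIntegrable (fun x => z x * u x - r x * v x) volume (-π) π :=
    Continuous.intervalIntegrable (by fun_prop) _ _
  have e0 : ∫ x in (-π)..π, (z x * u x - r x * v x) = 0 := by
    rw [integral_eq_sub_of_hasDerivAt (fun x _ => hd x) hc]
    rw [H.bu, H.bv, H.bp, H.bs]; ring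
  have : ∫ x in (-π)..π, w x * (u x ^ 2 + v x ^ 2) ≤ ∫ x in (-π)..π,
     ((t * (u x ^ 2 + v x ^ 2) + t⁻¹ * gg u v r z w E x) / 2 + (z x * u x - r x * v x)) := by
    refine integral_mono_on (by linarith [pi_pos]) (H.iwn _ _) ((H.iA E t _ _).add hc) ?_
    intro x _
    have := amgm ht (u x) (v x) (-z x + w x * u x - E * v x) (-(-r x - w x * v x - E * u x))
    simp only [gg]
    have e : (-z x + w x * u x - E * v x) ^ 2 + (-(-r x - w x * v x - E * u x)) ^ 2 =
      (-r x - w x * v x - E * u x) ^ 2 + (-z x + w x * u x - E * v x) ^ 2 := by ring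
    rw [e] at this
    nlinarith [this]
  rw [integral_add (H.iA E t _ _) hc, e0, add_zero] at this
  exact this

lemma est2 {u v p s r z w : ℝ → ℝ} (H : WSys u v p s r z w) (E : ℝ) {t : ℝ} (ht : 0 < t) :
    ∫ x in (-π)..π, (p x ^ 2 + s x ^ 2) ≤ E * (∫ x in (-π)..π, (u x ^ 2 + v x ^ 2)) +
      ∫ x in (-π)..π, (t * (u x ^ 2 + v x ^ 2) + t⁻¹ * gg u v r z w E x) / 2 := by
  have h1 := H.cu
  have h2 := H.cv
  have h3 := H.cr
  have h4 := H.cz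
  have h5 := H.cp
  have h6 := H.cs
  have hd : ∀ x, HasDerivAt (fun x => p x * u x + s x * v x)
      (r x * u x + z x * v x + p x ^ 2 + s x ^ 2) x := by
    intro x
    exact (((H.hp x).mul (H.hu x)).add ((H.hs x).mul (H.hv x))).congr_deriv (by ring)
  have hc : IntervalIntegrable (fun x => r x * u x + z x * v x + p x ^ 2 + s x ^ 2) volume (-π) π :=
    Continuous.intervalIntegrable (by fun_prop) _ _
  have e0 : ∫ x in (-π)..π, (r x * u x + z x * v x + p x ^ 2 + s x ^ 2) = 0 := by
    rw [integral_eq_sub_of_hasDerivAt (fun x _ => hd x) hc]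
    rw [H.bu, H.bv, H.bp, H.bs]; ring
  have : ∫ x in (-π)..π, (p x ^ 2 + s x ^ 2) ≤ ∫ x in (-π)..π,
     ((E * (u x ^ 2 + v x ^ 2) + (t * (u x ^ 2 + v x ^ 2) + t⁻¹ * gg u v r z w E x) / 2)
      + (r x * u x + z x * v x + p x ^ 2 + s x ^ 2)) := by
    refine integral_mono_on (by linarith [pi_pos]) (H.i_e _ _)
      ((((H.i_n _ _).const_mul E).add (H.iA E t _ _)).add hc) ?_
    intro x _
    have := amgm ht (u x) (v x) (-r x - w x * v x - E * u x) (-z x + w x * u x - E * v x)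
    simp only [gg]
    nlinarith [this]
  rw [integral_add (((H.i_n _ _).const_mul E).add (H.iA E t _ _)) hc, e0, add_zero,
    integral_add ((H.i_n _ _).const_mul E) (H.iA E t _ _),
    intervalIntegral.integral_const_mul] at this
  exact this

/-- Poincare type inequality -/
lemma poincare {u v p s r z w : ℝ → ℝ} (H : WSys u v p s r z w) {y : ℝ} (hy : y ∈ Set.Icc (-π) π) :
    ∫ x in (-π)..π, (u x ^ 2 + v x ^ 2) ≤ 4 * π * (u y ^ 2 + v y ^ 2) +
      16 * π ^ 2 * ∫ x in (-π)..π, (p x ^ 2 + s x ^ 2) := by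
  have h1 := H.cu
  have h2 := H.cv
  have h5 := H.cp
  have h6 := H.cs
  have hpi := pi_pos
  set N := ∫ x in (-π)..π, (u x ^ 2 + v x ^ 2) with hN
  set I := ∫ x in (-π)..π, (p x ^ 2 + s x ^ 2) with hI
  have hd : ∀ x, HasDerivAt (fun x => u x ^ 2 + v x ^ 2) (2 * (u x * p x + v x * s x)) x := by
    intro x
    exact (((H.hu x).pow 2).add ((H.hv x).pow 2)).congr_deriv (by norm_num; ring)
  have key : ∀ x ∈ Set.Icc (-π) π, u x ^ 2 + v x ^ 2 ≤ (u y ^ 2 + v y ^ 2) +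
      ((4 * π)⁻¹ * N + (4 * π) * I) := by
    intro x hx
    have := var_bound (h := fun x => (4 * π)⁻¹ * (u x ^ 2 + v x ^ 2) + (4 * π) * (p x ^ 2 + s x ^ 2))
      hd (by fun_prop) (((H.i_n (-π) π).const_mul _).add ((H.i_e (-π) π).const_mul _)) ?_ hx hy
    · rw [integral_add ((H.i_n (-π) π).const_mul _) ((H.i_e (-π) π).const_mul _),
        intervalIntegral.integral_const_mul, intervalIntegral.integral_const_mul] at this
      exact this
    · intro x _
      have t0 : 0 < (4 * π)⁻¹ := by positivity
      have a1 := amgm t0 (u x) (v x) (p x) (s x)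
      have a2 := amgm t0 (u x) (v x) (-p x) (-s x)
      rw [inv_inv] at a1 a2
      rw [abs_le]
      constructor <;> nlinarith
  have := integral_mono_on (by linarith) (H.i_n (-π) π)
    (_root_.intervalIntegrable_const (μ := volume) (a := -π) (b := π)) key
  rw [intervalIntegral.integral_const, ← hN, smul_eq_mul] at this
  have e : (π - -π) * (u y ^ 2 + v y ^ 2 + ((4 * π)⁻¹ * N + 4 * π * I)) =
    2 * π * (u y ^ 2 + v y ^ 2) + N / 2 + 8 * π ^ 2 * I := by field_simp; ring
  rw [e] at this
  linarith

/-- collar estimate -/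
lemma collar {u v p s r z w : ℝ → ℝ} (H : WSys u v p s r z w) {E a δ t : ℝ} (hE : 0 ≤ E) (hδ : 0 < δ) (ht : 0 < t) :
    ∫ x in a..(a + δ), 30 * ((x - a) * (a + δ - x) / δ ^ 2) ^ 2 *
      (p x ^ 2 + s x ^ 2 + E * (u x ^ 2 + v x ^ 2)) ≤
    4 * (∫ x in a..(a + δ), (t * (u x ^ 2 + v x ^ 2) + t⁻¹ * gg u v r z w E x) / 2) +
    (6 * E + 120 / δ ^ 2) * ∫ x in a..(a + δ), (u x ^ 2 + v x ^ 2) := by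
  have h1 := H.cu
  have h2 := H.cv
  have h3 := H.cr
  have h4 := H.cz
  have h5 := H.cp
  have h6 := H.cs
  have hδ' := hδ.ne'
  set χ : ℝ → ℝ := fun x => (x - a) * (a + δ - x) / δ ^ 2 with hχ
  set χ' : ℝ → ℝ := fun x => (2 * a + δ - 2 * x) / δ ^ 2 with hχ'
  have cχ : Continuous χ := by fun_prop
  have cχ' : Continuous χ' := by fun_prop
  have dχ : ∀ x, HasDerivAt χ (χ' x) x := by
    intro x
    have := ((((hasDerivAt_id x).sub_const a).mul ((hasDerivAt_id x).const_sub (a + δ))).div_const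
      (δ ^ 2))
    exact this.congr_deriv (by simp only [hχ', id]; ring)
  have hd : ∀ x, HasDerivAt (fun x => 60 * χ x ^ 2 * (p x * u x + s x * v x))
      (60 * χ x ^ 2 * (r x * u x + z x * v x + p x ^ 2 + s x ^ 2) +
        120 * χ x * χ' x * (p x * u x + s x * v x)) x := by
    intro x
    exact ((((dχ x).pow 2).const_mul 60).mul
      (((H.hp x).mul (H.hu x)).add ((H.hs x).mul (H.hv x)))).congr_deriv (by simp; ring)
  have hc : IntervalIntegrable (fun x =>
      (60 * χ x ^ 2 * (r x * u x + z x * v x + p x ^ 2 + s x ^ 2) +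
        120 * χ x * χ' x * (p x * u x + s x * v x))) volume a (a + δ) :=
    Continuous.intervalIntegrable (by fun_prop) _ _
  have e0 : ∫ x in a..(a + δ), (60 * χ x ^ 2 * (r x * u x + z x * v x + p x ^ 2 + s x ^ 2) +
        120 * χ x * χ' x * (p x * u x + s x * v x)) = 0 := by
    rw [integral_eq_sub_of_hasDerivAt (fun x _ => hd x) hc]
    simp [hχ]
  have hi := ((((H.iA E t a (a + δ)).const_mul 4).add
        ((H.i_n a (a + δ)).const_mul (6 * E + 120 / δ ^ 2))))
  have : ∫ x in a..(a + δ), 30 * χ x ^ 2 * (p x ^ 2 + s x ^ 2 + E * (u x ^ 2 + v x ^ 2)) ≤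
     ∫ x in a..(a + δ), ((4 * ((t * (u x ^ 2 + v x ^ 2) + t⁻¹ * gg u v r z w E x) / 2) +
      (6 * E + 120 / δ ^ 2) * (u x ^ 2 + v x ^ 2)) +
      (60 * χ x ^ 2 * (r x * u x + z x * v x + p x ^ 2 + s x ^ 2) +
        120 * χ x * χ' x * (p x * u x + s x * v x))) := by
    refine integral_mono_on (by linarith) (Continuous.intervalIntegrable (by fun_prop) _ _)
      (hi.add hc) ?_
    intro x hx
    have am := amgm ht (u x) (v x) (-r x - w x * v x - E * u x) (-z x + w x * u x - E * v x)
    have q1 : 0 ≤ χ x := by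
      simp only [hχ]
      have := hx.1; have := hx.2
      have : 0 ≤ x - a := by linarith
      have : 0 ≤ a + δ - x := by linarith
      positivity
    have q2 : χ x ≤ 1 / 4 := by
      simp only [hχ]
      rw [div_le_iff₀ (by positivity)]
      nlinarith [sq_nonneg (2 * (x - a) - δ)]
    have q3 : χ x ^ 2 ≤ 1 / 16 := by nlinarith
    have q4 : χ' x ^ 2 ≤ 1 / δ ^ 2 := by
      simp only [hχ']
      rw [div_pow, div_le_div_iff₀ (by positivity) (by positivity)]
      have : (2 * a + δ - 2 * x) ^ 2 ≤ δ ^ 2 := by nlinarith [hx.1, hx.2]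
      nlinarith [sq_nonneg δ]
    have A0 : 0 ≤ (t * (u x ^ 2 + v x ^ 2) + t⁻¹ * gg u v r z w E x) / 2 := by
      simp only [gg]; positivity
    set n := u x ^ 2 + v x ^ 2 with hn
    have n0 : 0 ≤ n := by positivity
    set AA := (t * n + t⁻¹ * gg u v r z w E x) / 2 with hAA
    have am' : u x * (-r x - w x * v x - E * u x) + v x * (-z x + w x * u x - E * v x) ≤ AA := am
    have c1 : 60 * χ x ^ 2 * (u x * (-r x - w x * v x - E * u x) + v x * (-z x + w x * u x - E * v x))
        ≤ 4 * AA := by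
      have := mul_le_mul_of_nonneg_left am' (by positivity : 0 ≤ 60 * χ x ^ 2)
      nlinarith
    have c2 : 90 * χ x ^ 2 * (E * n) ≤ 6 * E * n := by
      have : 0 ≤ E * n := by positivity
      nlinarith
    have c3 : 120 * χ' x ^ 2 * n ≤ 120 / δ ^ 2 * n := by
      have := mul_le_mul_of_nonneg_right q4 n0
      have e : 120 / δ ^ 2 * n = 120 * (1 / δ ^ 2 * n) := by ring
      rw [e]; linarith
    have c4 : 0 ≤ 30 * ((χ x * p x + 2 * χ' x * u x) ^ 2 + (χ x * s x + 2 * χ' x * v x) ^ 2) := by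
      positivity
    have c5 : 30 * χ x ^ 2 * (p x ^ 2 + s x ^ 2 + E * n) =
      60 * χ x ^ 2 * (u x * (-r x - w x * v x - E * u x) + v x * (-z x + w x * u x - E * v x))
      + 90 * χ x ^ 2 * (E * n) + 120 * χ' x ^ 2 * n
      - 30 * ((χ x * p x + 2 * χ' x * u x) ^ 2 + (χ x * s x + 2 * χ' x * v x) ^ 2)
      + (60 * χ x ^ 2 * (r x * u x + z x * v x + p x ^ 2 + s x ^ 2) +
        120 * χ x * χ' x * (p x * u x + s x * v x)) := by
      simp only [hn]; ring
    rw [c5, add_mul (6 * E)]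
    linarith
  rw [integral_add hi hc, e0, add_zero,
    integral_add ((H.iA E t a (a + δ)).const_mul 4) ((H.i_n a (a + δ)).const_mul _),
    intervalIntegral.integral_const_mul, intervalIntegral.integral_const_mul] at this
  exact this


lemma far {u v p s r z w : ℝ → ℝ} (H : WSys u v p s r z w) {E C₀ δ t c d : ℝ} (ht : 0 < t) (hC : 0 < C₀)
    (hc : -π ≤ c) (hcd : c ≤ d) (hd : d ≤ π)
    (hf : ∀ x ∈ Set.Icc c d, 1 ≤ C₀ * δ ^ 2 * w x) :
    ∫ x in c..d, (u x ^ 2 + v x ^ 2) ≤ C₀ * δ ^ 2 *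
      ∫ x in (-π)..π, (t * (u x ^ 2 + v x ^ 2) + t⁻¹ * gg u v r z w E x) / 2 := by
  have s1 : ∫ x in c..d, (u x ^ 2 + v x ^ 2) ≤
      ∫ x in c..d, C₀ * δ ^ 2 * (w x * (u x ^ 2 + v x ^ 2)) := by
    refine integral_mono_on hcd (H.i_n _ _) ((H.iwn _ _).const_mul _) ?_
    intro x hx
    have n0 : 0 ≤ u x ^ 2 + v x ^ 2 := by positivity
    nlinarith [mul_le_mul_of_nonneg_right (hf x hx) n0]
  have s2 : ∫ x in c..d, w x * (u x ^ 2 + v x ^ 2) ≤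
      ∫ x in (-π)..π, w x * (u x ^ 2 + v x ^ 2) := by
    refine integral_mono_interval hc hcd hd ?_ (H.iwn _ _)
    exact Filter.Eventually.of_forall fun x => mul_nonneg (H.w0 x) (by positivity)
  rw [intervalIntegral.integral_const_mul] at s1
  refine s1.trans ?_
  exact mul_le_mul_of_nonneg_left (s2.trans (H.est1 E ht)) (by positivity)

lemma supF {u v p s r z w : ℝ → ℝ} (H : WSys u v p s r z w) {E a b δ K t : ℝ} (hE : 0 ≤ E) (hδ : 0 < δ) (ht : 0 < t) (hK : 0 < K)
    (ha : 0 < a) (ha' : a ≤ π) (hab : a ≤ b) (hb : b ≤ π)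
    (hw : ∫ x in (-a)..b, w x ≤ K / δ) :
    ∃ S, (∀ x ∈ Set.Icc (-a) b, p x ^ 2 + s x ^ 2 + E * (u x ^ 2 + v x ^ 2) ≤ S) ∧
      ∀ y ∈ Set.Icc (-a) b, S ≤ 2 * (p y ^ 2 + s y ^ 2 + E * (u y ^ 2 + v y ^ 2)) +
        (16 * π * (∫ x in (-π)..π, gg u v r z w E x) + 8 * K / δ *
        ∫ x in (-π)..π, (t * (u x ^ 2 + v x ^ 2) + t⁻¹ * gg u v r z w E x) / 2) := by
  have h1 := H.cu
  have h2 := H.cv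
  have h3 := H.cr
  have h4 := H.cz
  have h5 := H.cp
  have h6 := H.cs
  have hpi := pi_pos
  set F : ℝ → ℝ := fun x => p x ^ 2 + s x ^ 2 + E * (u x ^ 2 + v x ^ 2) with hF
  have cF : Continuous F := by fun_prop
  have dF : ∀ x, HasDerivAt F (2 * (p x * r x + s x * z x + E * (u x * p x + v x * s x))) x := by
    intro x
    exact ((((H.hp x).pow 2).add ((H.hs x).pow 2)).add
      ((((H.hu x).pow 2).add ((H.hv x).pow 2)).const_mul E)).congr_deriv (by norm_num; ring)
  obtain ⟨x₀, hx₀, hmax⟩ := (isCompact_Icc (a := -a) (b := b)).exists_isMaxOn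
    ⟨a, by constructor <;> linarith⟩ cF.continuousOn
  have hm : ∀ x ∈ Set.Icc (-a) b, F x ≤ F x₀ := fun x hx => hmax hx
  refine ⟨F x₀, hm, fun y hy => ?_⟩
  set S := F x₀ with hS
  have S0 : 0 ≤ S := by simp only [hS, hF]; positivity
  set ε := (8 * π)⁻¹ with hε
  have ε0 : 0 < ε := by positivity
  set η := δ / (4 * K) with hη
  have η0 : 0 < η := by positivity
  set h : ℝ → ℝ := fun x => (ε * S + η * S * w x) + (ε⁻¹ * gg u v r z w E x +
    η⁻¹ * (w x * (u x ^ 2 + v x ^ 2))) with hh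
  have i1 : IntervalIntegrable (fun x => ε * S + η * S * w x) volume (-a) b :=
    (_root_.intervalIntegrable_const).add ((H.iw _ _).const_mul _)
  have i2 : IntervalIntegrable (fun x => ε⁻¹ * gg u v r z w E x +
    η⁻¹ * (w x * (u x ^ 2 + v x ^ 2))) volume (-a) b :=
    ((H.ig E _ _).const_mul _).add ((H.iwn _ _).const_mul _)
  have vb := var_bound (h := h) dF (by fun_prop) (i1.add i2) ?_ hx₀ hy
  · have e : ∫ x in (-a)..b, h x = ((b + a) * (ε * S) + η * S * ∫ x in (-a)..b, w x) +
      (ε⁻¹ * (∫ x in (-a)..b, gg u v r z w E x) +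
        η⁻¹ * ∫ x in (-a)..b, w x * (u x ^ 2 + v x ^ 2)) := by
      rw [integral_add i1 i2, integral_add (_root_.intervalIntegrable_const)
        ((H.iw _ _).const_mul _), integral_add ((H.ig E _ _).const_mul _) ((H.iwn _ _).const_mul _),
        intervalIntegral.integral_const_mul, intervalIntegral.integral_const_mul,
        intervalIntegral.integral_const_mul, intervalIntegral.integral_const_mul,
        intervalIntegral.integral_const, smul_eq_mul, sub_neg_eq_add]
      ring
    have m1 : ∫ x in (-a)..b, gg u v r z w E x ≤ ∫ x in (-π)..π, gg u v r z w E x := by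
      refine integral_mono_interval (by linarith) (by linarith) hb ?_ (H.ig E _ _)
      exact Filter.Eventually.of_forall fun x => by simp only [gg, Pi.zero_apply]; positivity
    have m2 : ∫ x in (-a)..b, w x * (u x ^ 2 + v x ^ 2) ≤
        ∫ x in (-π)..π, w x * (u x ^ 2 + v x ^ 2) := by
      refine integral_mono_interval (by linarith) (by linarith) hb ?_ (H.iwn _ _)
      exact Filter.Eventually.of_forall fun x => mul_nonneg (H.w0 x) (by positivity)
    have m2' := m2.trans (H.est1 E ht)
    have n1 : (b + a) * (ε * S) ≤ S / 4 := by
      have : (b + a) * (ε * S) ≤ (2 * π) * (ε * S) :=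
        mul_le_mul_of_nonneg_right (by linarith) (by positivity)
      have e : (2 * π) * (ε * S) = S / 4 := by rw [hε]; field_simp; ring
      linarith
    have n2 : η * S * (∫ x in (-a)..b, w x) ≤ S / 4 := by
      have := mul_le_mul_of_nonneg_left hw (by positivity : 0 ≤ η * S)
      have e : η * S * (K / δ) = S / 4 := by rw [hη]; field_simp
      linarith
    have n3 := mul_le_mul_of_nonneg_left m1 (by positivity : 0 ≤ ε⁻¹)
    have n4 := mul_le_mul_of_nonneg_left m2' (by positivity : 0 ≤ η⁻¹)
    rw [e] at vb
    set G := ∫ x in (-π)..π, gg u v r z w E x with hG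
    set A := ∫ x in (-π)..π, (t * (u x ^ 2 + v x ^ 2) + t⁻¹ * gg u v r z w E x) / 2 with hA
    have e1 : 16 * π * G = 2 * (ε⁻¹ * G) := by rw [hε, inv_inv]; ring
    have e2 : 8 * K / δ * A = 2 * (η⁻¹ * A) := by rw [hη, inv_div]; ring
    rw [e1, e2]
    have e3 : p y ^ 2 + s y ^ 2 + E * (u y ^ 2 + v y ^ 2) = F y := rfl
    rw [e3]
    linarith
  · intro x hx
    have a1 := amgm ε0 (p x) (s x) (-r x - w x * v x - E * u x) (-z x + w x * u x - E * v x)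
    have a2 := amgm ε0 (p x) (s x) (-(-r x - w x * v x - E * u x)) (-(-z x + w x * u x - E * v x))
    have b1 := mul_le_mul_of_nonneg_left (amgm η0 (p x) (s x) (-v x) (u x)) (H.w0 x)
    have b2 := mul_le_mul_of_nonneg_left (amgm η0 (p x) (s x) (v x) (-u x)) (H.w0 x)
    rw [neg_sq, neg_sq] at a2
    rw [neg_sq] at b1 b2
    have eS : p x ^ 2 + s x ^ 2 ≤ S := by
      have := hm x hx
      have h0 : 0 ≤ E * (u x ^ 2 + v x ^ 2) := by positivity
      simp only [hF] at this
      have e : S = F x₀ := rfl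
      simp only [hF] at e
      linarith
    have k1 := mul_le_mul_of_nonneg_left eS ε0.le
    have k2 := mul_le_mul_of_nonneg_left eS (mul_nonneg η0.le (H.w0 x))
    have eg : gg u v r z w E x = (-r x - w x * v x - E * u x) ^ 2 +
      (-z x + w x * u x - E * v x) ^ 2 := rfl
    simp only [hh]
    rw [← eg] at a1 a2
    rw [abs_le]
    constructor <;> linarith

set_option maxHeartbeats 2000000 in
lemma core {u v p s r z w : ℝ → ℝ} (H : WSys u v p s r z w) {E a δ K C₀ t : ℝ} (hδ : 0 < δ) (hδ1 : δ ≤ 1) (ht : 0 < t) (hK : 0 < K)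
    (hC : 0 < C₀) (ha : 0 < a) (hb : a + δ ≤ π)
    (hw : ∫ x in (-a)..(a + δ), w x ≤ K / δ)
    (hf : ∀ x, a ≤ |x| → |x| ≤ π → 1 ≤ C₀ * δ ^ 2 * w x) :
    ∫ x in (-π)..π, (u x ^ 2 + v x ^ 2) ≤
      (64 * π ^ 3 * (8 + 240 * C₀ + 8 * K) + 24 * π * C₀ + 2 * C₀ + 8 * π * C₀ + 32 * π ^ 2) / δ *
      (∫ x in (-π)..π, (t * (u x ^ 2 + v x ^ 2) + t⁻¹ * gg u v r z w E x) / 2) +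
      1024 * π ^ 4 * ∫ x in (-π)..π, gg u v r z w E x := by
  have hpi := pi_pos
  have hfR : ∫ x in a..(a + δ), (u x ^ 2 + v x ^ 2) ≤ _ :=
    H.far (E := E) ht hC (by linarith) (by linarith) hb (fun x hx => hf x
    (by rw [abs_of_nonneg (by linarith [hx.1])]; exact hx.1)
    (by rw [abs_of_nonneg (by linarith [hx.1])]; linarith [hx.2]))
  have hfR' : ∫ x in (a + δ)..π, (u x ^ 2 + v x ^ 2) ≤ _ :=
    H.far (E := E) ht hC (by linarith) hb le_rfl (fun x hx => hf x
    (by rw [abs_of_nonneg (by linarith [hx.1])]; linarith [hx.1])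
    (by rw [abs_of_nonneg (by linarith [hx.1])]; linarith [hx.2]))
  have hfL : ∫ x in (-π)..(-a), (u x ^ 2 + v x ^ 2) ≤ _ :=
    H.far (E := E) ht hC le_rfl (by linarith) (by linarith) (fun x hx => hf x
    (by rw [abs_of_nonpos (by linarith [hx.2])]; linarith [hx.2])
    (by rw [abs_of_nonpos (by linarith [hx.2])]; linarith [hx.1]))
  have hA2 := H.est2 E ht
  have A0 : 0 ≤ ∫ x in (-π)..π, (t * (u x ^ 2 + v x ^ 2) + t⁻¹ * gg u v r z w E x) / 2 :=
    integral_nonneg (by linarith) (fun x _ => by simp only [gg]; positivity)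
  have G0 : 0 ≤ ∫ x in (-π)..π, gg u v r z w E x :=
    integral_nonneg (by linarith) (fun x _ => by simp only [gg]; positivity)
  have N0 : 0 ≤ ∫ x in (-π)..π, (u x ^ 2 + v x ^ 2) :=
    integral_nonneg (by linarith) (fun x _ => by positivity)
  have hsplit : ∫ x in (-π)..π, (u x ^ 2 + v x ^ 2) = (∫ x in (-π)..(-a), (u x ^ 2 + v x ^ 2)) +
      (∫ x in (-a)..(a + δ), (u x ^ 2 + v x ^ 2)) + ∫ x in (a + δ)..π, (u x ^ 2 + v x ^ 2) := by
    rw [integral_add_adjacent_intervals (H.i_n _ _) (H.i_n _ _),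
      integral_add_adjacent_intervals (H.i_n _ _) (H.i_n _ _)]
  have hpoin := fun y hy => H.poincare (y := y) hy
  have hsup := fun hE : 0 ≤ E => H.supF hE hδ ht hK ha (by linarith : a ≤ π) (by linarith) hb hw
  have hcol := fun hE : 0 ≤ E => H.collar (a := a) hE hδ ht
  have hAsub : ∫ x in a..(a + δ), (t * (u x ^ 2 + v x ^ 2) + t⁻¹ * gg u v r z w E x) / 2 ≤
      ∫ x in (-π)..π, (t * (u x ^ 2 + v x ^ 2) + t⁻¹ * gg u v r z w E x) / 2 := by
    refine integral_mono_interval (by linarith) (by linarith) hb ?_ (H.iA E t _ _)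
    exact Filter.Eventually.of_forall fun x => by simp only [gg, Pi.zero_apply]; positivity
  set A := ∫ x in (-π)..π, (t * (u x ^ 2 + v x ^ 2) + t⁻¹ * gg u v r z w E x) / 2 with hA
  set G := ∫ x in (-π)..π, gg u v r z w E x with hG
  set N := ∫ x in (-π)..π, (u x ^ 2 + v x ^ 2) with hN
  have dd : ∀ k, 0 ≤ k → k * A ≤ k / δ * A := fun k hk => by
    refine mul_le_mul_of_nonneg_right ?_ A0
    rw [le_div_iff₀ hδ]; nlinarith
  have hδA : δ * A ≤ A := by nlinarith
  have hδA2 : δ ^ 2 * A ≤ A := by nlinarith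
  have cd := mul_le_mul_of_nonneg_left hδA hC.le
  have cd2 := mul_le_mul_of_nonneg_left hδA2 hC.le
  have C0A : 0 ≤ C₀ * A := by positivity
  rcases le_total E (1 / (32 * π ^ 2)) with hE | hE
  · have h1 : ∀ y ∈ Set.Icc a (a + δ), N - 32 * π ^ 2 * A ≤ 8 * π * (u y ^ 2 + v y ^ 2) := by
      intro y hy
      have := hpoin y ⟨by linarith [hy.1], by linarith [hy.2]⟩
      have h2 : E * N ≤ 1 / (32 * π ^ 2) * N := mul_le_mul_of_nonneg_right hE N0
      have h3 := mul_le_mul_of_nonneg_left (hA2.trans (add_le_add_left h2 A))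
        (by positivity : 0 ≤ 16 * π ^ 2)
      have e : 16 * π ^ 2 * (1 / (32 * π ^ 2) * N + A) = N / 2 + 16 * π ^ 2 * A := by
        field_simp; ring
      rw [e] at h3
      linarith
    have h2 := integral_mono_on (by linarith) (_root_.intervalIntegrable_const (μ := volume))
      ((H.i_n a (a + δ)).const_mul (8 * π)) h1
    rw [intervalIntegral.integral_const, smul_eq_mul, intervalIntegral.integral_const_mul,
      add_sub_cancel_left] at h2
    have h3 := h2.trans (mul_le_mul_of_nonneg_left hfR (by positivity : 0 ≤ 8 * π))
    have h4 : N - 32 * π ^ 2 * A ≤ 8 * π * (C₀ * δ * A) := by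
      refine le_of_mul_le_mul_left (h3.trans (le_of_eq ?_)) hδ
      ring
    have h5 : N ≤ (8 * π * C₀ + 32 * π ^ 2) * A := by
      have := mul_le_mul_of_nonneg_left cd (by positivity : 0 ≤ 8 * π)
      nlinarith
    have h6 := h5.trans (mul_le_mul_of_nonneg_right (show 8 * π * C₀ + 32 * π ^ 2 ≤
      64 * π ^ 3 * (8 + 240 * C₀ + 8 * K) + 24 * π * C₀ + 2 * C₀ + 8 * π * C₀ + 32 * π ^ 2 by
        have : 0 ≤ 64 * π ^ 3 * (8 + 240 * C₀ + 8 * K) + 24 * π * C₀ + 2 * C₀ := by positivity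
        linarith) A0)
    have h7 := h6.trans (dd _ (by positivity))
    have : 0 ≤ 1024 * π ^ 4 * G := by positivity
    linarith
  · have E0 : 0 < E := lt_of_lt_of_le (by positivity) hE
    obtain ⟨S, hS1, hS2⟩ := hsup E0.le
    have hc := hcol E0.le
    have S0 : 0 ≤ S := le_trans (by positivity) (hS1 a ⟨by linarith, by linarith⟩)
    have hu := H.cu
    have hv := H.cv
    have hp := H.cp
    have hs := H.cs
    have iφ : ∀ k : ℝ, ∫ x in a..(a + δ), k * (30 * ((x - a) * (a + δ - x) / δ ^ 2) ^ 2)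
        = k * δ := by
      intro k
      rw [intervalIntegral.integral_const_mul]
      congr 1
      have hd : ∀ x, HasDerivAt (fun x => 30 / δ ^ 4 * (δ ^ 2 * (x - a) ^ 3 / 3
          - 2 * δ * (x - a) ^ 4 / 4 + (x - a) ^ 5 / 5))
          (30 * ((x - a) * (a + δ - x) / δ ^ 2) ^ 2) x := by
        intro x
        have d1 := (hasDerivAt_id x).sub_const a
        refine ((((((d1.pow 3).const_mul (δ ^ 2)).div_const 3).sub
          (((d1.pow 4).const_mul (2 * δ)).div_const 4)).add
          ((d1.pow 5).div_const 5)).const_mul (30 / δ ^ 4)).congr_deriv ?_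
        simp
        field_simp
        ring
      rw [integral_eq_sub_of_hasDerivAt (fun x _ => hd x)
        (Continuous.intervalIntegrable (by fun_prop) _ _)]
      simp only [add_sub_cancel_left, sub_self]
      field_simp
      ring
    set R := 16 * π * G + 8 * K / δ * A with hR
    have av : ∫ x in a..(a + δ), (S - R) * (30 * ((x - a) * (a + δ - x) / δ ^ 2) ^ 2) ≤
        ∫ x in a..(a + δ), 2 * (30 * ((x - a) * (a + δ - x) / δ ^ 2) ^ 2 *
          (p x ^ 2 + s x ^ 2 + E * (u x ^ 2 + v x ^ 2))) := by
      refine integral_mono_on (by linarith) (Continuous.intervalIntegrable (by fun_prop) _ _)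
        (Continuous.intervalIntegrable (by fun_prop) _ _) ?_
      intro y hy
      have h0 : 0 ≤ 30 * ((y - a) * (a + δ - y) / δ ^ 2) ^ 2 := by positivity
      have := hS2 y ⟨by linarith [hy.1], by linarith [hy.2]⟩
      have := mul_le_mul_of_nonneg_right (sub_le_iff_le_add.2 this) h0
      linarith
    rw [iφ, intervalIntegral.integral_const_mul] at av
    have c1 : (6 * E + 120 / δ ^ 2) * ∫ x in a..(a + δ), (u x ^ 2 + v x ^ 2) ≤
        6 * E * (C₀ * δ ^ 2 * A) + 120 * (C₀ * A) := by
      have := mul_le_mul_of_nonneg_left hfR (by positivity : 0 ≤ 6 * E + 120 / δ ^ 2)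
      refine this.trans (le_of_eq ?_)
      field_simp
    have c2 : (S - R) * δ ≤ 2 * (4 * A + (6 * E * (C₀ * δ ^ 2 * A) + 120 * (C₀ * A))) := by
      linarith
    have c3 : S ≤ 16 * π * G + (8 + 240 * C₀ + 8 * K) / δ * A + 12 * E * (C₀ * δ * A) := by
      refine le_of_mul_le_mul_right ?_ hδ
      have e1 : R * δ = 16 * π * G * δ + 8 * K * A := by rw [hR]; field_simp
      have e2 : (16 * π * G + (8 + 240 * C₀ + 8 * K) / δ * A + 12 * E * (C₀ * δ * A)) * δ =
        16 * π * G * δ + (8 + 240 * C₀ + 8 * K) * A + 12 * E * (C₀ * δ ^ 2 * A) := by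
        field_simp
      rw [e2]
      nlinarith
    have mid : E * ∫ x in (-a)..(a + δ), (u x ^ 2 + v x ^ 2) ≤ 2 * π * S := by
      have := integral_mono_on (by linarith) ((H.i_n (-a) (a + δ)).const_mul E)
        (_root_.intervalIntegrable_const (μ := volume) (c := S)) (fun x hx => by
          have := hS1 x hx
          have h0 : 0 ≤ p x ^ 2 + s x ^ 2 := by positivity
          linarith)
      rw [intervalIntegral.integral_const, smul_eq_mul, intervalIntegral.integral_const_mul] at this
      refine this.trans (mul_le_mul_of_nonneg_right (by linarith) S0)
    set Q := 16 * π * G + (8 + 240 * C₀ + 8 * K) / δ * A with hQ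
    have Q0 : 0 ≤ Q := by positivity
    have QE : Q ≤ E * (32 * π ^ 2 * Q) := by
      have := mul_le_mul_of_nonneg_right hE (by positivity : 0 ≤ 32 * π ^ 2 * Q)
      refine le_trans (le_of_eq ?_) this
      field_simp
    have mid2 : ∫ x in (-a)..(a + δ), (u x ^ 2 + v x ^ 2) ≤
        2 * π * (32 * π ^ 2 * Q + 12 * (C₀ * δ * A)) := by
      refine le_of_mul_le_mul_left (mid.trans ?_) E0
      have := mul_le_mul_of_nonneg_left (c3.trans (add_le_add_left QE _))
        (by positivity : 0 ≤ 2 * π)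
      refine this.trans (le_of_eq ?_)
      ring
    have l1 := dd (24 * π * C₀) (by positivity)
    have l2 := dd (2 * C₀) (by positivity)
    have l3 : 0 ≤ (8 * π * C₀ + 32 * π ^ 2) / δ * A := by positivity
    have l4 := mul_le_mul_of_nonneg_left cd (by positivity : 0 ≤ 24 * π)
    have fin : N ≤ 64 * π ^ 3 * Q + 24 * π * C₀ / δ * A + 2 * C₀ / δ * A := by
      rw [hsplit]
      nlinarith
    refine fin.trans ?_
    rw [hQ]
    have e : (64 * π ^ 3 * (8 + 240 * C₀ + 8 * K) + 24 * π * C₀ + 2 * C₀ + 8 * π * C₀ +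
      32 * π ^ 2) / δ * A + 1024 * π ^ 4 * G = 64 * π ^ 3 * (16 * π * G +
        (8 + 240 * C₀ + 8 * K) / δ * A) + 24 * π * C₀ / δ * A + 2 * C₀ / δ * A +
        (8 * π * C₀ + 32 * π ^ 2) / δ * A := by
      ring
    rw [e]
    linarith

end WSys

lemma absorb {N G δ K1 K2 : ℝ} (hδ : 0 < δ) (hδ1 : δ ≤ 1) (h1 : 0 < K1) (h2 : 0 ≤ K2) (hG : 0 ≤ G)
    (h : N ≤ K1 / δ * ((δ / K1 * N + (δ / K1)⁻¹ * G) / 2) + K2 * G) :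
    N ≤ (K1 ^ 2 + 2 * K2) * (δ⁻¹) ^ 2 * G := by
  have e : K1 / δ * ((δ / K1 * N + (δ / K1)⁻¹ * G) / 2) = N / 2 + K1 ^ 2 * (δ⁻¹) ^ 2 * G / 2 := by
    field_simp
  rw [e] at h
  have h3 : 1 ≤ (δ⁻¹) ^ 2 := one_le_pow₀ (one_le_inv_iff₀.2 ⟨hδ, hδ1⟩)
  have : K2 * G ≤ K2 * G * (δ⁻¹) ^ 2 := le_mul_of_one_le_right (by positivity) h3
  linarith

lemma wsys_of {u : ℝ → ℂ} {w : ℝ → ℝ} (hu : ContDiff ℝ 2 u) (hper : Function.Periodic u (2 * π))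
    (wm : Measurable w) (w0 : ∀ x, 0 ≤ w x) (wM : ∃ M, ∀ x, w x ≤ M) :
    WSys (fun x => (u x).re) (fun x => (u x).im) (fun x => (deriv u x).re)
      (fun x => (deriv u x).im) (fun x => (deriv (deriv u) x).re)
      (fun x => (deriv (deriv u) x).im) w := by
  have hu2 : ContDiff ℝ (1 + 1) u := by simpa [one_add_one_eq_two] using hu
  have hd1 : Differentiable ℝ u := hu.differentiable (by norm_num)
  have hu' : ContDiff ℝ 1 (deriv u) := (contDiff_succ_iff_deriv.1 hu2).2.2
  have hd2 : Differentiable ℝ (deriv u) := hu'.differentiable (by norm_num)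
  have hc : Continuous (deriv (deriv u)) := hu'.continuous_deriv le_rfl
  have b0 : u (-π) = u π := by
    have := hper (-π)
    rw [← this]; congr 1; ring
  have b1 : deriv u (-π) = deriv u π := by
    have h : (fun x => u (x + 2 * π)) = u := funext hper
    have := deriv_comp_add_const u (2 * π) (-π)
    rw [h] at this
    rw [this]; congr 1; ring
  exact {
    hu := fun x => Complex.reCLM.hasFDerivAt.comp_hasDerivAt x (hd1 x).hasDerivAt
    hv := fun x => Complex.imCLM.hasFDerivAt.comp_hasDerivAt x (hd1 x).hasDerivAt
    hp := fun x => Complex.reCLM.hasFDerivAt.comp_hasDerivAt x (hd2 x).hasDerivAt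
    hs := fun x => Complex.imCLM.hasFDerivAt.comp_hasDerivAt x (hd2 x).hasDerivAt
    cr := Complex.continuous_re.comp hc
    cz := Complex.continuous_im.comp hc
    wm := wm
    w0 := w0
    wM := wM
    bu := by simp only [b0]
    bv := by simp only [b0]
    bp := by simp only [b1]
    bs := by simp only [b1] }

lemma int_le {w : ℝ → ℝ} {c d M : ℝ} (hcd : c ≤ d) (hi : ∀ c d, IntervalIntegrable w volume c d)
    (h : ∀ x ∈ Set.Icc c d, w x ≤ M) : ∫ x in c..d, w x ≤ (d - c) * M := by
  have := integral_mono_on hcd (hi c d) (_root_.intervalIntegrable_const (μ := volume) (c := M)) h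
  rwa [intervalIntegral.integral_const, smul_eq_mul] at this

/-- The main stationary resolvent estimate: there are `C, q₀ > 0` depending only on
`C₀, σ, β` such that for `q ≥ q₀`, `E ≤ q²`, and `u, f` with `f = -u'' + iqWu - Eu`,
one has `∫ |u|² ≤ C q^{2/(β+2)} ∫ |f|²`. -/
theorem damped_wave_stationary_estimate
    (C₀ σ β : ℝ) (hC₀ : 0 < C₀) (hσ : σ ∈ Set.Ioo 0 π) (hβ : 0 ≤ β) :
    ∃ C > (0 : ℝ), ∃ q₀ > (0 : ℝ),
      ∀ (W : ℝ → ℝ), Function.Periodic W (2 * π) → Measurable W →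
        (∃ M : ℝ, ∀ x : ℝ, W x ≤ M) → (∀ x : ℝ, 0 ≤ W x) →
        (∀ x ∈ Set.Icc (-π) π,
          dampV σ β x / C₀ ≤ W x ∧ W x ≤ C₀ * dampV σ β x) →
        ∀ q ≥ q₀, ∀ E : ℝ, E ≤ q ^ 2 →
          ∀ (u f : ℝ → ℂ), ContDiff ℝ 2 u → Function.Periodic u (2 * π) →
            (∀ x : ℝ,
              f x = -(deriv (deriv u) x) + Complex.I * q * W x * u x - E * u x) →
            ∫ x in (-π)..π, ‖u x‖ ^ 2 ≤
              C * q ^ ((2 : ℝ) / (β + 2)) * ∫ x in (-π)..π, ‖f x‖ ^ 2 := by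
  obtain ⟨hσ0, hσπ⟩ := hσ
  have hpi := pi_pos
  have hβ2 : 0 < β + 2 := by linarith
  set K : ℝ := 3 * C₀ * 2 ^ β with hK
  have K0 : 0 < K := by positivity
  set K1 : ℝ := 64 * π ^ 3 * (8 + 240 * C₀ + 8 * K) + 24 * π * C₀ + 2 * C₀ + 8 * π * C₀ +
    32 * π ^ 2 with hK1
  have K10 : 0 < K1 := by positivity
  refine ⟨K1 ^ 2 + 2 * (1024 * π ^ 4), by positivity, max 1 ((2 / (π - σ)) ^ (β + 2)),
    lt_of_lt_of_le one_pos (le_max_left _ _), ?_⟩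
  intro W hWp hWm hWM hW0 hWV q hq E _ u f hu hper hf
  have q1 : 1 ≤ q := (le_max_left _ _).trans hq
  have q2 : (2 / (π - σ)) ^ (β + 2) ≤ q := (le_max_right _ _).trans hq
  have q0 : 0 < q := by linarith
  set D : ℝ := q ^ (1 / (β + 2)) with hD
  have D0 : 0 < D := by positivity
  have D1 : 1 ≤ D := Real.one_le_rpow q1 (by positivity)
  have hπσ : 0 < π - σ := by linarith
  have D2 : 2 / (π - σ) ≤ D := by
    have := Real.rpow_le_rpow (by positivity) q2 (by positivity : 0 ≤ 1 / (β + 2))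
    rwa [← Real.rpow_mul (by positivity), mul_one_div_cancel hβ2.ne', Real.rpow_one] at this
  have hqD : q ^ ((2 : ℝ) / (β + 2)) = D ^ 2 := by
    rw [hD, ← Real.rpow_natCast, ← Real.rpow_mul q0.le]
    congr 1; push_cast; ring
  have hDq : q = D ^ β * D ^ 2 := by
    rw [← Real.rpow_natCast D 2, ← Real.rpow_add D0, hD, ← Real.rpow_mul q0.le]
    push_cast
    rw [one_div_mul_cancel hβ2.ne', Real.rpow_one]
  set δ : ℝ := D⁻¹ with hδ
  have δ0 : 0 < δ := by positivity
  have δ1 : δ ≤ 1 := inv_le_one_of_one_le₀ D1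
  have δ2 : 2 * δ ≤ π - σ := by
    rw [div_le_iff₀ hπσ] at D2
    rw [hδ, ← div_eq_mul_inv, div_le_iff₀ D0]; linarith
  have hδβ : q * δ ^ β = D ^ 2 := by
    rw [hδ, Real.inv_rpow D0.le, hDq]
    have : 0 < D ^ β := by positivity
    field_simp
  have hδD : δ * D = 1 := inv_mul_cancel₀ D0.ne'
  set w : ℝ → ℝ := fun x => q * W x with hw
  have H := wsys_of (w := w) hu hper (hWm.const_mul q) (fun x => mul_nonneg q0.le (hW0 x))
    (by obtain ⟨M, hM⟩ := hWM
        exact ⟨q * M, fun x => mul_le_mul_of_nonneg_left (hM x) q0.le⟩)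
  have hnear : ∀ x, |x| ≤ σ + 2 * δ → w x ≤ C₀ * 2 ^ β * D ^ 2 := by
    intro x hx
    have hV : dampV σ β x ≤ (2 * δ) ^ β := by
      unfold dampV
      split_ifs with h
      · positivity
      · exact Real.rpow_le_rpow (by linarith) (by linarith) hβ
    have hx' : x ∈ Set.Icc (-π) π := abs_le.1 (by linarith)
    have := (hWV x hx').2.trans (mul_le_mul_of_nonneg_left hV hC₀.le)
    have := mul_le_mul_of_nonneg_left this q0.le
    refine this.trans (le_of_eq ?_)
    rw [Real.mul_rpow (by norm_num) δ0.le, ← hδβ]; ring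
  have hzero : ∀ x, |x| ≤ σ → w x ≤ 0 := by
    intro x hx
    have hx' : x ∈ Set.Icc (-π) π := abs_le.1 (by linarith)
    have := (hWV x hx').2
    simp only [dampV, if_pos hx, mul_zero] at this
    simp only [hw]
    nlinarith
  have hint : ∫ x in (-(σ + δ))..(σ + δ + δ), w x ≤ K / δ := by
    have i1 : ∫ x in (-(σ + δ))..(-σ), w x ≤ (-σ - -(σ + δ)) * (C₀ * 2 ^ β * D ^ 2) :=
      int_le (by linarith) H.iw (fun x hx => hnear x (by
        rw [abs_of_nonpos (by linarith [hx.2])]; linarith [hx.1]))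
    have i2 : ∫ x in (-σ)..σ, w x ≤ (σ - -σ) * 0 :=
      int_le (by linarith) H.iw (fun x hx => hzero x (abs_le.2 hx))
    have i3 : ∫ x in σ..(σ + δ + δ), w x ≤ (σ + δ + δ - σ) * (C₀ * 2 ^ β * D ^ 2) :=
      int_le (by linarith) H.iw (fun x hx => hnear x (by
        rw [abs_of_nonneg (by linarith [hx.1])]; linarith [hx.2]))
    rw [← integral_add_adjacent_intervals (H.iw _ (-σ)) (H.iw _ _),
      ← integral_add_adjacent_intervals (H.iw (-σ) σ) (H.iw _ _)]
    have e : K / δ = 3 * δ * (C₀ * 2 ^ β * D ^ 2) := by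
      rw [hK, div_eq_iff δ0.ne']
      calc 3 * C₀ * 2 ^ β = 3 * C₀ * 2 ^ β * (δ * D) ^ 2 := by rw [hδD]; ring
        _ = _ := by ring
    rw [e]
    linarith
  have hfar : ∀ x, σ + δ ≤ |x| → |x| ≤ π → 1 ≤ C₀ * δ ^ 2 * w x := by
    intro x h1 h2
    have := (hWV x (abs_le.1 h2)).1
    rw [div_le_iff₀ hC₀] at this
    have hV : δ ^ β ≤ dampV σ β x := by
      unfold dampV
      rw [if_neg (by linarith)]
      exact Real.rpow_le_rpow δ0.le (by linarith) hβ
    have h3 := mul_le_mul_of_nonneg_left (hV.trans this) (by positivity : 0 ≤ δ ^ 2 * q)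
    have e : δ ^ 2 * q * δ ^ β = 1 := by
      rw [mul_assoc, hδβ, ← mul_pow, hδD, one_pow]
    rw [e] at h3
    simp only [hw]
    linarith
  have hcore := H.core (E := E) (t := δ / K1) (a := σ + δ) δ0 δ1 (by positivity) K0 hC₀
    (by linarith) (by linarith) hint hfar
  rw [H.A_eq] at hcore
  have hG : ∀ x, ‖f x‖ ^ 2 = gg (fun x => (u x).re) (fun x => (u x).im)
      (fun x => (deriv (deriv u) x).re) (fun x => (deriv (deriv u) x).im) w E x := by
    intro x
    rw [Complex.sq_norm, Complex.normSq_apply, hf x]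
    simp [gg, hw]
    ring
  have hN : ∀ x, ‖u x‖ ^ 2 = (u x).re ^ 2 + (u x).im ^ 2 := by
    intro x
    rw [Complex.sq_norm, Complex.normSq_apply]; ring
  simp only [hG, hN]
  rw [hqD]
  have G0 : 0 ≤ ∫ x in (-π)..π, gg (fun x => (u x).re) (fun x => (u x).im)
      (fun x => (deriv (deriv u) x).re) (fun x => (deriv (deriv u) x).im) w E x :=
    integral_nonneg (by linarith) (fun x _ => by simp only [gg]; positivity)
  have := absorb δ0 δ1 K10 (by positivity) G0 hcore
  rwa [hδ, inv_inv] at this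
end

section
/- There exist constants E₀ > 0, C > 0, and q₀ > 0, depending only on C₀, σ, and β, such that for all q ≥ q₀, all real E with E₀ ≤ E ≤ q², and all u, f as in the context (i.e. u is 2π-periodic, twice continuously differentiable, and f = −u'' + i·q·W·u − E·u), one has ∫_{−π}^{π} |u|² ≤ C · E⁻¹ · q^{2/(β+2)} · ∫_{−π}^{π} |f|². -/
open Real MeasureTheory intervalIntegral

namespace DW

/-- measurable and dominated by a continuous function implies interval integrable. -/
lemma ii_of_le {g B : ℝ → ℝ} (hg : Measurable g) (hB : Continuous B)
    (h : ∀ x, |g x| ≤ B x) (a b : ℝ) : IntervalIntegrable g volume a b := by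
  refine IntervalIntegrable.mono_fun' (hB.intervalIntegrable a b) hg.aestronglyMeasurable ?_
  exact Filter.Eventually.of_forall (fun x => by simpa using h x)

/-- The data of the equation. -/
structure Data (u v w f : ℝ → ℂ) (W : ℝ → ℝ) (q E : ℝ) : Prop where
  hu : ∀ x, HasDerivAt u (v x) x
  hv : ∀ x, HasDerivAt v (w x) x
  hw : Continuous w
  hWm : Measurable W
  hWb : ∃ M : ℝ, ∀ x : ℝ, W x ≤ M
  hW0 : ∀ x, 0 ≤ W x
  hq : 0 < q
  hE : 0 < E
  hf : ∀ x, f x = -(w x) + Complex.I * q * W x * u x - E * u x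
  pu : u (-π) = u π
  pv : v (-π) = v π

variable {u v w f : ℝ → ℂ} {W : ℝ → ℝ} {q E : ℝ}

namespace Data

lemma cu (h : Data u v w f W q E) : Continuous u :=
  continuous_iff_continuousAt.2 fun x => (h.hu x).continuousAt

lemma cv (h : Data u v w f W q E) : Continuous v :=
  continuous_iff_continuousAt.2 fun x => (h.hv x).continuousAt

lemma mf (h : Data u v w f W q E) : Measurable f := by
  have : f = fun x => -(w x) + Complex.I * q * W x * u x - E * u x := funext h.hf
  rw [this]
  have h1 := h.hw.measurable
  have h2 := h.cu.measurable
  have h3 := Complex.measurable_ofReal.comp h.hWm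
  exact ((h1.neg.add ((measurable_const.mul h3).mul h2))).sub (measurable_const.mul h2)

lemma bf (h : Data u v w f W q E) : ∃ B : ℝ → ℝ, Continuous B ∧ ∀ x, ‖f x‖ ≤ B x := by
  obtain ⟨M, hM⟩ := h.hWb
  refine ⟨fun x => ‖w x‖ + q * M * ‖u x‖ + E * ‖u x‖, ?_, fun x => ?_⟩
  · have := h.hw; have := h.cu; fun_prop
  · rw [h.hf x]
    refine (norm_sub_le _ _).trans ?_
    refine add_le_add ((norm_add_le _ _).trans ?_) ?_
    · rw [norm_neg]
      refine add_le_add le_rfl ?_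
      simp only [norm_mul, Complex.norm_I, Complex.norm_real, one_mul, Real.norm_eq_abs]
      rw [abs_of_pos h.hq, abs_of_nonneg (h.hW0 x)]
      have := hM x
      have := h.hq
      gcongr
    · simp [abs_of_pos h.hE]

lemma iiff (h : Data u v w f W q E) (a b : ℝ) :
    IntervalIntegrable (fun x => ‖f x‖ ^ 2) volume a b := by
  obtain ⟨B, hB, hfB⟩ := h.bf
  refine ii_of_le (B := fun x => (B x) ^ 2) (h.mf.norm.pow_const 2) (hB.pow 2) (fun x => ?_) a b
  rw [abs_of_nonneg (by positivity)]
  have := hfB x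
  gcongr

lemma iifg (h : Data u v w f W q E) {g : ℝ → ℝ} (hg : Continuous g) (a b : ℝ) :
    IntervalIntegrable (fun x => ‖f x‖ * g x) volume a b := by
  obtain ⟨B, hB, hfB⟩ := h.bf
  refine ii_of_le (B := fun x => (B x) * |g x|) (h.mf.norm.mul hg.measurable) (hB.mul hg.abs)
    (fun x => ?_) a b
  change |‖f x‖ * g x| ≤ _
  rw [abs_mul, abs_norm]
  have := hfB x
  gcongr

lemma iiWg (h : Data u v w f W q E) {g : ℝ → ℝ} (hg : Continuous g) (a b : ℝ) :
    IntervalIntegrable (fun x => q * W x * g x) volume a b := by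
  obtain ⟨M, hM⟩ := h.hWb
  refine ii_of_le (B := fun x => q * M * |g x|) ((measurable_const.mul h.hWm).mul hg.measurable)
    (by fun_prop) (fun x => ?_) a b
  change |q * W x * g x| ≤ _
  rw [abs_mul, abs_of_nonneg (mul_nonneg h.hq.le (h.hW0 x))]
  have := hM x
  have := h.hq
  gcongr

lemma cnu (h : Data u v w f W q E) : Continuous (fun x => ‖u x‖) := h.cu.norm
lemma cnv (h : Data u v w f W q E) : Continuous (fun x => ‖v x‖) := h.cv.norm

lemma hre {u : ℝ → ℂ} {d : ℂ} {x : ℝ} (h : HasDerivAt u d x) :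
    HasDerivAt (fun x => (u x).re) d.re x :=
  (Complex.reCLM.hasFDerivAt (x := u x)).comp_hasDerivAt x h
lemma him {u : ℝ → ℂ} {d : ℂ} {x : ℝ} (h : HasDerivAt u d x) :
    HasDerivAt (fun x => (u x).im) d.im x :=
  (Complex.imCLM.hasFDerivAt (x := u x)).comp_hasDerivAt x h

lemma nsq (z : ℂ) : ‖z‖ ^ 2 = z.re ^ 2 + z.im ^ 2 := by
  rw [Complex.sq_norm, Complex.normSq_apply]; ring

lemma cs (z y : ℂ) : |z.re * y.re + z.im * y.im| ≤ ‖z‖ * ‖y‖ := by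
  apply abs_le_of_sq_le_sq _ (by positivity)
  rw [mul_pow, nsq, nsq]; nlinarith [sq_nonneg (z.re * y.im - z.im * y.re)]
lemma cs' (z y : ℂ) : |z.im * y.re - z.re * y.im| ≤ ‖z‖ * ‖y‖ := by
  apply abs_le_of_sq_le_sq _ (by positivity)
  rw [mul_pow, nsq, nsq]; nlinarith [sq_nonneg (z.re * y.re + z.im * y.im)]

lemma fre (h : Data u v w f W q E) (x : ℝ) :
    (f x).re = -(w x).re - q * W x * (u x).im - E * (u x).re := by
  rw [h.hf x]; simp; ring
lemma fim (h : Data u v w f W q E) (x : ℝ) :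
    (f x).im = -(w x).im + q * W x * (u x).re - E * (u x).im := by
  rw [h.hf x]; simp

lemma dre (h : Data u v w f W q E) (x : ℝ) :
    HasDerivAt (fun x => (v x).re * (u x).re + (v x).im * (u x).im)
      ((w x).re * (u x).re + (w x).im * (u x).im + ‖v x‖ ^ 2) x := by
  refine (((hre (h.hv x)).mul (hre (h.hu x))).add
    ((him (h.hv x)).mul (him (h.hu x)))).congr_deriv ?_
  rw [nsq]; ring

lemma dim (h : Data u v w f W q E) (x : ℝ) :
    HasDerivAt (fun x => (v x).im * (u x).re - (v x).re * (u x).im)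
      ((w x).im * (u x).re - (w x).re * (u x).im) x := by
  refine (((him (h.hv x)).mul (hre (h.hu x))).sub
    ((hre (h.hv x)).mul (him (h.hu x)))).congr_deriv ?_
  ring

lemma dF (h : Data u v w f W q E) (x : ℝ) :
    HasDerivAt (fun x => ‖v x‖ ^ 2 + E * ‖u x‖ ^ 2)
      (2 * ((w x).re * (v x).re + (w x).im * (v x).im
        + E * ((u x).re * (v x).re + (u x).im * (v x).im))) x := by
  simp only [nsq]
  refine ((((hre (h.hv x)).pow 2).add ((him (h.hv x)).pow 2)).add
    ((((hre (h.hu x)).pow 2).add ((him (h.hu x)).pow 2)).const_mul E)).congr_deriv ?_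
  simp; ring

lemma mono {g k : ℝ → ℝ} {a b : ℝ} (hab : a ≤ b) (hg : IntervalIntegrable g volume a b)
    (hk : IntervalIntegrable k volume a b) (h : ∀ x ∈ Set.Icc a b, g x ≤ k x) :
    ∫ x in a..b, g x ≤ ∫ x in a..b, k x := integral_mono_on hab hg hk h

lemma pipi : -π ≤ π := by linarith [Real.pi_pos]

/-- imaginary part identity -/
lemma est_im (h : Data u v w f W q E) :
    ∫ x in (-π)..π, q * W x * ‖u x‖ ^ 2 ≤ ∫ x in (-π)..π, ‖f x‖ * ‖u x‖ := by
  have hu := h.cu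
  have hv := h.cv
  have hw := h.hw
  have cH : Continuous (fun x => (w x).im * (u x).re - (w x).re * (u x).im) := by fun_prop
  have h0 := integral_eq_sub_of_hasDerivAt (a := -π) (b := π) (fun x _ => h.dim x)
    (cH.intervalIntegrable _ _)
  rw [h.pu, h.pv, sub_self] at h0
  have h1 : ∫ x in (-π)..π, q * W x * ‖u x‖ ^ 2 ≤
      ∫ x in (-π)..π, (‖f x‖ * ‖u x‖ + ((w x).im * (u x).re - (w x).re * (u x).im)) := by
    refine mono pipi (h.iiWg (by fun_prop) _ _)
      ((h.iifg h.cnu _ _).add (cH.intervalIntegrable _ _)) (fun x _ => ?_)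
    have := (abs_le.1 (cs' (f x) (u x))).2
    rw [h.fre, h.fim] at this
    rw [nsq]
    linarith
  rwa [integral_add (h.iifg h.cnu _ _) (cH.intervalIntegrable _ _), h0, add_zero] at h1

lemma est_re (h : Data u v w f W q E) :
    ∫ x in (-π)..π, ‖v x‖ ^ 2 ≤
      E * (∫ x in (-π)..π, ‖u x‖ ^ 2) + ∫ x in (-π)..π, ‖f x‖ * ‖u x‖ := by
  have hu := h.cu
  have hv := h.cv
  have hw := h.hw
  have cH : Continuous (fun x => (w x).re * (u x).re + (w x).im * (u x).im + ‖v x‖ ^ 2) := by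
    fun_prop
  have h0 := integral_eq_sub_of_hasDerivAt (a := -π) (b := π) (fun x _ => h.dre x)
    (cH.intervalIntegrable _ _)
  rw [h.pu, h.pv, sub_self] at h0
  have i1 : IntervalIntegrable (fun x => E * ‖u x‖ ^ 2) volume (-π) π :=
    Continuous.intervalIntegrable (by fun_prop) _ _
  have h1 : ∫ x in (-π)..π, ‖v x‖ ^ 2 ≤
      ∫ x in (-π)..π, ((E * ‖u x‖ ^ 2 + ‖f x‖ * ‖u x‖) +
        ((w x).re * (u x).re + (w x).im * (u x).im + ‖v x‖ ^ 2)) := by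
    refine mono pipi (Continuous.intervalIntegrable (by fun_prop) _ _)
      ((i1.add (h.iifg h.cnu _ _)).add (cH.intervalIntegrable _ _)) (fun x _ => ?_)
    have := (abs_le.1 (cs (f x) (u x))).2
    rw [h.fre, h.fim] at this
    rw [nsq (u x)]
    linarith
  rwa [integral_add (i1.add (h.iifg h.cnu _ _)) (cH.intervalIntegrable _ _), h0, add_zero,
    integral_add i1 (h.iifg h.cnu _ _), intervalIntegral.integral_const_mul] at h1

lemma sub_le {g : ℝ → ℝ} (hg : ∀ a b, IntervalIntegrable g volume a b) (h0 : ∀ x, 0 ≤ g x)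
    {a b : ℝ} (ha : -π ≤ a) (hab : a ≤ b) (hb : b ≤ π) :
    ∫ x in a..b, g x ≤ ∫ x in (-π)..π, g x :=
  integral_mono_interval ha hab hb (Filter.Eventually.of_forall h0) (hg _ _)

lemma poly_int (a b : ℝ) : ∫ x in a..b, ((x - a) * (b - x)) ^ 2 = (b - a) ^ 5 / 30 := by
  have : ∀ x ∈ Set.uIcc a b, HasDerivAt
      (fun x : ℝ => (b - a) ^ 2 * (x - a) ^ 3 / 3 - (b - a) * (x - a) ^ 4 / 2 + (x - a) ^ 5 / 5)
      (((x - a) * (b - x)) ^ 2) x := by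
    intro x _
    have h1 : HasDerivAt (fun x : ℝ => x - a) 1 x := (hasDerivAt_id x).sub_const a
    refine (((((h1.pow 3).const_mul ((b - a) ^ 2)).div_const 3).sub
      (((h1.pow 4).const_mul (b - a)).div_const 2)).add ((h1.pow 5).div_const 5)).congr_deriv ?_
    simp; ring
  rw [integral_eq_sub_of_hasDerivAt this (Continuous.intervalIntegrable (by fun_prop) _ _)]
  ring

set_option maxHeartbeats 1000000 in
/-- a good point in the damped region -/
lemma good_point (h : Data u v w f W q E) {a b w0 : ℝ} (ha : -π ≤ a) (hab : a < b) (hb : b ≤ π)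
    (hw0 : 0 < w0) (hW : ∀ x ∈ Set.Icc a b, w0 ≤ W x) :
    ∃ x0 ∈ Set.Icc a b, (‖v x0‖ ^ 2 + E * ‖u x0‖ ^ 2) * ((b - a) ^ 5 / 60) ≤
      ((2 * (b - a) ^ 2 + 3 / 2 * E * (b - a) ^ 4) / (q * w0) + (b - a) ^ 4) *
        ∫ x in (-π)..π, ‖f x‖ * ‖u x‖ := by
  have hu := h.cu
  have hv := h.cv
  have hw := h.hw
  have hq := h.hq
  have hE := h.hE
  have cF : Continuous (fun x => ‖v x‖ ^ 2 + E * ‖u x‖ ^ 2) := by fun_prop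
  obtain ⟨x0, hx0, hmin⟩ := isCompact_Icc.exists_isMinOn (Set.nonempty_Icc.2 hab.le)
    cF.continuousOn
  refine ⟨x0, hx0, ?_⟩
  set m := ‖v x0‖ ^ 2 + E * ‖u x0‖ ^ 2 with hm
  have hm' : ∀ x ∈ Set.Icc a b, m ≤ ‖v x‖ ^ 2 + E * ‖u x‖ ^ 2 := fun x hx => hmin hx
  let H' : ℝ → ℝ := fun x =>
    (2 * ((x - a) * (b - x)) * ((b - x) - (x - a))) * ((v x).re * (u x).re + (v x).im * (u x).im)
    + ((x - a) * (b - x)) ^ 2 * ((w x).re * (u x).re + (w x).im * (u x).im + ‖v x‖ ^ 2)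
  have cH : Continuous H' := by simp only [H']; fun_prop
  have dH : ∀ x ∈ Set.uIcc a b, HasDerivAt (fun x => ((x - a) * (b - x)) ^ 2 *
      ((v x).re * (u x).re + (v x).im * (u x).im)) (H' x) x := by
    intro x _
    have h1 : HasDerivAt (fun x : ℝ => x - a) 1 x := (hasDerivAt_id x).sub_const a
    have h2 : HasDerivAt (fun x : ℝ => b - x) (-1) x := (hasDerivAt_id x).const_sub b
    refine (((h1.mul h2).pow 2).mul (h.dre x)).congr_deriv ?_
    simp only [H', Pi.mul_apply, Pi.pow_apply]; ring
  have h0 := integral_eq_sub_of_hasDerivAt dH (cH.intervalIntegrable _ _)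
  have h0' : ∫ x in a..b, H' x = 0 := by rw [h0]; ring
  set k1 := (2 * (b - a) ^ 2 + 3 / 2 * E * (b - a) ^ 4) / (q * w0) with hk1
  have hba : 0 < b - a := by linarith
  have hk10 : 0 ≤ k1 := by positivity
  have iW := h.iiWg (g := fun x => ‖u x‖ ^ 2) (by fun_prop)
  have iF := h.iifg h.cnu
  have key : ∫ x in a..b, m / 2 * ((x - a) * (b - x)) ^ 2 ≤
      ∫ x in a..b, ((H' x + k1 * (q * W x * ‖u x‖ ^ 2)) + (b - a) ^ 4 * (‖f x‖ * ‖u x‖)) := by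
    refine mono hab.le (Continuous.intervalIntegrable (by fun_prop) _ _)
      (((cH.intervalIntegrable _ _).add ((iW _ _).const_mul _)).add ((iF _ _).const_mul _))
      (fun x hx => ?_)
    have e1 := hm' x hx
    have e2 := hW x hx
    have s1 : 0 ≤ x - a := by linarith [hx.1]
    have s2 : 0 ≤ b - x := by linarith [hx.2]
    have c1 := (abs_le.1 (cs (f x) (u x))).2
    have c2 := (abs_le.1 (cs (v x) (u x))).1
    have c3 := (abs_le.1 (cs (v x) (u x))).2
    rw [h.fre, h.fim] at c1
    have hk : k1 * (q * W x * ‖u x‖ ^ 2) ≥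
        (2 * (b - a) ^ 2 + 3 / 2 * E * (b - a) ^ 4) * ‖u x‖ ^ 2 := by
      have : k1 * (q * w0 * ‖u x‖ ^ 2) =
        (2 * (b - a) ^ 2 + 3 / 2 * E * (b - a) ^ 4) * ‖u x‖ ^ 2 := by
        rw [hk1]; field_simp
      rw [← this]
      gcongr
    have p0 : 0 ≤ (x - a) * (b - x) := by positivity
    have p1 : (x - a) * (b - x) ≤ (b - a) ^ 2 := by nlinarith
    have p2 : ((x - a) * (b - x)) ^ 2 ≤ (b - a) ^ 4 := by nlinarith
    have p3 : ((b - x) - (x - a)) ^ 2 ≤ (b - a) ^ 2 := by nlinarith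
    set P := (x - a) * (b - x)
    set Q := (b - x) - (x - a)
    have hH : H' x = 2 * P * Q * ((v x).re * (u x).re + (v x).im * (u x).im)
      + P ^ 2 * ((w x).re * (u x).re + (w x).im * (u x).im + ‖v x‖ ^ 2) := rfl
    rw [hH]
    set R := (v x).re * (u x).re + (v x).im * (u x).im
    have hR : R ^ 2 ≤ ‖v x‖ ^ 2 * ‖u x‖ ^ 2 := by
      rw [← mul_pow]; exact sq_le_sq' (by linarith) c3
    have d1 : 2 * P * Q * R ≥ - (P ^ 2 * ‖v x‖ ^ 2 / 2 + 2 * Q ^ 2 * ‖u x‖ ^ 2) := by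
      have : |2 * P * Q * R| ≤ P ^ 2 * ‖v x‖ ^ 2 / 2 + 2 * Q ^ 2 * ‖u x‖ ^ 2 := by
        apply abs_le_of_sq_le_sq _ (by positivity)
        have : (2 * P * Q * R) ^ 2 ≤ 4 * P ^ 2 * Q ^ 2 * (‖v x‖ ^ 2 * ‖u x‖ ^ 2) := by
          have := mul_le_mul_of_nonneg_left hR (by positivity : 0 ≤ 4 * P ^ 2 * Q ^ 2)
          linarith
        nlinarith [sq_nonneg (P ^ 2 * ‖v x‖ ^ 2 / 2 - 2 * Q ^ 2 * ‖u x‖ ^ 2)]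
      exact (abs_le.1 this).1
    have d2 : P ^ 2 * ((w x).re * (u x).re + (w x).im * (u x).im) ≥
        - P ^ 2 * (‖f x‖ * ‖u x‖) - P ^ 2 * (E * ‖u x‖ ^ 2) := by
      have : (w x).re * (u x).re + (w x).im * (u x).im ≥ - (‖f x‖ * ‖u x‖) - E * ‖u x‖ ^ 2 := by
        rw [nsq (u x)]
        linarith
      have := mul_le_mul_of_nonneg_left this (sq_nonneg P)
      linarith
    have d3 : m / 2 * P ^ 2 ≤ P ^ 2 * ‖v x‖ ^ 2 / 2 + P ^ 2 * (E * ‖u x‖ ^ 2) / 2 := by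
      have := mul_le_mul_of_nonneg_left e1 (sq_nonneg P)
      linarith
    have d4 : P ^ 2 * (‖f x‖ * ‖u x‖) ≤ (b - a) ^ 4 * (‖f x‖ * ‖u x‖) := by gcongr
    have d5 : P ^ 2 * (E * ‖u x‖ ^ 2) ≤ (b - a) ^ 4 * (E * ‖u x‖ ^ 2) := by gcongr
    have d6 : 2 * Q ^ 2 * ‖u x‖ ^ 2 ≤ 2 * (b - a) ^ 2 * ‖u x‖ ^ 2 := by gcongr
    linarith
  rw [integral_add ((cH.intervalIntegrable _ _).add ((iW _ _).const_mul _)) ((iF _ _).const_mul _),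
    integral_add (cH.intervalIntegrable _ _) ((iW _ _).const_mul _), h0', zero_add,
    intervalIntegral.integral_const_mul, intervalIntegral.integral_const_mul,
    intervalIntegral.integral_const_mul, poly_int] at key
  have g1 : ∫ x in a..b, q * W x * ‖u x‖ ^ 2 ≤ ∫ x in (-π)..π, ‖f x‖ * ‖u x‖ :=
    (sub_le iW (fun x => mul_nonneg (mul_nonneg hq.le (h.hW0 x)) (by positivity))
      ha hab.le hb).trans h.est_im
  have g2 : ∫ x in a..b, ‖f x‖ * ‖u x‖ ≤ ∫ x in (-π)..π, ‖f x‖ * ‖u x‖ :=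
    sub_le iF (fun x => by positivity) ha hab.le hb
  have g3 := mul_le_mul_of_nonneg_left g1 hk10
  have g4 := mul_le_mul_of_nonneg_left g2 (by positivity : 0 ≤ (b - a) ^ 4)
  linarith

/-- propagation -/
lemma propagate (h : Data u v w f W q E) {b G x0 : ℝ} (hb0 : 0 < b) (hb : b ≤ π) (hG : 0 < G)
    (hWG : ∫ x in (-b)..b, q * W x ≤ G) (hx0 : x0 ∈ Set.Icc (-b) b) :
    ∀ x ∈ Set.Icc (-b) b, ‖v x‖ ^ 2 + E * ‖u x‖ ^ 2 ≤
      2 * (‖v x0‖ ^ 2 + E * ‖u x0‖ ^ 2) + 4 * (∫ x in (-π)..π, ‖f x‖ * ‖v x‖)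
        + 4 * G * ∫ x in (-π)..π, ‖f x‖ * ‖u x‖ := by
  have hu := h.cu
  have hv := h.cv
  have hw := h.hw
  have hq := h.hq
  have hE := h.hE
  have cF : Continuous (fun x => ‖v x‖ ^ 2 + E * ‖u x‖ ^ 2) := by fun_prop
  have hbb : -b ≤ b := by linarith
  obtain ⟨x1, hx1, hmax⟩ := isCompact_Icc.exists_isMaxOn (Set.nonempty_Icc.2 hbb)
    cF.continuousOn
  set m := ‖v x1‖ ^ 2 + E * ‖u x1‖ ^ 2 with hm
  have hm' : ∀ x ∈ Set.Icc (-b) b, ‖v x‖ ^ 2 + E * ‖u x‖ ^ 2 ≤ m := fun x hx => hmax hx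
  intro x hx
  refine (hm' x hx).trans ?_
  let F' : ℝ → ℝ := fun x => 2 * ((w x).re * (v x).re + (w x).im * (v x).im
        + E * ((u x).re * (v x).re + (u x).im * (v x).im))
  have cF' : Continuous F' := by simp only [F']; fun_prop
  have h0 := integral_eq_sub_of_hasDerivAt (a := x0) (b := x1) (fun x _ => h.dF x)
    (cF'.intervalIntegrable _ _)
  have iW := h.iiWg (g := fun x => ‖u x‖ ^ 2) (by fun_prop)
  have iW1 : ∀ a b, IntervalIntegrable (fun x => q * W x) volume a b := fun a b => by
    simpa using h.iiWg (g := fun _ => 1) continuous_const a b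
  have iF := h.iifg h.cnv
  have h1 : |∫ x in x0..x1, F' x| ≤ ∫ x in (-b)..b, |F' x| := by
    refine (norm_integral_le_abs_integral_norm (f := F')).trans ?_
    have : ∀ s t : ℝ, -b ≤ s → s ≤ t → t ≤ b →
        |∫ x in s..t, ‖F' x‖| ≤ ∫ x in (-b)..b, |F' x| := by
      intro s t hs hst ht
      rw [abs_of_nonneg (integral_nonneg hst (fun x _ => norm_nonneg _))]
      exact integral_mono_interval hs hst ht (Filter.Eventually.of_forall fun x => abs_nonneg _)
        (cF'.abs.intervalIntegrable _ _)
    rcases le_total x0 x1 with hle | hle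
    · exact this _ _ hx0.1 hle hx1.2
    · rw [integral_symm, abs_neg]
      exact this _ _ hx1.1 hle hx0.2
  have h2 : ∫ x in (-b)..b, |F' x| ≤ ∫ x in (-b)..b,
      ((2 * (‖f x‖ * ‖v x‖) + 2 * G * (q * W x * ‖u x‖ ^ 2)) + m / (2 * G) * (q * W x)) := by
    refine mono hbb (cF'.abs.intervalIntegrable _ _)
      ((((iF _ _).const_mul _).add ((iW _ _).const_mul _)).add ((iW1 _ _).const_mul _))
      (fun x hx => ?_)
    have e1 := hm' x hx
    have c1 := cs (f x) (v x)
    have c2 := cs' (u x) (v x)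
    have hqW : 0 ≤ q * W x := mul_nonneg hq.le (h.hW0 x)
    have hF : F' x = -2 * ((f x).re * (v x).re + (f x).im * (v x).im)
      - 2 * (q * W x) * ((u x).im * (v x).re - (u x).re * (v x).im) := by
      simp only [F']; rw [h.fre, h.fim]; ring
    rw [hF]
    have t1 : |(-2) * ((f x).re * (v x).re + (f x).im * (v x).im)
      - 2 * (q * W x) * ((u x).im * (v x).re - (u x).re * (v x).im)| ≤
      2 * (‖f x‖ * ‖v x‖) + 2 * (q * W x) * (‖u x‖ * ‖v x‖) := by
      refine (abs_sub _ _).trans ?_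
      rw [abs_mul, abs_mul (2 * (q * W x)), abs_of_nonneg (by positivity : 0 ≤ 2 * (q * W x))]
      norm_num
      gcongr
    refine t1.trans ?_
    have t2 : 2 * (‖u x‖ * ‖v x‖) ≤ 2 * G * ‖u x‖ ^ 2 + m / (2 * G) := by
      have : ‖v x‖ ^ 2 ≤ m := by nlinarith [sq_nonneg (‖u x‖)]
      have e : 2 * (‖u x‖ * ‖v x‖) ≤ 2 * G * ‖u x‖ ^ 2 + ‖v x‖ ^ 2 / (2 * G) := by
        have : 2 * G * ‖u x‖ ^ 2 + ‖v x‖ ^ 2 / (2 * G) - 2 * (‖u x‖ * ‖v x‖)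
          = (2 * G * ‖u x‖ - ‖v x‖) ^ 2 / (2 * G) := by field_simp; ring
        have : 0 ≤ (2 * G * ‖u x‖ - ‖v x‖) ^ 2 / (2 * G) := by positivity
        linarith
      have : ‖v x‖ ^ 2 / (2 * G) ≤ m / (2 * G) := by gcongr
      linarith
    have := mul_le_mul_of_nonneg_left t2 hqW
    linarith
  rw [integral_add (((iF _ _).const_mul _).add ((iW _ _).const_mul _)) ((iW1 _ _).const_mul _),
    integral_add ((iF _ _).const_mul _) ((iW _ _).const_mul _),
    intervalIntegral.integral_const_mul, intervalIntegral.integral_const_mul,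
    intervalIntegral.integral_const_mul] at h2
  have hpb : -π ≤ -b := by linarith
  have g1 : ∫ x in (-b)..b, q * W x * ‖u x‖ ^ 2 ≤ ∫ x in (-π)..π, ‖f x‖ * ‖u x‖ :=
    (sub_le iW (fun x => mul_nonneg (mul_nonneg hq.le (h.hW0 x)) (by positivity))
      hpb hbb hb).trans h.est_im
  have g2 : ∫ x in (-b)..b, ‖f x‖ * ‖v x‖ ≤ ∫ x in (-π)..π, ‖f x‖ * ‖v x‖ :=
    sub_le iF (fun x => by positivity) hpb hbb hb
  have hm0 : 0 ≤ m := by positivity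
  have g3 : m / (2 * G) * (∫ x in (-b)..b, q * W x) ≤ m / 2 := by
    have := mul_le_mul_of_nonneg_left hWG (by positivity : 0 ≤ m / (2 * G))
    have e : m / (2 * G) * G = m / 2 := by field_simp
    linarith
  have g4 := mul_le_mul_of_nonneg_left g1 (by positivity : 0 ≤ 2 * G)
  have h3 := le_abs_self (∫ x in x0..x1, F' x)
  have h0' : ∫ x in x0..x1, F' x = m - (‖v x0‖ ^ 2 + E * ‖u x0‖ ^ 2) := h0
  linarith

/-- combination -/
lemma combine (h : Data u v w f W q E) {a b G w0 : ℝ} (ha0 : 0 < a) (hab : a < b) (hb : b ≤ π)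
    (hG : 0 < G) (hWG : ∫ x in (-b)..b, q * W x ≤ G) (hw0 : 0 < w0)
    (hW : ∀ x ∈ Set.Icc (-π) π, a ≤ |x| → w0 ≤ W x) :
    E * ∫ x in (-π)..π, ‖u x‖ ^ 2 ≤
      (240 * π * ((2 / (b - a) ^ 3 + 3 / 2 * E / (b - a)) / (q * w0) + 1 / (b - a)) + 8 * π * G
        + E / (q * w0)) * (∫ x in (-π)..π, ‖f x‖ * ‖u x‖)
        + 8 * π * (∫ x in (-π)..π, ‖f x‖ * ‖v x‖) := by
  have hu := h.cu
  have hq := h.hq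
  have hE := h.hE
  have hpi := Real.pi_pos
  obtain ⟨x0, hx0, hgood⟩ := h.good_point (a := a) (b := b) (by linarith) hab hb hw0
    (fun x hx => hW x ⟨by linarith [hx.1], by linarith [hx.2]⟩
      (by rw [abs_of_pos (by linarith [hx.1])]; exact hx.1))
  have hprop := h.propagate (b := b) (x0 := x0) (by linarith) hb hG hWG
    ⟨by linarith [hx0.1], hx0.2⟩
  set A := ∫ x in (-π)..π, ‖f x‖ * ‖u x‖ with hA
  set B := ∫ x in (-π)..π, ‖f x‖ * ‖v x‖ with hB
  set m0 := ‖v x0‖ ^ 2 + E * ‖u x0‖ ^ 2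
  set m := 2 * m0 + 4 * B + 4 * G * A with hm
  have hm0 : 0 ≤ m := by
    refine le_trans ?_ (hprop 0 ⟨by linarith, by linarith⟩)
    positivity
  have iW := h.iiWg (g := fun x => ‖u x‖ ^ 2) (by fun_prop)
  have hba : 0 < b - a := by linarith
  have hm0' : m0 ≤ 60 * ((2 / (b - a) ^ 3 + 3 / 2 * E / (b - a)) / (q * w0) + 1 / (b - a)) * A := by
    have e : 60 * ((2 / (b - a) ^ 3 + 3 / 2 * E / (b - a)) / (q * w0) + 1 / (b - a)) * A =
      (((2 * (b - a) ^ 2 + 3 / 2 * E * (b - a) ^ 4) / (q * w0) + (b - a) ^ 4) * A)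
        / ((b - a) ^ 5 / 60) := by field_simp
    rw [e, le_div_iff₀ (by positivity)]
    exact hgood
  have key : ∫ x in (-π)..π, E * ‖u x‖ ^ 2 ≤
      ∫ x in (-π)..π, (m + E / (q * w0) * (q * W x * ‖u x‖ ^ 2)) := by
    refine mono pipi (Continuous.intervalIntegrable (by fun_prop) _ _)
      ((_root_.intervalIntegrable_const).add ((iW _ _).const_mul _)) (fun x hx => ?_)
    have hqW : 0 ≤ q * W x := mul_nonneg hq.le (h.hW0 x)
    rcases le_total a (|x|) with hax | hax
    · have := hW x hx hax
      have e : E / (q * w0) * (q * w0 * ‖u x‖ ^ 2) = E * ‖u x‖ ^ 2 := by field_simp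
      have : E / (q * w0) * (q * w0 * ‖u x‖ ^ 2) ≤ E / (q * w0) * (q * W x * ‖u x‖ ^ 2) := by
        gcongr
      linarith
    · have hxx := abs_le.1 hax
      have := hprop x ⟨by linarith, by linarith⟩
      have : 0 ≤ E / (q * w0) * (q * W x * ‖u x‖ ^ 2) := by positivity
      nlinarith [sq_nonneg (‖v x‖)]
  rw [integral_add (_root_.intervalIntegrable_const) ((iW _ _).const_mul _),
    intervalIntegral.integral_const_mul, intervalIntegral.integral_const_mul,
    intervalIntegral.integral_const] at key
  have g1 := mul_le_mul_of_nonneg_left h.est_im (by positivity : 0 ≤ E / (q * w0))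
  have e : (π - -π) • m = 2 * π * m := by rw [smul_eq_mul]; ring
  rw [e] at key
  have g2 := mul_le_mul_of_nonneg_left hm0' (by positivity : 0 ≤ 4 * π)
  have : 2 * π * m = 4 * π * m0 + 8 * π * B + 8 * π * G * A := by rw [hm]; ring
  rw [this] at key
  linarith

lemma young (h : Data u v w f W q E) {g : ℝ → ℂ} (hg : Continuous g) {t : ℝ} (ht : 0 < t) :
    2 * ∫ x in (-π)..π, ‖f x‖ * ‖g x‖ ≤
      t * (∫ x in (-π)..π, ‖g x‖ ^ 2) + t⁻¹ * ∫ x in (-π)..π, ‖f x‖ ^ 2 := by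
  have i1 : IntervalIntegrable (fun x => ‖g x‖ ^ 2) volume (-π) π :=
    Continuous.intervalIntegrable (by fun_prop) _ _
  rw [← intervalIntegral.integral_const_mul, ← intervalIntegral.integral_const_mul,
    ← intervalIntegral.integral_const_mul, ← integral_add (i1.const_mul _)
      ((h.iiff _ _).const_mul _)]
  refine mono pipi ((h.iifg hg.norm _ _).const_mul _)
    ((i1.const_mul _).add ((h.iiff _ _).const_mul _)) (fun x _ => ?_)
  have : t * ‖g x‖ ^ 2 + t⁻¹ * ‖f x‖ ^ 2 - 2 * (‖f x‖ * ‖g x‖) = (t * ‖g x‖ - ‖f x‖) ^ 2 / t := by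
    field_simp; ring
  have : 0 ≤ (t * ‖g x‖ - ‖f x‖) ^ 2 / t := by positivity
  linarith

/-- final absorption -/
lemma absorb (h : Data u v w f W q E) {C1 d : ℝ} (hE1 : 1 ≤ E) (hd : 1 ≤ d) (hC1 : 0 ≤ C1)
    (hmain : E * ∫ x in (-π)..π, ‖u x‖ ^ 2 ≤
      C1 * (√E * d) * (∫ x in (-π)..π, ‖f x‖ * ‖u x‖)
        + 8 * π * (∫ x in (-π)..π, ‖f x‖ * ‖v x‖)) :
    ∫ x in (-π)..π, ‖u x‖ ^ 2 ≤
      (2 * ((C1 + 1) ^ 2 + 64 * π ^ 2)) * E⁻¹ * d ^ 2 * ∫ x in (-π)..π, ‖f x‖ ^ 2 := by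
  have hpi := Real.pi_pos
  have hsE : 1 ≤ √E := by rw [Real.one_le_sqrt]; exact hE1
  have hsq : √E ^ 2 = E := Real.sq_sqrt (by linarith)
  set K := √E * d with hK
  have hK1 : 1 ≤ K := by nlinarith
  have hK2 : K ^ 2 = E * d ^ 2 := by rw [hK, mul_pow, hsq]
  have hre := h.est_re
  have y1 := h.young h.cu (t := E / (2 * (C1 + 1) * K)) (by positivity)
  have y2 := h.young h.cv (t := 1 / (16 * π)) (by positivity)
  have hA : 0 ≤ ∫ x in (-π)..π, ‖f x‖ * ‖u x‖ :=
    integral_nonneg pipi (fun x _ => by positivity)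
  have hY : 0 ≤ ∫ x in (-π)..π, ‖f x‖ ^ 2 :=
    integral_nonneg pipi (fun x _ => by positivity)
  set A := ∫ x in (-π)..π, ‖f x‖ * ‖u x‖
  set B := ∫ x in (-π)..π, ‖f x‖ * ‖v x‖
  set X := ∫ x in (-π)..π, ‖u x‖ ^ 2
  set Y := ∫ x in (-π)..π, ‖f x‖ ^ 2
  set V := ∫ x in (-π)..π, ‖v x‖ ^ 2
  have z2 : 8 * π * B ≤ V / 4 + 64 * π ^ 2 * Y := by
    have := mul_le_mul_of_nonneg_left y2 (by positivity : 0 ≤ 4 * π)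
    have e : 4 * π * (1 / (16 * π) * V + (1 / (16 * π))⁻¹ * Y) = V / 4 + 64 * π ^ 2 * Y := by
      field_simp; ring
    linarith
  have z1 : (C1 + 1) * K * A ≤ E * X / 4 + (C1 + 1) ^ 2 * d ^ 2 * Y := by
    have := mul_le_mul_of_nonneg_left y1 (by positivity : 0 ≤ (C1 + 1) * K / 2)
    have e : (C1 + 1) * K / 2 * (E / (2 * (C1 + 1) * K) * X + (E / (2 * (C1 + 1) * K))⁻¹ * Y)
      = E * X / 4 + (C1 + 1) ^ 2 * (K ^ 2 / E) * Y := by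
      field_simp; ring
    rw [e, hK2, mul_div_cancel_left₀ _ (by positivity : E ≠ 0)] at this
    linarith
  have z3 : A / 4 ≤ K * A := by nlinarith
  have z4 : 64 * π ^ 2 * Y ≤ 64 * π ^ 2 * Y * d ^ 2 :=
    le_mul_of_one_le_right (by positivity) (by nlinarith)
  have fin : E * X ≤ 2 * ((C1 + 1) ^ 2 + 64 * π ^ 2) * d ^ 2 * Y := by linarith
  have e : (2 * ((C1 + 1) ^ 2 + 64 * π ^ 2)) * E⁻¹ * d ^ 2 * Y =
    (2 * ((C1 + 1) ^ 2 + 64 * π ^ 2) * d ^ 2 * Y) / E := by field_simp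
  rw [e, le_div_iff₀ (by positivity)]
  linarith

end Data
end DW

namespace DW

lemma alg {c cp C₀ r d s mx E q w0 tb G : ℝ} (hc : 0 < c) (hcp : 0 < cp) (hC₀ : 0 < C₀)
    (hr : 0 < r) (hrc : r ≤ c) (hrd : 1 / r ≤ d / c) (hd : 1 ≤ d) (hs : 1 ≤ s)
    (hsm : s ≤ mx) (hdm : d ≤ mx) (hmx : mx ≤ s * d) (hE : E = s ^ 2) (htb : 0 < tb)
    (hq : 0 < q)
    (hw0 : q * w0 = cp * mx / (C₀ * r)) (hG : G = 4 * C₀ * tb * (cp * mx)) :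
    240 * π * ((2 / r ^ 3 + 3 / 2 * E / r) / (q * w0) + 1 / r) + 8 * π * G + E / (q * w0)
      ≤ (240 * π * (C₀ * (2 / (c ^ 2 * cp) + 3 / 2 / cp) + 1 / c) + 8 * π * (4 * C₀ * tb * cp)
        + C₀ * c / cp) * (s * d) := by
  have hpi := Real.pi_pos
  have hm : 0 < mx := by linarith
  have hsK : s ≤ s * d := by nlinarith
  have hdK : d ≤ s * d := by nlinarith
  have e1 : (2 / r ^ 3 + 3 / 2 * E / r) / (q * w0)
      = C₀ * (2 * (1 / r) ^ 2 / (cp * mx) + 3 / 2 * (E / mx) / cp) := by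
    rw [hw0]; field_simp
  have e2 : E / (q * w0) = C₀ * r / cp * (E / mx) := by rw [hw0]; field_simp
  have b1 : E / mx ≤ s * d := by
    rw [div_le_iff₀ hm, hE]; nlinarith
  have b2 : 2 * (1 / r) ^ 2 / (cp * mx) ≤ 2 / (c ^ 2 * cp) * (s * d) := by
    calc 2 * (1 / r) ^ 2 / (cp * mx) ≤ 2 * (d / c) ^ 2 / (cp * d) := by gcongr
      _ = 2 / (c ^ 2 * cp) * d := by field_simp
      _ ≤ _ := by gcongr
  have b3 : 3 / 2 * (E / mx) / cp ≤ 3 / 2 / cp * (s * d) := by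
    calc 3 / 2 * (E / mx) / cp ≤ 3 / 2 * (s * d) / cp := by gcongr
      _ = _ := by ring
  have b4 : 1 / r ≤ 1 / c * (s * d) := by
    calc 1 / r ≤ d / c := hrd
      _ = 1 / c * d := by ring
      _ ≤ _ := by gcongr
  have hE0 : 0 ≤ E := by rw [hE]; positivity
  have b5 : C₀ * r / cp * (E / mx) ≤ C₀ * c / cp * (s * d) := by gcongr
  have b6 : G ≤ 4 * C₀ * tb * cp * (s * d) := by
    rw [hG, mul_assoc _ cp]; gcongr
  rw [e1, e2]
  calc _ ≤ 240 * π * (C₀ * (2 / (c ^ 2 * cp) * (s * d) + 3 / 2 / cp * (s * d)) + 1 / c * (s * d))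
      + 8 * π * (4 * C₀ * tb * cp * (s * d)) + C₀ * c / cp * (s * d) := by gcongr
    _ = _ := by ring

lemma int_le {W : ℝ → ℝ} {q σ b w1 : ℝ} (hσ : 0 < σ) (hb : σ ≤ b)
    (hi : ∀ a b, IntervalIntegrable (fun x => q * W x) volume a b)
    (h0 : ∀ x, |x| ≤ σ → q * W x ≤ 0) (h1 : ∀ x, |x| ≤ b → q * W x ≤ w1) :
    ∫ x in (-b)..b, q * W x ≤ 2 * (b - σ) * w1 := by
  rw [← integral_add_adjacent_intervals (hi (-b) σ) (hi σ b),
    ← integral_add_adjacent_intervals (hi (-b) (-σ)) (hi (-σ) σ)]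
  have k1 : ∫ x in (-b)..(-σ), q * W x ≤ ∫ x in (-b)..(-σ), w1 :=
    Data.mono (by linarith) (hi _ _) _root_.intervalIntegrable_const
      (fun x hx => h1 x (abs_le.2 ⟨hx.1, by linarith [hx.2]⟩))
  have k2 : ∫ x in (-σ)..σ, q * W x ≤ ∫ x in (-σ)..σ, (0 : ℝ) :=
    Data.mono (by linarith) (hi _ _) _root_.intervalIntegrable_const
      (fun x hx => h0 x (abs_le.2 ⟨hx.1, hx.2⟩))
  have k3 : ∫ x in σ..b, q * W x ≤ ∫ x in σ..b, w1 :=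
    Data.mono (by linarith) (hi _ _) _root_.intervalIntegrable_const
      (fun x hx => h1 x (abs_le.2 ⟨by linarith [hx.1], hx.2⟩))
  simp only [intervalIntegral.integral_const, smul_eq_mul, mul_zero] at k1 k2 k3
  linarith

end DW

set_option maxHeartbeats 2000000

/-- The main high-energy estimate: there are `E₀, C, q₀ > 0` depending only on
`C₀, σ, β` such that for `q ≥ q₀`, `E₀ ≤ E ≤ q²`, and `u, f` with
`f = -u'' + iqWu - Eu`, one has `∫ |u|² ≤ C E⁻¹ q^{2/(β+2)} ∫ |f|²`. -/
theorem damped_wave_high_energy_estimate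
    (C₀ σ β : ℝ) (hC₀ : 0 < C₀) (hσ : σ ∈ Set.Ioo 0 π) (hβ : 0 ≤ β) :
    ∃ E₀ > (0 : ℝ), ∃ C > (0 : ℝ), ∃ q₀ > (0 : ℝ),
      ∀ (W : ℝ → ℝ), Function.Periodic W (2 * π) → Measurable W →
        (∃ M : ℝ, ∀ x : ℝ, W x ≤ M) → (∀ x : ℝ, 0 ≤ W x) →
        (∀ x ∈ Set.Icc (-π) π,
          dampV σ β x / C₀ ≤ W x ∧ W x ≤ C₀ * dampV σ β x) →
        ∀ q ≥ q₀, ∀ E : ℝ, E₀ ≤ E → E ≤ q ^ 2 →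
          ∀ (u f : ℝ → ℂ), ContDiff ℝ 2 u → Function.Periodic u (2 * π) →
            (∀ x : ℝ,
              f x = -(deriv (deriv u) x) + Complex.I * q * W x * u x - E * u x) →
            ∫ x in (-π)..π, ‖u x‖ ^ 2 ≤
              C * E⁻¹ * q ^ ((2 : ℝ) / (β + 2)) * ∫ x in (-π)..π, ‖f x‖ ^ 2 := by
  obtain ⟨hσ0, hσπ⟩ := hσ
  have hpi := Real.pi_pos
  set c := (π - σ) / 2 with hc
  have hc0 : 0 < c := by rw [hc]; linarith
  set cp := c ^ (β + 1) with hcp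
  have hcp0 : 0 < cp := Real.rpow_pos_of_pos hc0 _
  set tb := (2 : ℝ) ^ β with htb
  have htb0 : 0 < tb := Real.rpow_pos_of_pos two_pos _
  set C1 := (240 * π * (C₀ * (2 / (c ^ 2 * cp) + 3 / 2 / cp) + 1 / c) + 8 * π * (4 * C₀ * tb * cp)
        + C₀ * c / cp) with hC1
  have hC10 : 0 ≤ C1 := by positivity
  refine ⟨1, one_pos, 2 * ((C1 + 1) ^ 2 + 64 * π ^ 2), by positivity, 1, one_pos, ?_⟩
  intro W _ hWm hWb hW0 hWV q hq E hE1 hEq u f hu hper hf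
  have hq1 : 1 ≤ q := hq
  have hq0 : 0 < q := by linarith
  have hu1 : ContDiff ℝ 1 (deriv u) := by
    have : ContDiff ℝ (1 + 1) u := by simpa [one_add_one_eq_two] using hu
    exact (contDiff_succ_iff_deriv.1 this).2.2
  have hperd : deriv u (-π) = deriv u π := by
    have : (fun x => u (x + 2 * π)) = u := funext hper
    have h2 := deriv_comp_add_const (f := u) (2 * π) (-π)
    rw [this] at h2
    rw [h2]; congr 1; ring
  have D : DW.Data u (deriv u) (deriv (deriv u)) f W q E :=
    { hu := fun x => (hu.differentiable (by norm_num) x).hasDerivAt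
      hv := fun x => (hu1.differentiable (by norm_num) x).hasDerivAt
      hw := hu1.continuous_deriv (by norm_num)
      hWm := hWm
      hWb := hWb
      hW0 := hW0
      hq := hq0
      hE := by linarith
      hf := hf
      pu := by rw [← hper (-π)]; congr 1; ring
      pv := hperd }
  set d := q ^ ((1 : ℝ) / (β + 2)) with hd
  have hd1 : 1 ≤ d := Real.one_le_rpow hq1 (by positivity)
  have hd0 : 0 < d := by linarith
  have hdq : d ^ (β + 2) = q := by
    rw [hd, ← Real.rpow_mul hq0.le, one_div, inv_mul_cancel₀ (by positivity), Real.rpow_one]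
  have hdq' : d ≤ q := by
    rw [hd]
    calc q ^ ((1 : ℝ) / (β + 2)) ≤ q ^ (1 : ℝ) := by
          apply Real.rpow_le_rpow_of_exponent_le hq1
          rw [div_le_one (by positivity)]; linarith
      _ = q := Real.rpow_one q
  have hd2 : q ^ ((2 : ℝ) / (β + 2)) = d ^ 2 := by
    rw [hd, ← Real.rpow_natCast, ← Real.rpow_mul hq0.le]; congr 1; push_cast; ring
  have hs1 : 1 ≤ √E := by rw [Real.one_le_sqrt]; exact hE1
  have hsE : E = √E ^ 2 := (Real.sq_sqrt (by linarith)).symm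
  have hsq : √E ≤ q := by rw [Real.sqrt_le_left hq0.le]; exact hEq
  set mx := max (√E) d with hmx
  have hsm : √E ≤ mx := le_max_left _ _
  have hdm : d ≤ mx := le_max_right _ _
  have hmxK : mx ≤ √E * d := max_le (by nlinarith) (by nlinarith)
  have hmxq : mx ≤ q := max_le hsq hdq'
  have hmx0 : 0 < mx := by linarith
  set r0 := (mx / q) ^ ((1 : ℝ) / (β + 1)) with hr0
  have hr00 : 0 < r0 := Real.rpow_pos_of_pos (by positivity) _
  have hr0p : r0 ^ (β + 1) = mx / q := by
    rw [hr0, ← Real.rpow_mul (by positivity), one_div, inv_mul_cancel₀ (by positivity),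
      Real.rpow_one]
  have hr01 : r0 ≤ 1 := Real.rpow_le_one (by positivity) (by rw [div_le_one hq0]; exact hmxq)
    (by positivity)
  have hr0d : 1 / d ≤ r0 := by
    by_contra hcon
    push Not at hcon
    have := Real.rpow_lt_rpow hr00.le hcon (by positivity : 0 < β + 1)
    rw [hr0p, Real.div_rpow zero_le_one hd0.le, Real.one_rpow] at this
    have e : d ^ (β + 1) * d = q := by
      rw [← hdq, ← Real.rpow_add_one hd0.ne']; congr 1; ring
    have hdp : 0 < d ^ (β + 1) := Real.rpow_pos_of_pos hd0 _
    rw [div_lt_div_iff₀ hq0 hdp] at this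
    nlinarith
  set r := c * r0 with hr
  have hr_pos : 0 < r := by positivity
  have hrc : r ≤ c := by rw [hr]; nlinarith
  have hrp : q * (r ^ β * r) = cp * mx := by
    rw [← Real.rpow_add_one hr_pos.ne', hr, Real.mul_rpow hc0.le hr00.le, hr0p, ← hcp]
    field_simp
  have hrd : 1 / r ≤ d / c := by
    rw [div_le_iff₀ hd0] at hr0d
    rw [div_le_div_iff₀ hr_pos hc0, hr]
    have := mul_le_mul_of_nonneg_left hr0d hc0.le
    linarith
  have hrb : 0 < r ^ β := Real.rpow_pos_of_pos hr_pos _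
  have hbπ : σ + 2 * r ≤ π := by
    have : 2 * c = π - σ := by rw [hc]; ring
    linarith
  have iW1 : ∀ a b, IntervalIntegrable (fun x => q * W x) volume a b := fun a b => by
    simpa using D.iiWg (g := fun _ => 1) continuous_const a b
  have hWG : ∫ x in (-(σ + 2 * r))..(σ + 2 * r), q * W x ≤ 4 * C₀ * tb * (cp * mx) := by
    refine (DW.int_le (w1 := q * (C₀ * (2 * r) ^ β)) hσ0 (by linarith) iW1 ?_ ?_).trans ?_
    · intro x hx
      have hxx := abs_le.1 hx
      have := (hWV x ⟨by linarith, by linarith⟩).2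
      rw [dampV, if_pos hx, mul_zero] at this
      nlinarith
    · intro x hx
      have hxx := abs_le.1 hx
      have := (hWV x ⟨by linarith, by linarith⟩).2
      refine mul_le_mul_of_nonneg_left (this.trans ?_) hq0.le
      refine mul_le_mul_of_nonneg_left ?_ hC₀.le
      rw [dampV]
      split_ifs with hxs
      · positivity
      · push Not at hxs
        exact Real.rpow_le_rpow (by linarith) (by linarith) hβ
    · rw [Real.mul_rpow two_pos.le hr_pos.le, ← hrp]
      apply le_of_eq; ring
  have main := D.combine (a := σ + r) (b := σ + 2 * r) (G := 4 * C₀ * tb * (cp * mx))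
    (w0 := r ^ β / C₀) (by linarith) (by linarith) hbπ (by positivity) hWG (by positivity) ?_
  · have hba : σ + 2 * r - (σ + r) = r := by ring
    rw [hba] at main
    have hA : 0 ≤ ∫ x in (-π)..π, ‖f x‖ * ‖u x‖ :=
      integral_nonneg (by linarith) (fun x _ => by positivity)
    have al := DW.alg (w0 := r ^ β / C₀) (G := 4 * C₀ * tb * (cp * mx)) hc0 hcp0 hC₀ hr_pos hrc
      hrd hd1 hs1 hsm hdm hmxK hsE htb0 hq0 (by rw [← hrp]; field_simp) rfl
    have fin := D.absorb hE1 hd1 hC10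
      (main.trans (add_le_add (mul_le_mul_of_nonneg_right al hA) le_rfl))
    rw [hd2]
    exact fin
  · intro x hx hax
    refine le_trans ?_ (hWV x hx).1
    rw [dampV, if_neg (by push Not; linarith)]
    gcongr
    linarith
end
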